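/- Let Ω = ℝ^d and assume F = G + τH is convex and G satisfies Assumption (A-ii). Let (μ_t)_{t≥0} be a Wasserstein gradient flow of F starting from μ₀ ∈ P₂(ℝ^d). Suppose there exist σ₁ > 0, σ₂ ∈ [σ₁, √2·σ₁), and m, M > 0 such that for all t ≥ 0 the density of μ_t satisfies m·γ₁ ≤ μ_t ≤ M·γ₂ pointwise, where γ_i = N(0, σ_i²I). Then for all t ≥ 0, F(μ_t) − inf F ≤ ( (F(μ₀) − inf F)⁻¹ + m² t/(4CM²σ₁²) )⁻¹, where C = (2α − α²)^{−d/2} and α = σ₂²/σ₁². -/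

import Mathlib

open MeasureTheory ProbabilityTheory Real Set
open scoped ENNReal NNReal RealInnerProductSpace

noncomputable section
attribute [local instance] Classical.propDecidable

abbrev Ed (d : ℕ) := EuclideanSpace ℝ (Fin d)

def negEnt {d : ℕ} (μ : Measure (Ed d)) : EReal :=
  if μ ≪ (volume : Measure (Ed d)) ∧
      Integrable (fun x => ((μ.rnDeriv volume x).toReal) * Real.log ((μ.rnDeriv volume x).toReal)) volume
  then ((∫ x, ((μ.rnDeriv volume x).toReal) * Real.log ((μ.rnDeriv volume x).toReal) : ℝ) : EReal)
  else ⊤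

def IsP2 {d : ℕ} (μ : Measure (Ed d)) : Prop :=
  IsProbabilityMeasure μ ∧ Integrable (fun x => ‖x‖ ^ 2) μ

def mix {d : ℕ} (t : ℝ) (μ ν : Measure (Ed d)) : Measure (Ed d) :=
  ENNReal.ofReal (1 - t) • μ + ENNReal.ofReal t • ν

def ConvexFun {d : ℕ} (F : Measure (Ed d) → EReal) : Prop :=
  ∀ ⦃μ ν : Measure (Ed d)⦄, IsP2 μ → IsP2 ν → ∀ ⦃t : ℝ⦄, 0 ≤ t → t ≤ 1 →
    F (mix t μ ν) ≤ ((1 - t : ℝ) : EReal) * F μ + ((t : ℝ) : EReal) * F ν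

def obj {d : ℕ} (G : Measure (Ed d) → ℝ) (τ : ℝ) (μ : Measure (Ed d)) : EReal :=
  (G μ : EReal) + (τ : EReal) * negEnt μ

def tauC {d : ℕ} (G : Measure (Ed d) → ℝ) : ℝ :=
  sInf {τ' : ℝ | 0 ≤ τ' ∧ ConvexFun (obj G τ')}

def IsFirstVariation {d : ℕ} (G : Measure (Ed d) → ℝ) (μ : Measure (Ed d)) (g : Ed d → ℝ) : Prop :=
  ∀ ν : Measure (Ed d), IsP2 ν →
    HasDerivWithinAt (fun t : ℝ => G (mix t μ ν)) ((∫ x, g x ∂ν) - ∫ x, g x ∂μ) (Set.Ici (0:ℝ)) 0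

def AssumptionAii {d : ℕ} (G : Measure (Ed d) → ℝ) (G' : Measure (Ed d) → Ed d → ℝ)
    (α L : ℝ) : Prop :=
  ∀ μ : Measure (Ed d), IsP2 μ → IsFirstVariation G μ (G' μ) ∧ ContDiff ℝ 1 (G' μ) ∧
    ∃ V : Ed d → ℝ, (∀ x, G' μ x = α / 2 * ‖x‖ ^ 2 + V x) ∧ ∀ x, ‖gradient V x‖ ≤ L

def lap {d : ℕ} (f : Ed d → ℝ) (x : Ed d) : ℝ :=
  ∑ i : Fin d, iteratedFDeriv ℝ 2 f x ![EuclideanSpace.single i 1, EuclideanSpace.single i 1]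

structure IsWGF {d : ℕ} (G : Measure (Ed d) → ℝ) (G' : Measure (Ed d) → Ed d → ℝ) (τ : ℝ)
    (μ : ℝ → Measure (Ed d)) (ρ : ℝ → Ed d → ℝ) : Prop where
  isP2 : ∀ t : ℝ, 0 ≤ t → IsP2 (μ t)
  density_eq : ∀ t : ℝ, 0 < t → μ t = volume.withDensity (fun x => ENNReal.ofReal (ρ t x))
  density_pos : ∀ t : ℝ, 0 < t → ∀ x, 0 < ρ t x
  pde : ∀ φ : Ed d → ℝ, ContDiff ℝ (⊤ : ℕ∞) φ → HasCompactSupport φ →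
    ∀ t₁ t₂ : ℝ, 0 ≤ t₁ → t₁ ≤ t₂ →
      (∫ x, φ x ∂(μ t₂)) - (∫ x, φ x ∂(μ t₁))
        = ∫ s in t₁..t₂,
            ∫ x, (- ⟪gradient φ x, gradient (G' (μ s)) x⟫ + τ * lap φ x) ∂(μ s)
  finite : ∀ t : ℝ, 0 ≤ t → obj G τ (μ t) ≠ ⊤ ∧ obj G τ (μ t) ≠ ⊥
  dissipation : ∀ t₁ t₂ : ℝ, 0 ≤ t₁ → t₁ < t₂ →
    (obj G τ (μ t₂)).toReal - (obj G τ (μ t₁)).toReal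
      = - ∫ s in t₁..t₂,
            ∫ x, ‖gradient (G' (μ s)) x
                  + τ • gradient (fun y => Real.log (ρ s y)) x‖ ^ 2 ∂(μ s)

def infObj {d : ℕ} (G : Measure (Ed d) → ℝ) (τ : ℝ) : EReal :=
  ⨅ ν : {ν : Measure (Ed d) // IsP2 ν}, obj G τ ν.1

def gap {d : ℕ} (G : Measure (Ed d) → ℝ) (τ : ℝ) (μ : ℝ → Measure (Ed d)) (t : ℝ) : ℝ :=
  (obj G τ (μ t) - infObj G τ).toReal

def IsSubgaussian {d : ℕ} (M₀ : ℝ) (μ : Measure (Ed d)) : Prop :=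
  ∫ x, Real.exp (‖x‖ ^ 2 / M₀ ^ 2) ∂μ ≤ 2

/-- The centered isotropic Gaussian density on `ℝ^d` with standard deviation `σ`. -/
def gaussDen (d : ℕ) (σ : ℝ) (x : Ed d) : ℝ :=
  (2 * π * σ ^ 2) ^ (-(d : ℝ) / 2) * Real.exp (-‖x‖ ^ 2 / (2 * σ ^ 2))

section ModA1
def kk {d : ℕ} (s : ℝ) (x : Ed d) : ℝ :=
  (2 * π * s) ^ (-(d : ℝ) / 2) * Real.exp (-‖x‖ ^ 2 / (2 * s))

def om {d : ℕ} (x : Ed d) : ℝ := 1 + ‖x‖ ^ 2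

theorem om_pos {d : ℕ} (x : Ed d) : 0 < om x := by unfold om; positivity
theorem one_le_om {d : ℕ} (x : Ed d) : 1 ≤ om x := by unfold om; nlinarith [sq_nonneg ‖x‖]
theorem om_cont {d : ℕ} : Continuous (om : Ed d → ℝ) := by unfold om; fun_prop

theorem gaussDen_eq {d : ℕ} (σ : ℝ) (x : Ed d) : gaussDen d σ x = kk (σ ^ 2) x := rfl

theorem kk_pos {d : ℕ} {s : ℝ} (hs : 0 < s) (x : Ed d) : 0 < kk s x := by
  unfold kk; positivity

theorem kk_neg {d : ℕ} (s : ℝ) (x : Ed d) : kk s (-x) = kk s x := by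
  unfold kk; rw [norm_neg]

theorem kk_sub_comm {d : ℕ} (s : ℝ) (x y : Ed d) : kk s (x - y) = kk s (y - x) := by
  rw [← kk_neg, neg_sub]

theorem kk_cont {d : ℕ} (s : ℝ) : Continuous (kk s : Ed d → ℝ) := by
  unfold kk; fun_prop

theorem exp_form {d : ℕ} (s : ℝ) (x : Ed d) :
    Real.exp (-‖x‖ ^ 2 / (2 * s)) = Real.exp (-(1 / (2 * s)) * ‖x‖ ^ 2) := by
  congr 1; ring

theorem integrable_gexp {d : ℕ} {c : ℝ} (hc : 0 < c) :
    Integrable (fun x : Ed d => Real.exp (-c * ‖x‖ ^ 2)) := by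
  by_contra h
  have h1 := GaussianFourier.integral_rexp_neg_mul_sq_norm (V := Ed d) hc
  rw [integral_undef h] at h1
  have : (0:ℝ) < (π / c) ^ (Module.finrank ℝ (Ed d) / 2 : ℝ) := by positivity
  linarith

theorem kk_int {d : ℕ} {s : ℝ} (hs : 0 < s) : Integrable (kk s : Ed d → ℝ) := by
  unfold kk
  simp_rw [exp_form]
  exact (integrable_gexp (by positivity)).const_mul _

theorem kk_integral {d : ℕ} {s : ℝ} (hs : 0 < s) : ∫ x : Ed d, kk s x = 1 := by
  unfold kk
  simp_rw [exp_form]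
  rw [integral_const_mul, GaussianFourier.integral_rexp_neg_mul_sq_norm (by positivity)]
  have : π / (1 / (2 * s)) = 2 * π * s := by field_simp
  rw [this, finrank_euclideanSpace_fin, ← rpow_add (by positivity)]
  have : -(d:ℝ) / 2 + d / 2 = 0 := by ring
  rw [this, rpow_zero]

theorem kk_le {d : ℕ} {s s' : ℝ} (hs : 0 < s) (h : s ≤ s') (x : Ed d) :
    kk s x ≤ (s' / s) ^ ((d : ℝ) / 2) * kk s' x := by
  have hs' : 0 < s' := lt_of_lt_of_le hs h
  unfold kk
  have e1 : (s' / s) ^ ((d : ℝ) / 2) * ((2 * π * s') ^ (-(d : ℝ) / 2) * Real.exp (-‖x‖ ^ 2 / (2 * s')))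
      = (2 * π * s) ^ (-(d : ℝ) / 2) * Real.exp (-‖x‖ ^ 2 / (2 * s')) := by
    rw [← mul_assoc]; congr 1
    have : (2 * π * s') = (s' / s) * (2 * π * s) := by field_simp
    rw [this, mul_rpow (by positivity) (by positivity), ← mul_assoc, ← rpow_add (by positivity)]
    have : (d:ℝ) / 2 + -(d:ℝ) / 2 = 0 := by ring
    rw [this, rpow_zero, one_mul]
  rw [e1]
  refine mul_le_mul_of_nonneg_left (Real.exp_le_exp.mpr ?_) (by positivity)
  rw [neg_div, neg_div]
  gcongr

theorem om_kk {d : ℕ} (j : ℕ) {s s' : ℝ} (hs : 0 < s) (h : s < s') :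
    ∃ C : ℝ, 0 < C ∧ ∀ x : Ed d, om x ^ j * kk s x ≤ C * kk s' x := by
  have hs' : 0 < s' := hs.trans h
  set c := 1 / (2 * s) - 1 / (2 * s') with hc
  have hcpos : 0 < c := by
    rw [hc, sub_pos]; exact one_div_lt_one_div_of_lt (by positivity) (by linarith)
  -- om^j ≤ C exp(c |x|^2)
  have key : ∃ C : ℝ, 0 < C ∧ ∀ x : Ed d, om x ^ j ≤ C * Real.exp (c * ‖x‖ ^ 2) := by
    set D := max 1 (1 / c) with hD
    have hD1 : 1 ≤ D := le_max_left _ _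
    have hD2 : 1 ≤ D * c := by
      have : 1 / c ≤ D := le_max_right _ _
      calc 1 = (1 / c) * c := by field_simp
        _ ≤ D * c := by gcongr
    refine ⟨(D * j.factorial * (1) + 1) ^ j * (j.factorial + 1) * Real.exp c, by positivity, fun x => ?_⟩
    have h1 : om x ≤ D * (c * om x) := by
      have := mul_le_mul_of_nonneg_right hD2 (om_pos x).le
      linarith
    have h2 : (c * om x) ^ j ≤ j.factorial * Real.exp (c * om x) := by
      have := Real.pow_div_factorial_le_exp (c * om x) (by have := om_pos x; positivity) j
      rw [div_le_iff₀ (by positivity)] at this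
      linarith
    calc om x ^ j ≤ (D * (c * om x)) ^ j := by gcongr; exact (om_pos x).le
      _ = D ^ j * (c * om x) ^ j := by rw [mul_pow]
      _ ≤ D ^ j * (j.factorial * Real.exp (c * om x)) := by gcongr
      _ ≤ (D * j.factorial * (1) + 1) ^ j * ((j.factorial + 1) * Real.exp (c * om x)) := by
        have hf : (1:ℝ) ≤ j.factorial := by exact_mod_cast Nat.one_le_iff_ne_zero.mpr (Nat.factorial_ne_zero j)
        gcongr
        · nlinarith
        · linarith
      _ = _ := by
        unfold om
        rw [mul_add, mul_one, Real.exp_add]; ring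
  obtain ⟨C, hC, hk⟩ := key
  refine ⟨C * (s' / s) ^ ((d : ℝ) / 2), by positivity, fun x => ?_⟩
  have e1 : kk s x = (s' / s) ^ ((d : ℝ) / 2) * kk s' x * Real.exp (-(c * ‖x‖ ^ 2)) := by
    unfold kk
    have : (2 * π * s') = (s' / s) * (2 * π * s) := by field_simp
    rw [this, mul_rpow (x := s' / s) (by positivity) (by positivity)]
    have e3 : Real.exp (-‖x‖ ^ 2 / (2 * s)) = Real.exp (-‖x‖ ^ 2 / (2 * s')) * Real.exp (-(c * ‖x‖ ^ 2)) := by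
      rw [← Real.exp_add]; congr 1; rw [hc]; ring
    rw [e3]
    have e4 : (s' / s) ^ ((d : ℝ) / 2) * (s' / s) ^ (-(d : ℝ) / 2) = 1 := by
      rw [← rpow_add (by positivity)]
      have : (d:ℝ) / 2 + -(d:ℝ) / 2 = 0 := by ring
      rw [this, rpow_zero]
    linear_combination (-(2 * π * s) ^ (-(d : ℝ) / 2) * (Real.exp (-‖x‖ ^ 2 / (2 * s')) * Real.exp (-(c * ‖x‖ ^ 2)))) * e4
  have hkp := kk_pos hs' x
  calc om x ^ j * kk s x ≤ (C * Real.exp (c * ‖x‖ ^ 2)) * kk s x := by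
        gcongr
        · exact (kk_pos hs x).le
        · exact hk x
    _ = C * (s' / s) ^ ((d : ℝ) / 2) * kk s' x := by
      rw [e1, Real.exp_neg]; field_simp

theorem kk_semigroup {d : ℕ} {s s' : ℝ} (hs : 0 < s) (hs' : 0 < s') (x : Ed d) :
    ∫ y : Ed d, kk s (x - y) * kk s' y = kk (s + s') x := by
  have hS : 0 < s + s' := by positivity
  have e1 : ∀ y : Ed d, kk s (x - y) * kk s' y =
      ((2 * π * s) ^ (-(d : ℝ) / 2) * (2 * π * s') ^ (-(d : ℝ) / 2) * Real.exp (-‖x‖ ^ 2 / (2 * (s + s')))) *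
        Real.exp (-((s + s') / (2 * s * s')) * ‖y - (s' / (s + s')) • x‖ ^ 2) := by
    intro y
    unfold kk
    have : -‖x - y‖ ^ 2 / (2 * s) + -‖y‖ ^ 2 / (2 * s') = -‖x‖ ^ 2 / (2 * (s + s')) +
        -((s + s') / (2 * s * s')) * ‖y - (s' / (s + s')) • x‖ ^ 2 := by
      rw [norm_sub_sq_real, norm_sub_sq_real, inner_smul_right, real_inner_comm, norm_smul, mul_pow,
        Real.norm_eq_abs, sq_abs]
      field_simp
      ring
    calc _ = ((2 * π * s) ^ (-(d : ℝ) / 2) * (2 * π * s') ^ (-(d : ℝ) / 2)) *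
          Real.exp (-‖x - y‖ ^ 2 / (2 * s) + -‖y‖ ^ 2 / (2 * s')) := by rw [Real.exp_add]; ring
      _ = _ := by rw [this, Real.exp_add]; ring
  simp_rw [e1]
  rw [integral_const_mul, integral_sub_right_eq_self (fun y : Ed d => Real.exp (-((s + s') / (2 * s * s')) * ‖y‖ ^ 2)),
    GaussianFourier.integral_rexp_neg_mul_sq_norm (by positivity), finrank_euclideanSpace_fin]
  unfold kk
  have e2 : π / ((s + s') / (2 * s * s')) = (2 * π * s) * (2 * π * s') / (2 * π * (s + s')) := by
    field_simp
  have e3 : (π / ((s + s') / (2 * s * s'))) ^ ((d:ℝ) / 2) =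
      ((2 * π * s) ^ ((d:ℝ) / 2) * (2 * π * s') ^ ((d:ℝ) / 2)) * (2 * π * (s + s')) ^ (-(d:ℝ) / 2) := by
    rw [e2, div_rpow (by positivity) (by positivity), mul_rpow (by positivity) (by positivity),
      neg_div, rpow_neg (by positivity)]
    rfl
  have e4 : ∀ z : ℝ, 0 < z → z ^ (-(d:ℝ) / 2) * z ^ ((d:ℝ) / 2) = 1 := by
    intro z hz
    rw [← rpow_add hz]
    have : -(d:ℝ) / 2 + (d:ℝ) / 2 = 0 := by ring
    rw [this, rpow_zero]
  rw [e3]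
  have f1 := e4 (2 * π * s) (by positivity)
  have f2 := e4 (2 * π * s') (by positivity)
  set A := (2 * π * s) ^ (-(d:ℝ) / 2)
  set B := (2 * π * s') ^ (-(d:ℝ) / 2)
  set A' := (2 * π * s) ^ ((d:ℝ) / 2)
  set B' := (2 * π * s') ^ ((d:ℝ) / 2)
  set Z := (2 * π * (s + s')) ^ (-(d:ℝ) / 2)
  set X := Real.exp (-‖x‖ ^ 2 / (2 * (s + s')))
  linear_combination (B * B' * Z * X) * f1 + Z * X * f2

theorem kk_le_const {d : ℕ} {s : ℝ} (hs : 0 < s) (x : Ed d) :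
    kk s x ≤ (2 * π * s) ^ (-(d : ℝ) / 2) := by
  unfold kk
  have : Real.exp (-‖x‖ ^ 2 / (2 * s)) ≤ 1 := by
    apply Real.exp_le_one_iff.mpr
    rw [neg_div]; have : 0 ≤ ‖x‖ ^ 2 / (2 * s) := by positivity
    linarith
  calc _ ≤ (2 * π * s) ^ (-(d : ℝ) / 2) * 1 := by gcongr
    _ = _ := mul_one _

theorem om_kk_int {d : ℕ} (j : ℕ) {s : ℝ} (hs : 0 < s) :
    Integrable (fun x : Ed d => om x ^ j * kk s x) := by
  obtain ⟨C, hC, h⟩ := om_kk (d := d) j hs (show s < s + s by linarith)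
  refine Integrable.mono' ((kk_int (d := d) (show 0 < s + s by linarith)).const_mul C) ?_ ?_
  · exact ((om_cont.pow j).mul (kk_cont s)).aestronglyMeasurable
  · refine Filter.Eventually.of_forall fun x => ?_
    rw [Real.norm_eq_abs, abs_of_nonneg]
    · exact h x
    · have := om_pos x; have := kk_pos hs x; positivity
end ModA1

section ModA2
/-- measurable and dominated by a Gaussian -/
def GB {d : ℕ} (w : Ed d → ℝ) : Prop :=
  Measurable w ∧ ∃ C s : ℝ, 0 ≤ C ∧ 0 < s ∧ ∀ x, |w x| ≤ C * kk s x

/-- measurable with polynomial growth -/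
def PG {d : ℕ} (φ : Ed d → ℝ) : Prop :=
  Measurable φ ∧ ∃ (C : ℝ) (j : ℕ), 0 ≤ C ∧ ∀ x, |φ x| ≤ C * om x ^ j

theorem om_pow_mono {d : ℕ} (x : Ed d) {i j : ℕ} (h : i ≤ j) : om x ^ i ≤ om x ^ j :=
  pow_le_pow_right₀ (one_le_om x) h

namespace PG
variable {d : ℕ} {φ ψ : Ed d → ℝ}

theorem mul (h : PG φ) (h' : PG ψ) : PG (fun x => φ x * ψ x) := by
  obtain ⟨hm, C, j, hC, hb⟩ := h
  obtain ⟨hm', C', j', hC', hb'⟩ := h'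
  refine ⟨hm.mul hm', C * C', j + j', by positivity, fun x => ?_⟩
  rw [abs_mul]
  calc _ ≤ (C * om x ^ j) * (C' * om x ^ j') :=
        mul_le_mul (hb x) (hb' x) (abs_nonneg _) ((abs_nonneg _).trans (hb x))
    _ = _ := by rw [pow_add]; ring

theorem add (h : PG φ) (h' : PG ψ) : PG (fun x => φ x + ψ x) := by
  obtain ⟨hm, C, j, hC, hb⟩ := h
  obtain ⟨hm', C', j', hC', hb'⟩ := h'
  refine ⟨hm.add hm', C + C', max j j', by positivity, fun x => ?_⟩
  calc |φ x + ψ x| ≤ |φ x| + |ψ x| := abs_add_le _ _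
    _ ≤ C * om x ^ (max j j') + C' * om x ^ (max j j') := by
      refine add_le_add ((hb x).trans ?_) ((hb' x).trans ?_)
      · exact mul_le_mul_of_nonneg_left (om_pow_mono x (le_max_left _ _)) hC
      · exact mul_le_mul_of_nonneg_left (om_pow_mono x (le_max_right _ _)) hC'
    _ = _ := by ring

theorem const (c : ℝ) : PG (fun _ : Ed d => c) :=
  ⟨measurable_const, |c|, 0, abs_nonneg _, fun x => by simp⟩

theorem const_mul (c : ℝ) (h : PG φ) : PG (fun x => c * φ x) := (PG.const c).mul h

theorem neg (h : PG φ) : PG (fun x => -φ x) := by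
  simpa using h.const_mul (-1)

theorem sub (h : PG φ) (h' : PG ψ) : PG (fun x => φ x - ψ x) := by
  simpa [sub_eq_add_neg] using h.add h'.neg

theorem abs (h : PG φ) : PG (fun x => |φ x|) := by
  obtain ⟨hm, C, j, hC, hb⟩ := h
  exact ⟨hm.abs, C, j, hC, fun x => by simpa using hb x⟩

theorem sq (h : PG φ) : PG (fun x => φ x ^ 2) := by
  simpa [pow_two] using h.mul h

theorem mono (h : PG φ) (hm : Measurable ψ) (hb : ∀ x, |ψ x| ≤ |φ x|) : PG ψ := by
  obtain ⟨_, C, j, hC, hb'⟩ := h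
  exact ⟨hm, C, j, hC, fun x => (hb x).trans (hb' x)⟩

theorem om_pg : PG (om : Ed d → ℝ) :=
  ⟨om_cont.measurable, 1, 1, by norm_num, fun x => by rw [abs_of_pos (om_pos x)]; simp⟩

theorem of_om {C : ℝ} (hm : Measurable φ) (hb : ∀ x, |φ x| ≤ C * om x) : PG φ := by
  refine (om_pg.const_mul C).mono hm fun x => (hb x).trans (le_abs_self _)

theorem norm_pg : PG (fun x : Ed d => ‖x‖) := by
  refine of_om (C := 1) continuous_norm.measurable fun x => ?_
  rw [abs_of_nonneg (norm_nonneg _)]; unfold om; nlinarith [sq_nonneg (‖x‖ - 1)]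

theorem coord (i : Fin d) : PG (fun x : Ed d => x i) := by
  refine norm_pg.mono (by fun_prop) fun x => ?_
  rw [abs_of_nonneg (norm_nonneg _)]
  exact PiLp.norm_apply_le x i

theorem sum {ι : Type*} (S : Finset ι) {f : ι → Ed d → ℝ} (h : ∀ i ∈ S, PG (f i)) :
    PG (fun x => ∑ i ∈ S, f i x) := by
  induction S using Finset.induction_on with
  | empty => simpa using PG.const (d := d) 0
  | insert a S ha ih =>
    simp only [Finset.sum_insert ha]
    exact (h a (by simp)).add (ih fun i hi => h i (by simp [hi]))

end PG

namespace GB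
variable {d : ℕ} {w v φ : Ed d → ℝ}

theorem meas (h : GB w) : Measurable w := h.1

theorem mk_le {C s : ℝ} (hm : Measurable w) (hs : 0 < s) (hb : ∀ x, |w x| ≤ C * kk s x) : GB w := by
  refine ⟨hm, C, s, ?_, hs, hb⟩
  have h1 := (abs_nonneg _).trans (hb 0)
  exact nonneg_of_mul_nonneg_left h1 (kk_pos hs 0)

theorem kk_gb {s : ℝ} (hs : 0 < s) : GB (kk s : Ed d → ℝ) :=
  mk_le (C := 1) (kk_cont s).measurable hs fun x => by rw [abs_of_pos (kk_pos hs x), one_mul]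

theorem integrable (h : GB w) : Integrable w := by
  obtain ⟨hm, C, s, hC, hs, hb⟩ := h
  exact ((kk_int hs).const_mul C).mono' hm.aestronglyMeasurable
    (Filter.Eventually.of_forall hb)

theorem mul_PG (h : GB w) (h' : PG φ) : GB (fun x => w x * φ x) := by
  obtain ⟨hm, C, s, hC, hs, hb⟩ := h
  obtain ⟨hm', C', j, hC', hb'⟩ := h'
  obtain ⟨A, hA, hk⟩ := om_kk (d := d) j hs (show s < s + s by linarith)
  refine mk_le (C := C * C' * A) (hm.mul hm') (show 0 < s + s by linarith) fun x => ?_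
  rw [abs_mul]
  calc _ ≤ (C * kk s x) * (C' * om x ^ j) :=
        mul_le_mul (hb x) (hb' x) (abs_nonneg _) ((abs_nonneg _).trans (hb x))
    _ = C * C' * (om x ^ j * kk s x) := by ring
    _ ≤ C * C' * (A * kk (s + s) x) := by exact mul_le_mul_of_nonneg_left (hk x) (by positivity)
    _ = _ := by ring

theorem PG_mul (h' : PG φ) (h : GB w) : GB (fun x => φ x * w x) := by
  simpa [mul_comm] using h.mul_PG h'

theorem add (h : GB w) (h' : GB v) : GB (fun x => w x + v x) := by
  obtain ⟨hm, C, s, hC, hs, hb⟩ := h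
  obtain ⟨hm', C', s', hC', hs', hb'⟩ := h'
  have hS := lt_max_of_lt_left (c := s') hs
  refine mk_le (C := C * ((max s s') / s) ^ ((d:ℝ)/2) + C' * ((max s s') / s') ^ ((d:ℝ)/2))
    (hm.add hm') hS fun x => ?_
  calc |w x + v x| ≤ |w x| + |v x| := abs_add_le _ _
    _ ≤ C * (((max s s') / s) ^ ((d:ℝ)/2) * kk (max s s') x) + C' * (((max s s') / s') ^ ((d:ℝ)/2) * kk (max s s') x) := by
      refine add_le_add ((hb x).trans ?_) ((hb' x).trans ?_)
      · exact mul_le_mul_of_nonneg_left (kk_le hs (le_max_left _ _) x) hC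
      · exact mul_le_mul_of_nonneg_left (kk_le hs' (le_max_right _ _) x) hC'
    _ = _ := by ring

theorem const_mul (c : ℝ) (h : GB w) : GB (fun x => c * w x) := PG_mul (PG.const c) h
theorem neg (h : GB w) : GB (fun x => - w x) := by simpa using h.const_mul (-1)
theorem sub (h : GB w) (h' : GB v) : GB (fun x => w x - v x) := by
  simpa [sub_eq_add_neg] using h.add h'.neg
theorem mono (h : GB w) (hm : Measurable v) (hb : ∀ x, |v x| ≤ |w x|) : GB v := by
  obtain ⟨_, C, s, hC, hs, hb'⟩ := h
  exact ⟨hm, C, s, hC, hs, fun x => (hb x).trans (hb' x)⟩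
theorem abs (h : GB w) : GB (fun x => |w x|) := h.mono h.1.abs fun x => by simp
theorem zero : GB (fun _ : Ed d => (0:ℝ)) := by simpa using (kk_gb (d := d) one_pos).const_mul 0

theorem bdd (h : GB w) : ∃ B : ℝ, 0 ≤ B ∧ ∀ x, |w x| ≤ B := by
  obtain ⟨hm, C, s, hC, hs, hb⟩ := h
  refine ⟨C * (2 * π * s) ^ (-(d : ℝ) / 2), by positivity, fun x => (hb x).trans ?_⟩
  gcongr; exact kk_le_const hs x

theorem toPG (h : GB w) : PG w := by
  obtain ⟨B, hB, hb⟩ := h.bdd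
  exact ⟨h.1, B, 0, hB, by simpa using hb⟩

theorem sq (h : GB w) : GB (fun x => w x ^ 2) := by
  simpa [pow_two] using h.mul_PG h.toPG

theorem sum {ι : Type*} (S : Finset ι) {f : ι → Ed d → ℝ} (h : ∀ i ∈ S, GB (f i)) :
    GB (fun x => ∑ i ∈ S, f i x) := by
  induction S using Finset.induction_on with
  | empty => simpa using GB.zero (d := d)
  | insert a S ha ih =>
    simp only [Finset.sum_insert ha]
    exact (h a (by simp)).add (ih fun i hi => h i (by simp [hi]))

end GB

theorem abs_int_le {X : Type*} [MeasurableSpace X] {ν : Measure X} {f g : X → ℝ} (hg : Integrable g ν)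
    (h : ∀ x, |f x| ≤ g x) : |∫ x, f x ∂ν| ≤ ∫ x, g x ∂ν :=
  by
    rw [← Real.norm_eq_abs]
    exact norm_integral_le_of_norm_le hg (Filter.Eventually.of_forall fun x => by
      rw [Real.norm_eq_abs]; exact h x)

/-- convolution -/
def Cv {d : ℕ} (J w : Ed d → ℝ) (x : Ed d) : ℝ := ∫ y, J (x - y) * w y

section Cv
variable {d : ℕ} {J w : Ed d → ℝ}

theorem cv_integrable_at (hJ : Measurable J) {B : ℝ} (hB : ∀ x, |J x| ≤ B) (hw : Integrable w) (x : Ed d) :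
    Integrable (fun y => J (x - y) * w y) :=
  hw.bdd_mul (hJ.comp (measurable_const.sub measurable_id)).aestronglyMeasurable
    (Filter.Eventually.of_forall fun y => hB (x - y))

theorem gb_cv_integrable_at (hJ : GB J) (hw : Integrable w) (x : Ed d) :
    Integrable (fun y => J (x - y) * w y) := by
  obtain ⟨B, _, hB⟩ := hJ.bdd
  exact cv_integrable_at hJ.1 hB hw x

theorem cv_continuous (hJ : Continuous J) {B : ℝ} (hB : ∀ x, |J x| ≤ B) (hw : Integrable w) :
    Continuous (Cv J w) := by
  unfold Cv
  refine continuous_of_dominated (bound := fun y => B * |w y|) ?_ ?_ ?_ ?_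
  · intro x; exact (cv_integrable_at hJ.measurable hB hw x).aestronglyMeasurable
  · intro x; refine Filter.Eventually.of_forall fun y => ?_
    rw [norm_mul]; exact mul_le_mul_of_nonneg_right (hB _) (abs_nonneg _)
  · exact hw.abs.const_mul B
  · refine Filter.Eventually.of_forall fun y => ?_
    fun_prop

theorem cv_lipschitz (hJ : Measurable J) {B D : ℝ} (hB : ∀ x, |J x| ≤ B)
    (hD : ∀ x y, |J x - J y| ≤ D * ‖x - y‖) (hw : Integrable w) (x x' : Ed d) :
    |Cv J w x - Cv J w x'| ≤ D * ‖x - x'‖ * ∫ y, |w y| := by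
  unfold Cv
  rw [← integral_sub (cv_integrable_at hJ hB hw x) (cv_integrable_at hJ hB hw x'), ← integral_const_mul]
  refine abs_int_le (hw.abs.const_mul _) fun y => ?_
  rw [← sub_mul, abs_mul]
  refine mul_le_mul_of_nonneg_right ?_ (abs_nonneg _)
  have := hD (x - y) (x' - y)
  simpa using this

theorem cv_bound (hJm : Measurable J) (hwm : Measurable w) {C C' s s' : ℝ} (hs : 0 < s) (hs' : 0 < s')
    (hJ : ∀ x, |J x| ≤ C * kk s x) (hw : ∀ x, |w x| ≤ C' * kk s' x) (x : Ed d) :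
    |Cv J w x| ≤ C * C' * kk (s + s') x := by
  rw [← kk_semigroup hs hs', ← integral_const_mul]
  refine abs_int_le ?_ fun y => ?_
  · exact (gb_cv_integrable_at (GB.kk_gb hs) (kk_int hs') x).const_mul _
  · rw [abs_mul]
    calc _ ≤ (C * kk s (x - y)) * (C' * kk s' y) :=
        mul_le_mul (hJ _) (hw _) (abs_nonneg _) ((abs_nonneg _).trans (hJ _))
      _ = _ := by ring

theorem GB.cv (hJ : GB J) (hJc : Continuous J) (hw : GB w) : GB (Cv J w) := by
  obtain ⟨B, _, hB⟩ := hJ.bdd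
  have hc := cv_continuous hJc hB hw.integrable
  obtain ⟨hm, C, s, hC, hs, hb⟩ := hJ
  obtain ⟨hm', C', s', hC', hs', hb'⟩ := hw
  exact GB.mk_le hc.measurable (show 0 < s + s' by linarith) (cv_bound hm hm' hs hs' hb hb')

theorem cv_prod_int (hJ : Integrable J) (hw : Integrable w) :
    Integrable (fun p : Ed d × Ed d => J (p.1 - p.2) * w p.2) (volume.prod volume) := by
  have := Integrable.convolution_integrand (ContinuousLinearMap.mul ℝ ℝ) hw hJ
  simpa [mul_comm] using this

theorem cv_integrable (hJ : Integrable J) (hw : Integrable w) : Integrable (Cv J w) :=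
  (cv_prod_int hJ hw).integral_prod_left

theorem cv_integral (hJ : Integrable J) (hw : Integrable w) :
    ∫ x, Cv J w x = (∫ x, J x) * ∫ y, w y := by
  unfold Cv
  rw [integral_integral_swap (cv_prod_int hJ hw), ← integral_const_mul]
  congr 1; ext y
  rw [integral_mul_const, integral_sub_right_eq_self]

theorem cv_abs_le (x : Ed d) : |Cv J w x| ≤ Cv (fun x => |J x|) (fun x => |w x|) x := by
  unfold Cv
  refine (abs_integral_le_integral_abs).trans (le_of_eq ?_)
  congr 1; ext y; rw [abs_mul]

theorem cv_L1 (hJ : Integrable J) (hw : Integrable w) :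
    ∫ x, |Cv J w x| ≤ (∫ x, |J x|) * ∫ y, |w y| := by
  rw [← cv_integral hJ.abs hw.abs]
  exact integral_mono (cv_integrable hJ hw).abs (cv_integrable hJ.abs hw.abs) fun x => cv_abs_le x

theorem cv_swap {φ : Ed d → ℝ} (hJ : Measurable J) {B : ℝ} (hB : ∀ x, |J x| ≤ B) (hw : Integrable w)
    (hφ : Integrable φ) :
    ∫ x, φ x * Cv J w x = ∫ y, w y * ∫ x, J (x - y) * φ x := by
  have hI : Integrable (fun p : Ed d × Ed d => J (p.1 - p.2) * (φ p.1 * w p.2)) (volume.prod volume) :=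
    (hφ.mul_prod hw).bdd_mul (hJ.comp (measurable_fst.sub measurable_snd)).aestronglyMeasurable
      (Filter.Eventually.of_forall fun p => hB _)
  have h1 := integral_integral_swap (f := fun x y => J (x - y) * (φ x * w y)) hI
  calc _ = ∫ x, ∫ y, J (x - y) * (φ x * w y) := by
        congr 1; ext x; unfold Cv; rw [← integral_const_mul]; congr 1; ext y; ring
    _ = _ := h1
    _ = _ := by
        congr 1; ext x; rw [← integral_const_mul]; congr 1; ext y; ring

theorem cv_hasFDerivAt (hJc : Continuous J) {B D : ℝ} (hB : ∀ x, |J x| ≤ B)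
    {J' : Ed d → (Ed d →L[ℝ] ℝ)} (hJ' : ∀ x, HasFDerivAt J (J' x) x) (hJ'c : Continuous J')
    (hD : ∀ x, ‖J' x‖ ≤ D) (hw : Integrable w) (x : Ed d) :
    HasFDerivAt (Cv J w) (∫ y, w y • J' (x - y)) x := by
  unfold Cv
  refine hasFDerivAt_integral_of_dominated_of_fderiv_le (bound := fun y => |w y| * D)
    (F' := fun x y => w y • J' (x - y)) Filter.univ_mem ?_ ?_ ?_ ?_ ?_ ?_
  · exact Filter.Eventually.of_forall fun x => (cv_integrable_at hJc.measurable hB hw x).aestronglyMeasurable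
  · exact cv_integrable_at hJc.measurable hB hw x
  · exact hw.aestronglyMeasurable.smul (hJ'c.comp (by fun_prop)).aestronglyMeasurable
  · refine Filter.Eventually.of_forall fun y x _ => ?_
    rw [norm_smul]; exact mul_le_mul_of_nonneg_left (hD _) (abs_nonneg _)
  · exact hw.abs.mul_const D
  · refine Filter.Eventually.of_forall fun y x _ => ?_
    have h1 : HasFDerivAt (fun x => J (x - y)) (J' (x - y)) x :=
      by
        have := (hJ' (x - y)).comp x ((hasFDerivAt_id x).sub_const y)
        rw [ContinuousLinearMap.comp_id] at this
        exact this
    exact h1.mul_const (w y)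

theorem cv_fderiv_apply {D : ℝ} 
    {J' : Ed d → (Ed d →L[ℝ] ℝ)} (hJ'c : Continuous J')
    (hD : ∀ x, ‖J' x‖ ≤ D) (hw : Integrable w) (x v : Ed d) :
    (∫ y, w y • J' (x - y)) v = Cv (fun z => J' z v) w x := by
  have hint : Integrable (fun y => w y • J' (x - y)) := by
    refine (hw.abs.mul_const D).mono' (hw.aestronglyMeasurable.smul (hJ'c.comp (by fun_prop)).aestronglyMeasurable)
      (Filter.Eventually.of_forall fun y => ?_)
    rw [norm_smul]; exact mul_le_mul_of_nonneg_left (hD _) (abs_nonneg _)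
  rw [ContinuousLinearMap.integral_apply hint]
  unfold Cv
  congr 1; ext y; simp [mul_comm]

end Cv
end ModA2

section ModA3
def k1 {d : ℕ} (s : ℝ) (i : Fin d) (x : Ed d) : ℝ := -(x i / s) * kk s x
def k2 {d : ℕ} (s : ℝ) (i : Fin d) (x : Ed d) : ℝ := ((x i) ^ 2 / s ^ 2 - 1 / s) * kk s x

/-- the coordinate vector -/
abbrev ee {d : ℕ} (i : Fin d) : Ed d := EuclideanSpace.single i 1

section kernels
variable {d : ℕ} {s : ℝ}

def kkD (s : ℝ) (x : Ed d) : Ed d →L[ℝ] ℝ := (-(kk s x / s)) • innerSL ℝ x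
def pr (i : Fin d) : Ed d →L[ℝ] ℝ := EuclideanSpace.proj i
def k1D (s : ℝ) (i : Fin d) (x : Ed d) : Ed d →L[ℝ] ℝ :=
  (-(x i / s)) • kkD s x + (kk s x) • ((-(1 / s)) • pr i)
def k2D (s : ℝ) (i : Fin d) (x : Ed d) : Ed d →L[ℝ] ℝ :=
  ((x i) ^ 2 / s ^ 2 - 1 / s) • kkD s x + (kk s x) • ((2 * x i / s ^ 2) • pr i)

theorem pr_apply (i : Fin d) (x : Ed d) : pr i x = x i := rfl

theorem kk_hasFDerivAt (x : Ed d) : HasFDerivAt (kk s) (kkD s x) x := by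
  have h1 : HasFDerivAt (fun x : Ed d => ‖x‖ ^ 2) (2 • innerSL ℝ x) x :=
    (hasStrictFDerivAt_norm_sq x).hasFDerivAt
  have h2 := ((h1.const_mul (-(1 / (2 * s)))).exp).const_mul ((2 * π * s) ^ (-(d : ℝ) / 2))
  have e : (fun x : Ed d => (2 * π * s) ^ (-(d : ℝ) / 2) * Real.exp (-(1 / (2 * s)) * ‖x‖ ^ 2)) = kk s := by
    ext y; unfold kk; rw [exp_form]
  rw [e] at h2
  refine h2.congr_fderiv ?_
  ext v
  simp only [kkD, kk, exp_form, ContinuousLinearMap.smul_apply, smul_eq_mul, nsmul_eq_mul,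
    innerSL_apply_apply]
  rw [← exp_form]
  by_cases hs : s = 0
  · simp [hs]
  · push_cast; field_simp

theorem coord_hasFDerivAt (i : Fin d) (x : Ed d) : HasFDerivAt (fun x : Ed d => x i) (pr i) x :=
  (pr i).hasFDerivAt

theorem k1_hasFDerivAt (i : Fin d) (x : Ed d) : HasFDerivAt (k1 s i) (k1D s i x) x := by
  have h1 : HasFDerivAt (fun x : Ed d => -(x i / s)) ((-(1 / s)) • pr i) x := by
    have := (coord_hasFDerivAt i x).const_mul (-(1 / s))
    refine (this.congr_of_eventuallyEq (Filter.Eventually.of_forall fun y => ?_))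
    simp; ring
  exact h1.mul (kk_hasFDerivAt x)

theorem k2_hasFDerivAt (i : Fin d) (x : Ed d) : HasFDerivAt (k2 s i) (k2D s i x) x := by
  have h1 : HasFDerivAt (fun x : Ed d => (x i) ^ 2 / s ^ 2 - 1 / s) ((2 * x i / s ^ 2) • pr i) x := by
    have := (((coord_hasFDerivAt i x).pow 2).const_mul (1 / s ^ 2)).sub_const (1 / s)
    refine ((this.congr_of_eventuallyEq (Filter.Eventually.of_forall fun y => ?_))).congr_fderiv ?_
    · simp; ring
    · ext v; simp; ring
  exact h1.mul (kk_hasFDerivAt x)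

theorem inner_ee (x : Ed d) (i : Fin d) : ⟪x, ee i⟫ = x i := by
  simp [ee, EuclideanSpace.inner_single_right]

theorem kkD_ee (i : Fin d) (x : Ed d) : kkD s x (ee i) = k1 s i x := by
  simp only [kkD, k1, ContinuousLinearMap.smul_apply, smul_eq_mul, innerSL_apply_apply, inner_ee]
  ring

theorem k1D_ee (i : Fin d) (x : Ed d) : k1D s i x (ee i) = k2 s i x := by
  simp only [k1D, k2, ContinuousLinearMap.smul_apply, smul_eq_mul, ContinuousLinearMap.add_apply, kkD_ee, pr_apply]
  simp [k1]
  ring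

theorem k1_cont (i : Fin d) : Continuous (k1 s i) := by
  have := kk_cont (d := d) s; unfold k1; fun_prop
theorem k2_cont (i : Fin d) : Continuous (k2 s i) := by
  have := kk_cont (d := d) s; unfold k2; fun_prop
theorem kkD_cont : Continuous (kkD s : Ed d → _) := by
  have := kk_cont (d := d) s; unfold kkD; fun_prop
theorem k1D_cont (i : Fin d) : Continuous (k1D s i) := by
  have := kk_cont (d := d) s; have := kkD_cont (d := d) (s := s); unfold k1D; fun_prop
theorem k2D_cont (i : Fin d) : Continuous (k2D s i) := by
  have := kk_cont (d := d) s; have := kkD_cont (d := d) (s := s); unfold k2D; fun_prop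

theorem norm_pr (i : Fin d) : ‖pr i‖ ≤ 1 := by
  refine ContinuousLinearMap.opNorm_le_bound _ zero_le_one fun x => ?_
  rw [one_mul, pr_apply]; exact PiLp.norm_apply_le x i

theorem kk_gb1 (hs : 0 < s) (i : Fin d) : GB (k1 s i) := by
  have : PG (fun x : Ed d => -(x i / s)) := by
    have := (PG.coord i).const_mul (-(1 / s))
    refine this.mono ?_ fun x => ?_
    · have : Continuous (fun x : Ed d => -(x i / s)) := by fun_prop
      exact this.measurable
    · apply le_of_eq; congr 1; ring
  exact GB.PG_mul this (GB.kk_gb hs)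

theorem kk_gb2 (hs : 0 < s) (i : Fin d) : GB (k2 s i) := by
  have : PG (fun x : Ed d => (x i) ^ 2 / s ^ 2 - 1 / s) := by
    have := ((PG.coord i).sq.const_mul (1 / s ^ 2)).sub (PG.const (1 / s))
    refine this.mono ?_ fun x => ?_
    · have : Continuous (fun x : Ed d => (x i) ^ 2 / s ^ 2 - 1 / s) := by fun_prop
      exact this.measurable
    · apply le_of_eq; congr 1; ring
  exact GB.PG_mul this (GB.kk_gb hs)

theorem gb_of_le {C : ℝ} {j : ℕ} {f : Ed d → ℝ} (hs : 0 < s) (hm : Measurable f)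
    (h : ∀ x, |f x| ≤ C * om x ^ j * kk s x) : GB f := by
  have h2 : GB (fun x : Ed d => (C * om x ^ j) * kk s x) := by
    refine GB.PG_mul ?_ (GB.kk_gb hs)
    refine ⟨(om_cont.pow j).measurable.const_mul C, |C|, j, abs_nonneg _, fun x => ?_⟩
    rw [abs_mul, abs_of_nonneg (pow_nonneg (om_pos x).le j)]
  exact h2.mono hm fun x => (h x).trans (le_abs_self _)

theorem norm_le_om (x : Ed d) : ‖x‖ ≤ om x := by unfold om; nlinarith [sq_nonneg (‖x‖ - 1)]
theorem abs_coord_le (x : Ed d) (i : Fin d) : |x i| ≤ om x :=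
  (PiLp.norm_apply_le x i).trans (norm_le_om x)

theorem norm_kkD_le (hs : 0 < s) (x : Ed d) : ‖kkD s x‖ ≤ (1 / s) * om x * kk s x := by
  unfold kkD
  rw [norm_smul, innerSL_apply_norm, norm_neg, Real.norm_eq_abs, abs_of_nonneg (div_nonneg (kk_pos hs x).le hs.le)]
  have := kk_pos hs x
  calc kk s x / s * ‖x‖ ≤ kk s x / s * om x := by gcongr; exact norm_le_om x
    _ = _ := by ring

theorem norm_k1D_gb (hs : 0 < s) (i : Fin d) : GB (fun x => ‖k1D s i x‖) := by
  refine gb_of_le (C := 1 / s * (1 / s) + 1 / s) (j := 2) hs (k1D_cont i).norm.measurable fun x => ?_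
  have hk := kk_pos hs x
  have hw := one_le_om x
  rw [abs_of_nonneg (norm_nonneg _)]
  unfold k1D
  refine (norm_add_le _ _).trans ?_
  rw [norm_smul, norm_smul, norm_smul]
  have h1 : ‖-(x i / s)‖ ≤ om x / s := by
    rw [norm_neg, norm_div, Real.norm_eq_abs, Real.norm_eq_abs, abs_of_pos hs]
    gcongr; exact abs_coord_le x i
  have h2 : ‖-(1 / s)‖ = 1 / s := by rw [norm_neg, Real.norm_eq_abs, abs_of_pos (by positivity)]
  have h3 : ‖kk s x‖ = kk s x := by rw [Real.norm_eq_abs, abs_of_pos hk]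
  rw [h2, h3]
  calc _ ≤ (om x / s) * ((1 / s) * om x * kk s x) + kk s x * (1 / s * 1) := by
        gcongr
        · exact norm_kkD_le hs x
        · exact norm_pr i
    _ ≤ (om x / s) * ((1 / s) * om x * kk s x) + kk s x * (1 / s * om x ^ 2) := by
        gcongr; nlinarith
    _ = _ := by ring

theorem norm_k2D_gb (hs : 0 < s) (i : Fin d) : GB (fun x => ‖k2D s i x‖) := by
  refine gb_of_le (C := (1 / s ^ 2 + 1 / s) * (1 / s) + 2 / s ^ 2) (j := 3) hs (k2D_cont i).norm.measurable fun x => ?_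
  have hk := kk_pos hs x
  have hw := one_le_om x
  rw [abs_of_nonneg (norm_nonneg _)]
  unfold k2D
  refine (norm_add_le _ _).trans ?_
  rw [norm_smul, norm_smul, norm_smul]
  have h1 : ‖(x i) ^ 2 / s ^ 2 - 1 / s‖ ≤ (1 / s ^ 2 + 1 / s) * om x ^ 2 := by
    refine (norm_sub_le _ _).trans ?_
    rw [norm_div, norm_pow, norm_pow, Real.norm_eq_abs, Real.norm_eq_abs, abs_of_pos hs,
      Real.norm_eq_abs, abs_of_pos (show 0 < 1 / s by positivity), add_mul]
    have := abs_coord_le x i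
    gcongr
    · calc |x i| ^ 2 / s ^ 2 ≤ om x ^ 2 / s ^ 2 := by gcongr
        _ = _ := by ring
    · have : (1:ℝ) ≤ om x ^ 2 := one_le_pow₀ hw
      calc 1 / s = 1 / s * 1 := by ring
        _ ≤ _ := by gcongr
  have h2 : ‖2 * x i / s ^ 2‖ ≤ 2 / s ^ 2 * om x := by
    rw [norm_div, norm_mul, norm_pow, Real.norm_eq_abs, Real.norm_eq_abs, Real.norm_eq_abs,
      abs_of_pos hs, abs_two]
    calc _ ≤ 2 * om x / s ^ 2 := by gcongr; exact abs_coord_le x i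
      _ = _ := by ring
  have h3 : ‖kk s x‖ = kk s x := by rw [Real.norm_eq_abs, abs_of_pos hk]
  rw [h3]
  calc _ ≤ ((1 / s ^ 2 + 1 / s) * om x ^ 2) * ((1 / s) * om x * kk s x) + kk s x * (2 / s ^ 2 * om x * 1) := by
        gcongr
        · exact norm_kkD_le hs x
        · exact norm_pr i
    _ ≤ ((1 / s ^ 2 + 1 / s) * om x ^ 2) * ((1 / s) * om x * kk s x) + kk s x * (2 / s ^ 2 * om x * om x ^ 2) := by
        gcongr; exact one_le_pow₀ hw
    _ = _ := by ring

theorem norm_kkD_gb (hs : 0 < s) : GB (fun x : Ed d => ‖kkD s x‖) := by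
  refine gb_of_le (C := 1 / s) (j := 1) hs kkD_cont.norm.measurable fun x => ?_
  rw [abs_of_nonneg (norm_nonneg _), pow_one]; exact norm_kkD_le hs x

theorem lip_of_D {J : Ed d → ℝ} {J' : Ed d → (Ed d →L[ℝ] ℝ)} (hJ : ∀ x, HasFDerivAt J (J' x) x)
    {D : ℝ} (hD : ∀ x, ‖J' x‖ ≤ D) (x y : Ed d) : |J x - J y| ≤ D * ‖x - y‖ := by
  have := convex_univ.norm_image_sub_le_of_norm_hasFDerivWithin_le
    (fun z _ => (hJ z).hasFDerivWithinAt) (fun z _ => hD z) (mem_univ y) (mem_univ x)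
  simpa using this

/-- derivative of Gaussian convolutions -/
theorem cvkk_hasFDerivAt (hs : 0 < s) {w : Ed d → ℝ} (hw : Integrable w) (x : Ed d) :
    ∃ D : Ed d →L[ℝ] ℝ, HasFDerivAt (Cv (kk s) w) D x ∧ ∀ i, D (ee i) = Cv (k1 s i) w x := by
  obtain ⟨B, _, hB⟩ := (GB.kk_gb (d := d) hs).bdd
  obtain ⟨D, _, hD⟩ := (norm_kkD_gb (d := d) hs).bdd
  simp only [abs_norm] at hD
  refine ⟨_, cv_hasFDerivAt (kk_cont s) hB kk_hasFDerivAt kkD_cont hD hw x, fun i => ?_⟩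
  rw [cv_fderiv_apply kkD_cont hD hw]
  simp only [kkD_ee]

theorem cvk1_hasFDerivAt (hs : 0 < s) (i : Fin d) {w : Ed d → ℝ} (hw : Integrable w) (x : Ed d) :
    ∃ D : Ed d →L[ℝ] ℝ, HasFDerivAt (Cv (k1 s i) w) D x ∧ D (ee i) = Cv (k2 s i) w x := by
  obtain ⟨B, _, hB⟩ := (kk_gb1 (d := d) hs i).bdd
  obtain ⟨D, _, hD⟩ := (norm_k1D_gb (d := d) hs i).bdd
  simp only [abs_norm] at hD
  refine ⟨_, cv_hasFDerivAt (k1_cont i) hB (k1_hasFDerivAt i) (k1D_cont i) hD hw x, ?_⟩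
  rw [cv_fderiv_apply (k1D_cont i) hD hw]
  simp only [k1D_ee]

end kernels
end ModA3

section ModA4
open Filter Topology in
/-- from L¹ convergence to convergence of dominated, locally controlled quantities -/
theorem tend_T {d : ℕ} {ι : Type*} {l : Filter ι} {h Ψ : ι → Ed d → ℝ} {W Γ : Ed d → ℝ}
    (hh : ∀ n, Integrable (h n)) (hΨ : ∀ n, Integrable (Ψ n)) (hΓ : Integrable Γ) (hW : Continuous W)
    (hlim : Tendsto (fun n => ∫ x, |h n x|) l (𝓝 0))
    (hb1 : ∀ n x, |Ψ n x| ≤ Γ x) (hb2 : ∀ n x, |Ψ n x| ≤ W x * |h n x|) :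
    Tendsto (fun n => ∫ x, |Ψ n x|) l (𝓝 0) := by
  rw [Metric.tendsto_nhds]
  intro θ hθ
  -- choose R
  have hR : ∃ R : ℕ, ∫ x in (Metric.closedBall (0 : Ed d) R)ᶜ, Γ x < θ / 2 := by
    have h1 : Tendsto (fun R : ℕ => ∫ x in (Metric.closedBall (0 : Ed d) R)ᶜ, Γ x) atTop
        (𝓝 (∫ x in (⋂ R : ℕ, (Metric.closedBall (0 : Ed d) R)ᶜ), Γ x)) := by
      refine tendsto_setIntegral_of_antitone (fun R => measurableSet_closedBall.compl) ?_ ⟨0, hΓ.integrableOn⟩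
      intro a b hab
      exact compl_subset_compl.mpr (Metric.closedBall_subset_closedBall (by exact_mod_cast hab))
    have h2 : (⋂ R : ℕ, (Metric.closedBall (0 : Ed d) R)ᶜ) = ∅ := by
      rw [← compl_iUnion, Metric.iUnion_closedBall_nat, compl_univ]
    rw [h2] at h1
    simp only [Measure.restrict_empty, integral_zero_measure] at h1
    exact ((tendsto_order.1 h1).2 (θ / 2) (by positivity)).exists
  obtain ⟨R, hR⟩ := hR
  obtain ⟨C, hC⟩ := (isCompact_closedBall (0 : Ed d) R).exists_bound_of_continuousOn hW.continuousOn
  have hC' : ∀ x ∈ Metric.closedBall (0 : Ed d) R, W x ≤ |C| + 1 := fun x hx =>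
    ((le_abs_self _).trans (hC x hx)).trans (by linarith [le_abs_self C])
  have hev : ∀ᶠ n in l, ∫ x, |h n x| < θ / 2 / (|C| + 1) :=
    (tendsto_order.1 hlim).2 _ (by positivity)
  filter_upwards [hev] with n hn
  rw [Real.dist_eq, sub_zero, abs_of_nonneg (integral_nonneg fun x => abs_nonneg _)]
  have hs := integral_add_compl (μ := volume) (s := Metric.closedBall (0 : Ed d) R) measurableSet_closedBall (hΨ n).abs
  rw [← hs]
  have h1 : ∫ x in Metric.closedBall (0 : Ed d) R, |Ψ n x| ≤ (|C| + 1) * ∫ x, |h n x| := by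
    calc _ ≤ ∫ x in Metric.closedBall (0 : Ed d) R, (|C| + 1) * |h n x| := by
          refine setIntegral_mono_on (hΨ n).abs.integrableOn ((hh n).abs.const_mul _).integrableOn measurableSet_closedBall
            fun x hx => (hb2 n x).trans ?_
          exact mul_le_mul_of_nonneg_right (hC' x hx) (abs_nonneg _)
      _ ≤ ∫ x, (|C| + 1) * |h n x| :=
          setIntegral_le_integral ((hh n).abs.const_mul _) (Eventually.of_forall fun x => by positivity)
      _ = _ := integral_const_mul _ _
  have h2 : ∫ x in (Metric.closedBall (0 : Ed d) R)ᶜ, |Ψ n x| ≤ ∫ x in (Metric.closedBall (0 : Ed d) R)ᶜ, Γ x :=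
    setIntegral_mono (hΨ n).abs.integrableOn hΓ.integrableOn fun x => hb1 n x
  have h3 : (|C| + 1) * ∫ x, |h n x| < θ / 2 := by
    rw [lt_div_iff₀ (by positivity)] at hn; linarith
  linarith

theorem cs_weight {X : Type*} [MeasurableSpace X] {ν : Measure X} {g φ : X → ℝ} (hg0 : ∀ x, 0 ≤ g x)
    (hg : Integrable g ν) (hgφ : Integrable (fun x => g x * φ x) ν)
    (hgφ2 : Integrable (fun x => g x * φ x ^ 2) ν) :
    (∫ x, g x * φ x ∂ν) ^ 2 ≤ (∫ x, g x ∂ν) * ∫ x, g x * φ x ^ 2 ∂ν := by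
  have key : ∀ t : ℝ, 0 ≤ (∫ x, g x ∂ν) * (t * t) + (-2 * ∫ x, g x * φ x ∂ν) * t + ∫ x, g x * φ x ^ 2 ∂ν := by
    intro t
    have h1 : 0 ≤ ∫ x, g x * (φ x - t) ^ 2 ∂ν := integral_nonneg fun x => mul_nonneg (hg0 x) (sq_nonneg _)
    have h2 : ∫ x, g x * (φ x - t) ^ 2 ∂ν = ∫ x, (t * t) * g x + ((-2 * t) * (g x * φ x) + g x * φ x ^ 2) ∂ν := by
      congr 1; ext x; ring
    rw [h2, integral_add (hg.const_mul _) ((hgφ.const_mul _).fun_add hgφ2), integral_add (hgφ.const_mul _) hgφ2,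
      integral_const_mul, integral_const_mul] at h1
    linarith
  have := discrim_le_zero key
  unfold discrim at this
  linarith

section conv2
variable {d : ℕ} {s s' : ℝ}

theorem cv_comm (J w : Ed d → ℝ) : Cv J w = Cv w J := by
  ext x; unfold Cv
  rw [← integral_sub_left_eq_self _ volume x]
  congr 1; ext y; rw [sub_sub_cancel, mul_comm]

theorem cv_assoc {J J' w : Ed d → ℝ} (hJ : GB J) (hJ' : GB J') (hw : Integrable w) :
    Cv J (Cv J' w) = Cv (Cv J J') w := by
  obtain ⟨B', _, hB'⟩ := hJ'.bdd
  ext x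
  have hφ : Integrable (fun y => J (x - y)) := hJ.integrable.comp_sub_left x
  have := cv_swap (φ := fun y => J (x - y)) hJ'.1 hB' hw hφ
  calc Cv J (Cv J' w) x = ∫ y, J (x - y) * Cv J' w y := rfl
    _ = _ := this
    _ = _ := by
      conv_rhs => unfold Cv
      congr 1; ext z
      rw [mul_comm]; congr 1
      rw [← integral_add_right_eq_self _ z]
      congr 1; ext y; rw [add_sub_cancel_right, mul_comm]; congr 2; abel

theorem kk_conv (hs : 0 < s) (hs' : 0 < s') : Cv (kk s) (kk s') = (kk (s + s') : Ed d → ℝ) := by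
  ext x; exact kk_semigroup hs hs' x

theorem P_assoc (hs : 0 < s) (hs' : 0 < s') {w : Ed d → ℝ} (hw : Integrable w) :
    Cv (kk s) (Cv (kk s') w) = Cv (kk (s + s')) w := by
  rw [cv_assoc (GB.kk_gb hs) (GB.kk_gb hs') hw, kk_conv hs hs']

theorem k1_conv (hs : 0 < s) (hs' : 0 < s') (i : Fin d) : Cv (kk s) (k1 s' i) = k1 (s + s') i := by
  ext x
  obtain ⟨D, hD, hDe⟩ := cvkk_hasFDerivAt (d := d) hs' (kk_int (d := d) hs) x
  rw [kk_conv hs' hs, add_comm] at hD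
  have := hD.unique (kk_hasFDerivAt x)
  rw [cv_comm, ← hDe, this, kkD_ee]

theorem P_k1 (hs : 0 < s) (hs' : 0 < s') (i : Fin d) {w : Ed d → ℝ} (hw : Integrable w) :
    Cv (kk s) (Cv (k1 s' i) w) = Cv (k1 (s + s') i) w := by
  rw [cv_assoc (GB.kk_gb hs) (kk_gb1 hs' i) hw, k1_conv hs hs']

theorem P_selfadj (hs : 0 < s) {φ w : Ed d → ℝ} (hφ : Integrable φ) (hw : Integrable w) :
    ∫ x, φ x * Cv (kk s) w x = ∫ x, Cv (kk s) φ x * w x := by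
  obtain ⟨B, _, hB⟩ := (GB.kk_gb (d := d) hs).bdd
  rw [cv_swap (kk_cont s).measurable hB hw hφ]
  congr 1; ext y; rw [mul_comm]; congr 1
  unfold Cv; congr 1; ext z; rw [kk_sub_comm]

theorem int_kk_sub (hs : 0 < s) (x : Ed d) : ∫ y, kk s (x - y) = 1 := by
  rw [integral_sub_left_eq_self (fun y : Ed d => kk s y), kk_integral hs]

theorem P_sq_le (hs : 0 < s) {v : Ed d → ℝ} (hv : GB v) (x : Ed d) :
    (Cv (kk s) v x) ^ 2 ≤ Cv (kk s) (fun y => v y ^ 2) x := by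
  have := cs_weight (ν := volume) (g := fun y => kk s (x - y)) (φ := v) (fun y => (kk_pos hs _).le)
    ((kk_int hs).comp_sub_left x) (gb_cv_integrable_at (GB.kk_gb hs) hv.integrable x)
    (gb_cv_integrable_at (GB.kk_gb hs) hv.sq.integrable x)
  rw [int_kk_sub hs, one_mul] at this
  exact this

theorem P_L2 (hs : 0 < s) {v : Ed d → ℝ} (hv : GB v) :
    ∫ x, (Cv (kk s) v x) ^ 2 ≤ ∫ x, v x ^ 2 := by
  have h1 : ∫ x, Cv (kk s) (fun y => v y ^ 2) x = ∫ x, v x ^ 2 := by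
    rw [cv_integral (kk_int hs) hv.sq.integrable, kk_integral hs, one_mul]
  rw [← h1]
  exact integral_mono ((GB.kk_gb hs).cv (kk_cont s) hv).sq.integrable
    (cv_integrable (kk_int hs) hv.sq.integrable) fun x => P_sq_le hs hv x

theorem P_L2_defect (hs : 0 < s) {v : Ed d → ℝ} (hv : GB v) :
    ∫ x, (v x - Cv (kk s) v x) ^ 2 ≤ (∫ x, v x ^ 2) - ∫ x, (Cv (kk s) v x) ^ 2 := by
  have hs2 : 0 < s / 2 := by positivity
  have hP := (GB.kk_gb hs).cv (kk_cont s) hv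
  have hP2 := (GB.kk_gb hs2).cv (kk_cont _) hv
  have e1 : Cv (kk s) v = Cv (kk (s / 2)) (Cv (kk (s / 2)) v) := by
    rw [P_assoc hs2 hs2 hv.integrable]; congr 2; ring
  have h1 : ∫ x, v x * Cv (kk s) v x = ∫ x, (Cv (kk (s / 2)) v x) ^ 2 := by
    rw [e1, P_selfadj hs2 hv.integrable hP2.integrable]
    congr 1; ext x; ring
  have h2 : ∫ x, (Cv (kk s) v x) ^ 2 ≤ ∫ x, (Cv (kk (s / 2)) v x) ^ 2 := by
    rw [e1]; exact P_L2 hs2 hP2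
  have h3 : ∫ x, (v x - Cv (kk s) v x) ^ 2 = (∫ x, v x ^ 2) + (-2) * (∫ x, v x * Cv (kk s) v x) + ∫ x, (Cv (kk s) v x) ^ 2 := by
    rw [← integral_const_mul, ← integral_add hv.sq.integrable ((hv.mul_PG hP.toPG).const_mul _).integrable,
      ← integral_add (hv.sq.add ((hv.mul_PG hP.toPG).const_mul _)).integrable hP.sq.integrable]
    congr 1; ext x; ring
  rw [h3, h1]; linarith

theorem P_lower (hs : 0 < s) (hs' : 0 < s') {m : ℝ} {w : Ed d → ℝ} (hw : Integrable w)
    (h : ∀ x, m * kk s' x ≤ w x) (x : Ed d) : m * kk (s + s') x ≤ Cv (kk s) w x := by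
  rw [← kk_semigroup hs hs', ← integral_const_mul]
  refine integral_mono ((gb_cv_integrable_at (GB.kk_gb hs) (kk_int hs') x).const_mul m)
    (gb_cv_integrable_at (GB.kk_gb hs) hw x) fun y => ?_
  have := mul_le_mul_of_nonneg_left (h y) (kk_pos hs (x - y)).le
  simp only
  linarith

theorem P_upper (hs : 0 < s) (hs' : 0 < s') {m : ℝ} {w : Ed d → ℝ} (hw : Integrable w)
    (h : ∀ x, w x ≤ m * kk s' x) (x : Ed d) : Cv (kk s) w x ≤ m * kk (s + s') x := by
  rw [← kk_semigroup hs hs', ← integral_const_mul]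
  refine integral_mono 
    (gb_cv_integrable_at (GB.kk_gb hs) hw x) ((gb_cv_integrable_at (GB.kk_gb hs) (kk_int hs') x).const_mul m) fun y => ?_
  have := mul_le_mul_of_nonneg_left (h y) (kk_pos hs (x - y)).le
  simp only
  linarith

theorem P_scale (hs : 0 < s) (w : Ed d → ℝ) (x : Ed d) :
    Cv (kk s) w x = ∫ z, kk 1 z * w (x - Real.sqrt s • z) := by
  rw [cv_comm]
  have h1 := Measure.integral_comp_smul (volume : Measure (Ed d)) (fun y => kk s y * w (x - y)) (Real.sqrt s)
  have hsq : 0 < Real.sqrt s := Real.sqrt_pos.mpr hs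
  have hp : 0 < (Real.sqrt s) ^ d := by positivity
  rw [finrank_euclideanSpace_fin, abs_of_pos (by positivity), smul_eq_mul, eq_inv_mul_iff_mul_eq₀ hp.ne', ← integral_const_mul] at h1
  unfold Cv
  rw [show (∫ y, w (x - y) * kk s y) = ∫ y, kk s y * w (x - y) by congr 1; ext y; ring, ← h1]
  congr 1; ext z
  rw [← mul_assoc]; congr 1
  unfold kk
  symm
  rw [norm_smul, Real.norm_eq_abs, abs_of_pos hsq, mul_pow, Real.sq_sqrt hs.le, ← mul_assoc]
  congr 1
  · rw [mul_one, mul_rpow (by positivity) hs.le, ← Real.rpow_natCast, Real.sqrt_eq_rpow, ← Real.rpow_mul hs.le]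
    have : s ^ (1 / 2 * (d:ℝ)) * s ^ (-(d:ℝ) / 2) = 1 := by
      rw [← rpow_add hs]; ring_nf; simp
    linear_combination -(2 * π) ^ (-(d:ℝ)/2) * this
  · congr 1; field_simp

theorem gb_of_compact {h : Ed d → ℝ} (hc : Continuous h) (hs : HasCompactSupport h) :
    ∃ C, 0 ≤ C ∧ ∀ x, |h x| ≤ C * kk 1 x := by
  have hcont : Continuous (fun x => h x / kk 1 x) := hc.div (kk_cont 1) fun x => (kk_pos one_pos x).ne'
  have hcs : HasCompactSupport (fun x => h x / kk 1 x) := by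
    refine hs.mono fun x hx => ?_
    simp only [Function.mem_support] at hx ⊢
    intro h0; exact hx (by simp [h0])
  obtain ⟨C, hC⟩ := hcont.bounded_above_of_compact_support hcs
  refine ⟨|C|, abs_nonneg _, fun x => ?_⟩
  have := hC x
  have hk := kk_pos one_pos x
  rw [Real.norm_eq_abs, abs_div, abs_of_pos hk, div_le_iff₀ hk] at this
  exact this.trans (mul_le_mul_of_nonneg_right (le_abs_self _) hk.le)

open Filter Topology in
theorem P_approx {ε : ℕ → ℝ} (hε : ∀ n, 0 < ε n) (hε1 : ∀ n, ε n ≤ 1) (hε0 : Tendsto ε atTop (𝓝 0))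
    {w : Ed d → ℝ} (hw : Integrable w) :
    Tendsto (fun n => ∫ x, |Cv (kk (ε n)) w x - w x|) atTop (𝓝 0) := by
  have step : ∀ h : Ed d → ℝ, Continuous h → HasCompactSupport h →
      Tendsto (fun n => ∫ x, |Cv (kk (ε n)) h x - h x|) atTop (𝓝 0) := by
    intro h hc hcs
    obtain ⟨B, hB⟩ := hc.bounded_above_of_compact_support hcs
    obtain ⟨C, hC0, hC⟩ := gb_of_compact hc hcs
    have hgb : GB h := GB.mk_le hc.measurable one_pos hC
    have : (0:ℝ) = ∫ x : Ed d, (0:ℝ) := by simp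
    rw [this]
    refine tendsto_integral_of_dominated_convergence
      (fun x => C * 2 ^ ((d:ℝ)/2) * kk 2 x + C * kk 1 x) ?_ ?_ ?_ ?_
    · intro n
      exact (((GB.kk_gb (hε n)).cv (kk_cont _) hgb).sub hgb).abs.integrable.aestronglyMeasurable
    · exact ((kk_int two_pos).const_mul _).add ((kk_int one_pos).const_mul _)
    · intro n
      refine Eventually.of_forall fun x => ?_
      rw [Real.norm_eq_abs, abs_abs]
      refine (abs_sub _ _).trans (add_le_add ?_ (hC x))
      have h1 := cv_bound (kk_cont (d := d) (ε n)).measurable hc.measurable (hε n) one_pos (C := 1)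
        (fun x => by rw [abs_of_pos (kk_pos (hε n) x), one_mul]) hC x
      have h2 : kk (ε n + 1) x ≤ 2 ^ ((d:ℝ)/2) * kk 2 x := by
        refine (kk_le (by linarith [hε n]) (show ε n + 1 ≤ 2 by linarith [hε1 n]) x).trans ?_
        refine mul_le_mul_of_nonneg_right ?_ (kk_pos two_pos x).le
        have := hε n
        refine Real.rpow_le_rpow (by positivity) ?_ (by positivity)
        rw [div_le_iff₀ (by linarith)]; linarith
      rw [one_mul] at h1
      calc _ ≤ C * kk (ε n + 1) x := h1
        _ ≤ C * (2 ^ ((d:ℝ)/2) * kk 2 x) := by gcongr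
        _ = _ := by ring
    · refine Eventually.of_forall fun x => ?_
      have h1 : Tendsto (fun n => Cv (kk (ε n)) h x) atTop (𝓝 (∫ z : Ed d, kk 1 z * h x)) := by
        simp_rw [P_scale (hε _)]
        refine tendsto_integral_of_dominated_convergence (fun z => kk 1 z * B) ?_ ?_ ?_ ?_
        · intro n
          have := kk_cont (d := d) 1
          have : Continuous (fun z : Ed d => kk 1 z * h (x - Real.sqrt (ε n) • z)) := by fun_prop
          exact this.aestronglyMeasurable
        · exact (kk_int one_pos).mul_const B
        · intro n; refine Eventually.of_forall fun z => ?_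
          rw [norm_mul, Real.norm_eq_abs, abs_of_pos (kk_pos one_pos z)]
          exact mul_le_mul_of_nonneg_left (hB _) (kk_pos one_pos z).le
        · refine Eventually.of_forall fun z => ?_
          refine Tendsto.const_mul _ ?_
          have h3 : Tendsto (fun n => x - Real.sqrt (ε n) • z) atTop (𝓝 (x - Real.sqrt 0 • z)) :=
            tendsto_const_nhds.sub ((Real.continuous_sqrt.continuousAt.tendsto.comp hε0).smul_const z)
          rw [Real.sqrt_zero, zero_smul, sub_zero] at h3
          exact hc.continuousAt.tendsto.comp h3
      rw [integral_mul_const, kk_integral one_pos, one_mul] at h1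
      have := (h1.sub_const (h x)).abs
      simpa using this
  rw [Metric.tendsto_nhds]
  intro θ hθ
  obtain ⟨h, hcs, hle, hc, hint⟩ := hw.exists_hasCompactSupport_integral_sub_le (show 0 < θ / 3 by positivity)
  have hev := (tendsto_order.1 (step h hc hcs)).2 (θ / 3) (by positivity)
  filter_upwards [hev] with n hn
  rw [Real.dist_eq, sub_zero, abs_of_nonneg (integral_nonneg fun x => abs_nonneg _)]
  have hd : Integrable (fun x => w x - h x) := hw.sub hint
  have hL := cv_L1 (kk_int (d := d) (hε n)) hd
  have e1 : ∫ x : Ed d, |kk (ε n) x| = 1 := by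
    simp_rw [abs_of_pos (kk_pos (hε n) _)]; exact kk_integral (hε n)
  rw [e1, one_mul] at hL
  have hCd : ∀ x, Cv (kk (ε n)) (fun x => w x - h x) x = Cv (kk (ε n)) w x - Cv (kk (ε n)) h x := by
    intro x; unfold Cv
    rw [← integral_sub (gb_cv_integrable_at (GB.kk_gb (hε n)) hw x) (gb_cv_integrable_at (GB.kk_gb (hε n)) hint x)]
    congr 1; ext y; ring
  have hle' : ∫ x, |w x - h x| ≤ θ / 3 := hle
  have i1 := (cv_integrable (kk_int (hε n)) hd).abs
  have i2 : Integrable (fun x => |Cv (kk (ε n)) h x - h x|) := ((cv_integrable (kk_int (hε n)) hint).sub hint).abs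
  calc ∫ x, |Cv (kk (ε n)) w x - w x| ≤ ∫ x, |Cv (kk (ε n)) (fun x => w x - h x) x| + |Cv (kk (ε n)) h x - h x| + |w x - h x| := by
        refine integral_mono (((cv_integrable (kk_int (hε n)) hw).sub hw).abs) ((i1.add i2).add hd.abs) fun x => ?_
        simp only
        rw [hCd]
        have : Cv (kk (ε n)) w x - w x = (Cv (kk (ε n)) w x - Cv (kk (ε n)) h x) + (Cv (kk (ε n)) h x - h x) + -(w x - h x) := by ring
        rw [this]
        refine (abs_add_le _ _).trans ?_
        rw [abs_neg]
        gcongr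
        exact abs_add_le _ _
    _ = (∫ x, |Cv (kk (ε n)) (fun x => w x - h x) x|) + (∫ x, |Cv (kk (ε n)) h x - h x|) + ∫ x, |w x - h x| := by
        rw [integral_add (i1.fun_add i2) hd.abs, integral_add i1 i2]
    _ < θ := by linarith

end conv2
end ModA4

section ModB1
theorem isub {X : Type*} [MeasurableSpace X] {ν : Measure X} {f g : X → ℝ} (hf : Integrable f ν) (hg : Integrable g ν) :
    Integrable (fun x => f x - g x) ν := hf.sub hg
theorem iadd {X : Type*} [MeasurableSpace X] {ν : Measure X} {f g : X → ℝ} (hf : Integrable f ν) (hg : Integrable g ν) :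
    Integrable (fun x => f x + g x) ν := hf.add hg

/-- measure with density `q` -/
def wd {d : ℕ} (q : Ed d → ℝ) : Measure (Ed d) := volume.withDensity (fun x => ENNReal.ofReal (q x))

/-- densities of elements of P2 -/
structure Pd {d : ℕ} (r : Ed d → ℝ) : Prop where
  meas : Measurable r
  nn : ∀ x, 0 ≤ r x
  int_om : Integrable (fun x => om x * r x)
  mass : ∫ x, r x = 1

def ent {d : ℕ} (r : Ed d → ℝ) : ℝ := ∫ x, r x * Real.log (r x)

def Fr {d : ℕ} (G : Measure (Ed d) → ℝ) (τ : ℝ) (r : Ed d → ℝ) : ℝ := G (wd r) + τ * ent r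

section B1
variable {d : ℕ} {r q : Ed d → ℝ}

theorem Pd.int (h : Pd r) : Integrable r := by
  refine h.int_om.mono' h.meas.aestronglyMeasurable (Filter.Eventually.of_forall fun x => ?_)
  rw [Real.norm_eq_abs, abs_of_nonneg (h.nn x)]
  exact le_mul_of_one_le_left (h.nn x) (one_le_om x)

theorem wd_integral (hm : Measurable r) (hn : ∀ x, 0 ≤ r x) (φ : Ed d → ℝ) :
    ∫ x, φ x ∂(wd r) = ∫ x, φ x * r x := by
  unfold wd
  rw [integral_withDensity_eq_integral_toReal_smul hm.ennreal_ofReal (Filter.Eventually.of_forall fun x => ENNReal.ofReal_lt_top)]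
  congr 1; ext x
  rw [ENNReal.toReal_ofReal (hn x), smul_eq_mul, mul_comm]

theorem wd_integrable (hm : Measurable r) (hn : ∀ x, 0 ≤ r x) (φ : Ed d → ℝ) :
    Integrable φ (wd r) ↔ Integrable (fun x => φ x * r x) := by
  unfold wd
  rw [integrable_withDensity_iff hm.ennreal_ofReal (Filter.Eventually.of_forall fun x => ENNReal.ofReal_lt_top)]
  have : ∀ x, (ENNReal.ofReal (r x)).toReal = r x := fun x => ENNReal.toReal_ofReal (hn x)
  simp_rw [this]

theorem Pd.isP2 (h : Pd r) : IsP2 (wd r) := by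
  constructor
  · constructor
    unfold wd
    rw [withDensity_apply _ MeasurableSet.univ, Measure.restrict_univ,
      ← ofReal_integral_eq_lintegral_ofReal h.int (Filter.Eventually.of_forall h.nn), h.mass, ENNReal.ofReal_one]
  · rw [wd_integrable h.meas h.nn]
    refine h.int_om.mono' ?_ (Filter.Eventually.of_forall fun x => ?_)
    · exact (((continuous_norm.pow 2).measurable).mul h.meas).aestronglyMeasurable
    · rw [Real.norm_eq_abs, abs_of_nonneg (mul_nonneg (sq_nonneg _) (h.nn x))]
      refine mul_le_mul_of_nonneg_right ?_ (h.nn x)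
      unfold om; linarith

theorem wd_negEnt (h : Pd r) (hi : Integrable (fun x => r x * Real.log (r x))) :
    negEnt (wd r) = (ent r : EReal) := by
  have hae : (wd r).rnDeriv volume =ᵐ[volume] fun x => ENNReal.ofReal (r x) :=
    Measure.rnDeriv_withDensity _ h.meas.ennreal_ofReal
  have hae2 : (fun x => ((wd r).rnDeriv volume x).toReal * Real.log ((wd r).rnDeriv volume x).toReal)
      =ᵐ[volume] fun x => r x * Real.log (r x) := by
    filter_upwards [hae] with x hx
    rw [hx, ENNReal.toReal_ofReal (h.nn x)]
  unfold negEnt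
  rw [if_pos ⟨withDensity_absolutelyContinuous _ _, hi.congr hae2.symm⟩, integral_congr_ae hae2]
  rfl

theorem obj_wd (G : Measure (Ed d) → ℝ) (τ : ℝ) (h : Pd r) (hi : Integrable (fun x => r x * Real.log (r x))) :
    obj G τ (wd r) = (Fr G τ r : EReal) := by
  unfold obj Fr
  rw [wd_negEnt h hi]; norm_cast

theorem exists_wd {G : Measure (Ed d) → ℝ} {τ : ℝ} (hτ : 0 < τ) {ν : Measure (Ed d)} (h2 : IsP2 ν)
    (hf : obj G τ ν ≠ ⊤) : ∃ r, Pd r ∧ Integrable (fun x => r x * Real.log (r x)) ∧ ν = wd r := by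
  have hne : negEnt ν ≠ ⊤ := by
    intro h0; apply hf
    unfold obj
    rw [h0, EReal.coe_mul_top_of_pos hτ]; rfl
  unfold negEnt at hne
  split_ifs at hne with hc
  swap
  · exact absurd rfl hne
  obtain ⟨hac, hi⟩ := hc
  haveI := h2.1
  have hlt : ∀ᵐ x, ν.rnDeriv volume x < ⊤ := Measure.rnDeriv_lt_top ν volume
  have hm : Measurable fun x => (ν.rnDeriv volume x).toReal := (Measure.measurable_rnDeriv ν volume).ennreal_toReal
  have hwd : ν = wd fun x => (ν.rnDeriv volume x).toReal := by
    unfold wd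
    conv_lhs => rw [← Measure.withDensity_rnDeriv_eq ν volume hac]
    refine withDensity_congr_ae ?_
    filter_upwards [hlt] with x hx
    rw [ENNReal.ofReal_toReal hx.ne]
  refine ⟨_, ⟨hm, fun x => ENNReal.toReal_nonneg, ?_, ?_⟩, hi, hwd⟩
  · have h3 : Integrable (fun x => om x) ν := by
      unfold om; exact (integrable_const _).add h2.2
    rw [hwd, wd_integrable hm (fun x => ENNReal.toReal_nonneg)] at h3
    exact h3
  · have h3 : ∫ x, (1:ℝ) ∂ν = 1 := by simp
    rw [hwd, wd_integral hm (fun x => ENNReal.toReal_nonneg)] at h3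
    simpa using h3

theorem mix_wd (hq : Pd q) (hr : Pd r) {s : ℝ} (h0 : 0 ≤ s) (h1 : s ≤ 1) :
    mix s (wd q) (wd r) = wd fun x => (1 - s) * q x + s * r x := by
  unfold mix wd
  rw [← withDensity_smul _ hq.meas.ennreal_ofReal, ← withDensity_smul _ hr.meas.ennreal_ofReal,
    ← withDensity_add_left (hq.meas.ennreal_ofReal.const_smul _)]
  congr 1; ext x
  simp only [Pi.add_apply, Pi.smul_apply, smul_eq_mul]
  rw [ENNReal.ofReal_add (mul_nonneg (by linarith) (hq.nn x)) (mul_nonneg h0 (hr.nn x)),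
    ENNReal.ofReal_mul (by linarith), ENNReal.ofReal_mul h0]

theorem Pd.mix (hq : Pd q) (hr : Pd r) {s : ℝ} (h0 : 0 ≤ s) (h1 : s ≤ 1) :
    Pd fun x => (1 - s) * q x + s * r x := by
  refine ⟨(hq.meas.const_mul _).add (hr.meas.const_mul _), fun x => add_nonneg (mul_nonneg (by linarith) (hq.nn x)) (mul_nonneg h0 (hr.nn x)), ?_, ?_⟩
  · refine ((hq.int_om.const_mul (1 - s)).add (hr.int_om.const_mul s)).congr (Filter.Eventually.of_forall fun x => ?_)
    simp only [Pi.add_apply]; ring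
  · rw [integral_add (hq.int.const_mul _) (hr.int.const_mul _), integral_const_mul, integral_const_mul, hq.mass, hr.mass]; ring

theorem tangent_xlogx {x y : ℝ} (hx : 0 < x) (hy : 0 ≤ y) :
    x * Real.log x + (1 + Real.log x) * (y - x) ≤ y * Real.log y := by
  rcases hy.eq_or_lt with rfl | hy
  · simp; nlinarith
  have h1 : Real.log (x / y) ≤ x / y - 1 := Real.log_le_sub_one_of_pos (by positivity)
  rw [Real.log_div hx.ne' hy.ne'] at h1
  have h2 : y * (Real.log x - Real.log y) ≤ x - y := by
    calc _ ≤ y * (x / y - 1) := mul_le_mul_of_nonneg_left h1 hy.le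
      _ = x - y := by field_simp
  nlinarith

/-- class of densities between Gaussians -/
structure Dn {d : ℕ} (m a M b : ℝ) (q : Ed d → ℝ) : Prop where
  meas : Measurable q
  hm : 0 < m
  ha : 0 < a
  hM : 0 < M
  hb : 0 < b
  lb : ∀ x, m * kk a x ≤ q x
  ub : ∀ x, q x ≤ M * kk b x
  mass : ∫ x, q x = 1

variable {m a M b : ℝ}
theorem Dn.pos (h : Dn m a M b q) (x : Ed d) : 0 < q x :=
  lt_of_lt_of_le (mul_pos h.hm (kk_pos h.ha x)) (h.lb x)

theorem Dn.gb (h : Dn m a M b q) : GB q :=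
  GB.mk_le h.meas h.hb fun x => by rw [abs_of_pos (h.pos x)]; exact h.ub x

theorem Dn.pd (h : Dn m a M b q) : Pd q :=
  ⟨h.meas, fun x => (h.pos x).le, (GB.PG_mul PG.om_pg h.gb).integrable, h.mass⟩

theorem Dn.weaken {m' M' b' : ℝ} (h : Dn m a M b q) (hm' : 0 < m') (hmm : m' ≤ m)
    (hbb : b ≤ b') (hMM : M * (b' / b) ^ ((d:ℝ)/2) ≤ M') : Dn m' a M' b' q := by
  have hb' : 0 < b' := h.hb.trans_le hbb
  have h0 : 0 < (b' / b) ^ ((d:ℝ)/2) := Real.rpow_pos_of_pos (div_pos hb' h.hb) _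
  refine ⟨h.meas, hm', h.ha, lt_of_lt_of_le (mul_pos h.hM h0) hMM, hb', fun x => ?_, fun x => ?_, h.mass⟩
  · exact (mul_le_mul_of_nonneg_right hmm (kk_pos h.ha x).le).trans (h.lb x)
  · refine (h.ub x).trans ((mul_le_mul_of_nonneg_left (kk_le h.hb hbb x) h.hM.le).trans ?_)
    rw [← mul_assoc]
    exact mul_le_mul_of_nonneg_right hMM (kk_pos hb' x).le

theorem log_kk {s : ℝ} (hs : 0 < s) (x : Ed d) :
    Real.log (kk s x) = -(d:ℝ)/2 * Real.log (2 * π * s) - ‖x‖^2 / (2 * s) := by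
  unfold kk
  rw [Real.log_mul (by positivity) (Real.exp_pos _).ne', Real.log_exp, Real.log_rpow (by positivity)]
  ring

theorem log_bound (hm : 0 < m) (ha : 0 < a) (hM : 0 < M) (hb : 0 < b) :
    ∃ A, 0 ≤ A ∧ ∀ q : Ed d → ℝ, Dn m a M b q → ∀ x, |Real.log (q x)| ≤ A * om x := by
  refine ⟨|Real.log m| + |-(d:ℝ)/2 * Real.log (2 * π * a)| + 1/(2*a) + |Real.log M| + |-(d:ℝ)/2 * Real.log (2 * π * b)|, by positivity, fun q h x => ?_⟩
  have h1 : Real.log (m * kk a x) ≤ Real.log (q x) := Real.log_le_log (mul_pos hm (kk_pos ha x)) (h.lb x)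
  have h2 : Real.log (q x) ≤ Real.log (M * kk b x) := Real.log_le_log (h.pos x) (h.ub x)
  rw [Real.log_mul hm.ne' (kk_pos ha x).ne', log_kk ha] at h1
  rw [Real.log_mul hM.ne' (kk_pos hb x).ne', log_kk hb] at h2
  have h3 : 0 ≤ ‖x‖^2 / (2*b) := by positivity
  have h4 : ‖x‖^2 / (2*a) ≤ 1/(2*a) * om x := by
    unfold om; rw [div_eq_mul_inv, mul_comm, ← one_div]
    apply mul_le_mul_of_nonneg_left _ (by positivity); linarith
  have ho := one_le_om x
  have k1 := le_mul_of_one_le_right (abs_nonneg (Real.log m)) ho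
  have k2 := le_mul_of_one_le_right (abs_nonneg (-(d:ℝ)/2 * Real.log (2 * π * a))) ho
  have k3 := le_mul_of_one_le_right (abs_nonneg (Real.log M)) ho
  have k4 := le_mul_of_one_le_right (abs_nonneg (-(d:ℝ)/2 * Real.log (2 * π * b))) ho
  have n1 := neg_abs_le (Real.log m)
  have n2 := neg_abs_le (-(d:ℝ)/2 * Real.log (2 * π * a))
  have n3 := le_abs_self (Real.log M)
  have n4 := le_abs_self (-(d:ℝ)/2 * Real.log (2 * π * b))
  have p1 : 0 ≤ 1/(2*a) * om x := by have := om_pos x; positivity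
  have q1 := abs_nonneg (Real.log m)
  have q2 := abs_nonneg (-(d:ℝ)/2 * Real.log (2 * π * a))
  have q3 := abs_nonneg (Real.log M)
  have q4 := abs_nonneg (-(d:ℝ)/2 * Real.log (2 * π * b))
  rw [abs_le]; constructor <;> nlinarith

theorem Dn.log_pg (h : Dn m a M b q) : PG (fun x => Real.log (q x)) := by
  obtain ⟨A, hA, hb⟩ := log_bound (d := d) h.hm h.ha h.hM h.hb
  exact PG.of_om (Real.measurable_log.comp h.meas) (hb q h)

theorem Dn.ent_int (h : Dn m a M b q) : Integrable (fun x => q x * Real.log (q x)) :=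
  (h.gb.mul_PG h.log_pg).integrable

/-- standing assumptions -/
structure HF {d : ℕ} (α L τ : ℝ) (G : Measure (Ed d) → ℝ) (G' : Measure (Ed d) → Ed d → ℝ) : Prop where
  hα : 0 < α
  hL : 0 < L
  hτ : 0 < τ
  hA : AssumptionAii G G' α L
  hc : ConvexFun (obj G τ)

variable {α L τ : ℝ} {G : Measure (Ed d) → ℝ} {G' : Measure (Ed d) → Ed d → ℝ}

theorem hasDeriv_gradient_bound {V : Ed d → ℝ} (hV : Differentiable ℝ V) (x : Ed d) :
    ‖fderiv ℝ V x‖ = ‖gradient V x‖ := by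
  unfold gradient
  simp

theorem HF.split (H : HF α L τ G G') {μ : Measure (Ed d)} (hμ : IsP2 μ) :
    ∃ V : Ed d → ℝ, ContDiff ℝ 1 V ∧ (∀ x, G' μ x = α / 2 * ‖x‖ ^ 2 + V x) ∧ ∀ x, ‖fderiv ℝ V x‖ ≤ L := by
  obtain ⟨h1, h2, V, h3, h4⟩ := H.hA μ hμ
  have e : V = fun x => G' μ x - α / 2 * ‖x‖^2 := by ext x; rw [h3]; ring
  have hV : ContDiff ℝ 1 V := by
    rw [e]; exact h2.sub (contDiff_const.mul (contDiff_norm_sq ℝ))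
  exact ⟨V, hV, h3, fun x => by rw [hasDeriv_gradient_bound (hV.differentiable (by norm_num))]; exact h4 x⟩

theorem lip_of_fderiv {V : Ed d → ℝ} (hV : Differentiable ℝ V) {C : ℝ} (h : ∀ x, ‖fderiv ℝ V x‖ ≤ C) (x y : Ed d) :
    |V x - V y| ≤ C * ‖x - y‖ := by
  have := convex_univ.norm_image_sub_le_of_norm_fderiv_le (𝕜 := ℝ) (f := V) (C := C) (fun x _ => hV x) (fun x _ => h x) (mem_univ y) (mem_univ x)
  simpa using this

theorem HF.G'_bound (H : HF α L τ G G') {μ : Measure (Ed d)} (hμ : IsP2 μ) (x : Ed d) :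
    |G' μ x - G' μ 0| ≤ (α / 2 + L) * om x := by
  obtain ⟨V, h1, h2, h3⟩ := H.split hμ
  have := lip_of_fderiv (h1.differentiable (by norm_num)) h3 x 0
  rw [sub_zero] at this
  rw [h2 x, h2 0, norm_zero]
  have hn := norm_le_om x
  have e : α / 2 * ‖x‖^2 + V x - (α / 2 * 0^2 + V 0) = α/2*‖x‖^2 + (V x - V 0) := by ring
  rw [e]
  refine (abs_add_le _ _).trans ?_
  have hα := H.hα
  rw [abs_of_nonneg (by positivity)]
  have : ‖x‖^2 ≤ om x := by unfold om; linarith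
  nlinarith [H.hL, mul_le_mul_of_nonneg_left this hα.le, mul_le_mul_of_nonneg_left hn H.hL.le]

theorem HF.G'_cont (H : HF α L τ G G') {μ : Measure (Ed d)} (hμ : IsP2 μ) : Continuous (G' μ) :=
  (H.hA μ hμ).2.1.continuous

theorem HF.G'_pg (H : HF α L τ G G') {μ : Measure (Ed d)} (hμ : IsP2 μ) : PG (G' μ) := by
  have h1 : PG (fun x => G' μ x - G' μ 0) :=
    PG.of_om ((H.G'_cont hμ).sub continuous_const).measurable (H.G'_bound hμ)
  simpa using h1.add (PG.const (G' μ 0))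

/-- first variation of F -/
def ff {d : ℕ} (G' : Measure (Ed d) → Ed d → ℝ) (τ : ℝ) (q : Ed d → ℝ) (x : Ed d) : ℝ :=
  G' (wd q) x + τ * Real.log (q x)

theorem ff_bound (H : HF α L τ G G') (hm : 0 < m) (ha : 0 < a) (hM : 0 < M) (hb : 0 < b) :
    ∃ A, 0 ≤ A ∧ ∀ q : Ed d → ℝ, Dn m a M b q → ∀ x, |ff G' τ q x - G' (wd q) 0| ≤ A * om x := by
  obtain ⟨A, hA, h⟩ := log_bound (d := d) hm ha hM hb
  have := H.hα; have := H.hL; have := H.hτ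
  refine ⟨(α/2+L) + τ * A, by positivity, fun q hq x => ?_⟩
  unfold ff
  have h1 := H.G'_bound hq.pd.isP2 x
  have h2 := h q hq x
  rw [show G' (wd q) x + τ * Real.log (q x) - G' (wd q) 0 = (G' (wd q) x - G' (wd q) 0) + τ * Real.log (q x) by ring]
  refine (abs_add_le _ _).trans ?_
  rw [abs_mul, abs_of_pos H.hτ, add_mul, mul_assoc]
  gcongr

theorem HF.ff_pg (H : HF α L τ G G') (hq : Dn m a M b q) : PG (ff G' τ q) :=
  (H.G'_pg hq.pd.isP2).add (hq.log_pg.const_mul τ)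

theorem pd_om_int (h : Pd r) {φ : Ed d → ℝ} (hm : Measurable φ) {A c : ℝ} (hb : ∀ x, |φ x - c| ≤ A * om x) :
    Integrable (fun x => φ x * r x) := by
  refine (h.int_om.const_mul (A + |c|)).mono' (hm.mul h.meas).aestronglyMeasurable (Filter.Eventually.of_forall fun x => ?_)
  rw [norm_mul, Real.norm_eq_abs, Real.norm_eq_abs, abs_of_nonneg (h.nn x), ← mul_assoc]
  refine mul_le_mul_of_nonneg_right ?_ (h.nn x)
  have h1 : |φ x| ≤ |φ x - c| + |c| := by
    have := abs_add_le (φ x - c) c; simpa using this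
  nlinarith [hb x, le_mul_of_one_le_right (abs_nonneg c) (one_le_om x)]

open Filter Topology in
theorem tangent (H : HF α L τ G G') (hq : Dn m a M b q) (hr : Pd r)
    (hi : Integrable (fun x => r x * Real.log (r x))) :
    Fr G τ q + (∫ x, ff G' τ q x * (r x - q x)) ≤ Fr G τ r := by
  have hqp := hq.pd
  obtain ⟨A, hA, hlog⟩ := log_bound (d := d) hq.hm hq.ha hq.hM hq.hb
  have hlog' : ∀ x, |Real.log (q x) - 0| ≤ A * om x := fun x => by simpa using hlog q hq x
  have lm : Measurable (fun x => Real.log (q x)) := Real.measurable_log.comp hq.meas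
  have gm := (H.G'_cont hqp.isP2).measurable
  have i1 := pd_om_int hr lm hlog'
  have i2 := pd_om_int hqp lm hlog'
  have i3 := pd_om_int hr gm (H.G'_bound hqp.isP2)
  have i4 := pd_om_int hqp gm (H.G'_bound hqp.isP2)
  have il : Integrable (fun x => Real.log (q x) * (r x - q x)) := by
    simpa [mul_sub] using isub i1 i2
  have ig : Integrable (fun x => G' (wd q) x * (r x - q x)) := by
    simpa [mul_sub] using isub i3 i4
  have eff : ∫ x, ff G' τ q x * (r x - q x) = (∫ x, G' (wd q) x * (r x - q x)) + τ * ∫ x, Real.log (q x) * (r x - q x) := by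
    rw [← integral_const_mul, ← integral_add ig (il.const_mul τ)]
    congr 1; ext x; unfold ff; ring
  -- key inequality
  have key : ∀ s : ℝ, 0 < s → s ≤ 1 → (G (mix s (wd q) (wd r)) - G (wd q)) + s * (τ * ∫ x, Real.log (q x) * (r x - q x)) ≤ s * (Fr G τ r - Fr G τ q) := by
    intro s h0 h1
    set z := fun x => (1 - s) * q x + s * r x with hz
    have hzp : Pd z := hqp.mix hr h0.le h1
    have hlow : ∀ x, q x * Real.log (q x) + s * ((r x - q x) + Real.log (q x) * (r x - q x)) ≤ z x * Real.log (z x) := by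
      intro x
      have := tangent_xlogx (hq.pos x) (hzp.nn x)
      have e : z x - q x = s * (r x - q x) := by simp only [hz]; ring
      rw [e] at this; linarith
    have hup : ∀ x, z x * Real.log (z x) ≤ (1 - s) * (q x * Real.log (q x)) + s * (r x * Real.log (r x)) := by
      intro x
      have := Real.convexOn_mul_log.2 (show q x ∈ Set.Ici 0 from hqp.nn x) (show r x ∈ Set.Ici 0 from hr.nn x) (show 0 ≤ 1 - s by linarith) h0.le (by ring)
      simpa [hz] using this
    have ilow : Integrable (fun x => q x * Real.log (q x) + s * ((r x - q x) + Real.log (q x) * (r x - q x))) :=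
      hq.ent_int.add (((hr.int.sub hqp.int).add il).const_mul s)
    have iup : Integrable (fun x => (1 - s) * (q x * Real.log (q x)) + s * (r x * Real.log (r x))) :=
      (hq.ent_int.const_mul _).add (hi.const_mul _)
    have hzi : Integrable (fun x => z x * Real.log (z x)) := by
      refine (ilow.abs.add iup.abs).mono' (hzp.meas.mul (Real.measurable_log.comp hzp.meas)).aestronglyMeasurable (Eventually.of_forall fun x => ?_)
      simp only [Pi.add_apply]
      rw [Real.norm_eq_abs, abs_le]
      constructor
      · have := hlow x; have := neg_abs_le (q x * Real.log (q x) + s * ((r x - q x) + Real.log (q x) * (r x - q x)))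
        have := abs_nonneg ((1 - s) * (q x * Real.log (q x)) + s * (r x * Real.log (r x)))
        linarith
      · have := hup x; have := abs_nonneg (q x * Real.log (q x) + s * ((r x - q x) + Real.log (q x) * (r x - q x)))
        have := le_abs_self ((1 - s) * (q x * Real.log (q x)) + s * (r x * Real.log (r x)))
        linarith
    have hent : ent q + s * ∫ x, Real.log (q x) * (r x - q x) ≤ ent z := by
      have h3 := integral_mono ilow hzi hlow
      rw [integral_add hq.ent_int ((iadd (isub hr.int hqp.int) il).const_mul s), integral_const_mul,
        integral_add (isub hr.int hqp.int) il, integral_sub hr.int hqp.int, hr.mass, hqp.mass] at h3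
      unfold ent; linarith
    have hcv := H.hc hqp.isP2 hr.isP2 h0.le h1
    rw [mix_wd hqp hr h0.le h1, obj_wd G τ hzp hzi, obj_wd G τ hqp hq.ent_int, obj_wd G τ hr hi] at hcv
    have hcv' : Fr G τ z ≤ (1 - s) * Fr G τ q + s * Fr G τ r := by exact_mod_cast hcv
    rw [mix_wd hqp hr h0.le h1]
    have := mul_le_mul_of_nonneg_left hent H.hτ.le
    unfold Fr at hcv' ⊢
    linarith
  have hd := (H.hA _ hqp.isP2).1 _ hr.isP2
  rw [wd_integral hr.meas hr.nn, wd_integral hq.meas hqp.nn] at hd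
  have hd2 := (hd.mono Set.Ioi_subset_Ici_self)
  rw [hasDerivWithinAt_iff_tendsto_slope' (by simp)] at hd2
  have e0 : mix 0 (wd q) (wd r) = wd q := by
    unfold mix; simp
  have hle := le_of_tendsto hd2 (b := (Fr G τ r - Fr G τ q) - (τ * ∫ x, Real.log (q x) * (r x - q x))) (by
    have : Set.Ioc (0:ℝ) 1 ∈ 𝓝[>] (0:ℝ) := Ioc_mem_nhdsGT one_pos
    filter_upwards [this] with s hs
    rw [slope_def_field, sub_zero, e0, div_le_iff₀ hs.1]
    linarith [key s hs.1 hs.2])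
  rw [eff]
  have e3 : ∫ x, G' (wd q) x * (r x - q x) = (∫ x, G' (wd q) x * r x) - ∫ x, G' (wd q) x * q x := by
    rw [← integral_sub i3 i4]; congr 1; ext x; ring
  rw [e3]; linarith

end B1
end ModB1

section ModB2
section B2
variable {d : ℕ} {r q p : Ed d → ℝ} {m a M b : ℝ}
variable {α L τ : ℝ} {G : Measure (Ed d) → ℝ} {G' : Measure (Ed d) → Ed d → ℝ}

theorem int_shift {φ h : Ed d → ℝ} (hφ : Integrable (fun x => φ x * h x)) (hh : Integrable h) (h0 : ∫ x, h x = 0) (c : ℝ) :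
    ∫ x, φ x * h x = ∫ x, (φ x - c) * h x := by
  have : ∀ x, (φ x - c) * h x = φ x * h x - c * h x := fun x => by ring
  simp_rw [this]
  rw [integral_sub hφ (hh.const_mul c), integral_const_mul, h0]; ring

theorem Dn.sub_int {m' a' M' b' : ℝ} (h : Dn m a M b q) (h' : Dn m' a' M' b' p) : GB (fun x => q x - p x) := h.gb.sub h'.gb

theorem F_lip (H : HF α L τ G G') (hm : 0 < m) (ha : 0 < a) (hM : 0 < M) (hb : 0 < b) :
    ∃ A, 0 ≤ A ∧ ∀ q p : Ed d → ℝ, Dn m a M b q → Dn m a M b p →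
      |Fr G τ q - Fr G τ p| ≤ A * ∫ x, om x * |q x - p x| := by
  obtain ⟨A, hA, hf⟩ := ff_bound H hm ha hM hb
  have one : ∀ q p : Ed d → ℝ, Dn m a M b q → Dn m a M b p → Fr G τ q - Fr G τ p ≤ A * ∫ x, om x * |q x - p x| := by
    intro q p hq hp
    have h1 := tangent H hq hp.pd hp.ent_int
    have hg : GB (fun x => p x - q x) := hp.sub_int hq
    have h0 : ∫ x, (p x - q x) = 0 := by
      rw [integral_sub hp.pd.int hq.pd.int, hp.mass, hq.mass, sub_self]
    rw [int_shift (GB.PG_mul (H.ff_pg hq) hg).integrable hg.integrable h0 (G' (wd q) 0)] at h1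
    have h2 : |∫ x, (ff G' τ q x - G' (wd q) 0) * (p x - q x)| ≤ ∫ x, A * (om x * |q x - p x|) := by
      refine abs_int_le ?_ fun x => ?_
      · exact (GB.PG_mul PG.om_pg (hq.sub_int hp).abs).integrable.const_mul A
      · rw [abs_mul, abs_sub_comm (p x), ← mul_assoc]
        exact mul_le_mul_of_nonneg_right (hf q hq x) (abs_nonneg _)
    rw [integral_const_mul] at h2
    linarith [neg_abs_le (∫ x, (ff G' τ q x - G' (wd q) 0) * (p x - q x))]
  refine ⟨A, hA, fun q p hq hp => ?_⟩
  rw [abs_le]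
  have h1 := one q p hq hp
  have h2 := one p q hp hq
  have e : ∫ x, om x * |p x - q x| = ∫ x, om x * |q x - p x| := by
    congr 1; ext x; rw [abs_sub_comm]
  rw [e] at h2
  constructor <;> linarith

theorem log_diff {x y c : ℝ} (hc : 0 < c) (hx : c ≤ x) (hy : c ≤ y) : |Real.log x - Real.log y| ≤ |x - y| / c := by
  have one : ∀ x y : ℝ, c ≤ x → c ≤ y → Real.log x - Real.log y ≤ |x - y| / c := by
    intro x y hx hy
    have hx0 := hc.trans_le hx
    have hy0 := hc.trans_le hy
    rw [← Real.log_div hx0.ne' hy0.ne']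
    refine (Real.log_le_sub_one_of_pos (by positivity)).trans ?_
    have : x / y - 1 = (x - y) / y := by field_simp
    rw [this]
    calc (x - y) / y ≤ |x - y| / y := by gcongr; exact le_abs_self _
      _ ≤ |x - y| / c := by gcongr
  rw [abs_le]
  have h1 := one x y hx hy
  have h2 := one y x hy hx
  rw [abs_sub_comm] at h2
  constructor <;> linarith

theorem Dn.perturb (h : Dn m a M b q) {η : Ed d → ℝ} (hη : Measurable η) {C : ℝ} (hC : ∀ x, |η x| ≤ C * kk a x)
    (h0 : ∫ x, η x = 0) {s : ℝ} (hs : |s| * C ≤ m / 2) : Dn (m/2) a (2*M) b (fun x => q x + s * η x) := by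
  have hgb : GB η := GB.mk_le hη h.ha hC
  have hk : ∀ x, |s * η x| ≤ q x / 2 := fun x => by
    rw [abs_mul]
    calc |s| * |η x| ≤ |s| * (C * kk a x) := mul_le_mul_of_nonneg_left (hC x) (abs_nonneg _)
      _ = |s| * C * kk a x := by ring
      _ ≤ m / 2 * kk a x := mul_le_mul_of_nonneg_right hs (kk_pos h.ha x).le
      _ ≤ q x / 2 := by linarith [h.lb x]
  refine ⟨h.meas.add (hη.const_mul s), by have := h.hm; positivity, h.ha, by have := h.hM; positivity, h.hb, fun x => ?_, fun x => ?_, ?_⟩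
  · have := (abs_le.1 (hk x)).1; linarith [h.lb x]
  · have := (abs_le.1 (hk x)).2; linarith [h.ub x, h.pos x]
  · rw [integral_add h.pd.int (hgb.integrable.const_mul s), integral_const_mul, h0, h.mass]; ring

open Filter Topology in
theorem demi_aux (H : HF α L τ G G') {qn : ℕ → Ed d → ℝ} (hq : ∀ n, Dn m a M b (qn n)) (hp : Dn m a M b p)
    (hconv : Tendsto (fun n => ∫ x, om x * |qn n x - p x|) atTop (𝓝 0))
    {η : Ed d → ℝ} (hη : Measurable η) {C : ℝ} (hC : ∀ x, |η x| ≤ C * kk a x)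
    (h0 : ∫ x, η x = 0) {θ : ℝ} (hθ : 0 < θ) :
    ∀ᶠ n in atTop, ∫ x, (G' (wd (qn n)) x - G' (wd p) x) * η x ≤ θ := by
  have hgb : GB η := GB.mk_le hη hp.ha hC
  have hm := hp.hm
  have ha := hp.ha
  have hτ := H.hτ
  have hC0 : 0 ≤ C := nonneg_of_mul_nonneg_left ((abs_nonneg _).trans (hC 0)) (kk_pos ha 0)
  set N := ∫ x, |η x| with hN
  have hN0 : 0 ≤ N := integral_nonneg fun x => abs_nonneg _
  set s0 := m / (2 * (C + 1)) with hs0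
  have hs0p : 0 < s0 := by positivity
  have hsC : s0 * C ≤ m / 2 := by
    rw [hs0, div_mul_eq_mul_div, div_le_div_iff₀ (by positivity) (by norm_num)]; nlinarith
  have pert : ∀ {q : Ed d → ℝ}, Dn m a M b q → ∀ s, 0 ≤ s → s ≤ s0 → Dn (m/2) a (2*M) b (fun x => q x + s * η x) :=
    fun hq s h1 h2 => hq.perturb hη hC h0 (by rw [abs_of_nonneg h1]; exact (mul_le_mul_of_nonneg_right h2 hC0).trans hsC)
  have hpi : ∀ {φ : Ed d → ℝ}, PG φ → Integrable (fun x => φ x * η x) := fun h => (GB.PG_mul h hgb).integrable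
  have gI : Integrable (fun x => G' (wd p) x * η x) := hpi (H.G'_pg hp.pd.isP2)
  have lI : Integrable (fun x => Real.log (p x) * η x) := hpi hp.log_pg
  -- G derivative
  have hr := pert hp s0 hs0p.le le_rfl
  have hd := (H.hA _ hp.pd.isP2).1 _ hr.pd.isP2
  rw [wd_integral hr.meas hr.pd.nn, wd_integral hp.meas hp.pd.nn] at hd
  have e1 : (∫ x, G' (wd p) x * (p x + s0 * η x)) - ∫ x, G' (wd p) x * p x = s0 * ∫ x, G' (wd p) x * η x := by
    rw [← integral_sub (GB.PG_mul (H.G'_pg hp.pd.isP2) hr.gb).integrable (GB.PG_mul (H.G'_pg hp.pd.isP2) hp.gb).integrable,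
      ← integral_const_mul]
    congr 1; ext x; ring
  rw [e1] at hd
  have hd2 := (hd.mono Set.Ioi_subset_Ici_self)
  rw [hasDerivWithinAt_iff_tendsto_slope' (by simp)] at hd2
  have e0 : mix 0 (wd p) (wd fun x => p x + s0 * η x) = wd p := by
    unfold mix; simp
  have hev1 := (tendsto_order.1 hd2).2 (s0 * (∫ x, G' (wd p) x * η x) + s0 * (θ/4)) (by linarith [mul_pos hs0p (show 0 < θ/4 by positivity)])
  have hev2 : ∀ᶠ t in 𝓝[>] (0:ℝ), t ∈ Set.Ioc (0:ℝ) 1 := Ioc_mem_nhdsGT one_pos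
  have hev3 : ∀ᶠ t in 𝓝[>] (0:ℝ), τ * (t * s0 * (2 * C / m) * N) < θ / 4 := by
    have : Tendsto (fun t : ℝ => τ * (t * s0 * (2 * C / m) * N)) (𝓝 0) (𝓝 (τ * (0 * s0 * (2 * C / m) * N))) := by
      apply Continuous.tendsto; fun_prop
    rw [zero_mul, zero_mul, zero_mul, mul_zero] at this
    exact ((tendsto_order.1 this).2 _ (by positivity)).filter_mono nhdsWithin_le_nhds
  obtain ⟨t, ht1, ht2, ht3⟩ := (hev1.and (hev2.and hev3)).exists
  set s := t * s0 with hs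
  have hsp : 0 < s := mul_pos ht2.1 hs0p
  have hss : s ≤ s0 := by rw [hs]; nlinarith [ht2.2]
  have hps := pert hp s hsp.le hss
  have emix : mix t (wd p) (wd fun x => p x + s0 * η x) = wd fun x => p x + s * η x := by
    rw [mix_wd hp.pd hr.pd ht2.1.le ht2.2]; congr 1; ext x; rw [hs]; ring
  rw [slope_def_field, sub_zero, e0, emix, div_lt_iff₀ ht2.1] at ht1
  -- entropy bound
  have hent : ent (fun x => p x + s * η x) - ent p ≤ s * (∫ x, Real.log (p x) * η x) + s * (s * (2 * C / m) * N) := by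
    have hE := hps.ent_int
    have e2 : ent (fun x => p x + s * η x) - ent p = ∫ x, ((p x + s * η x) * Real.log (p x + s * η x) - p x * Real.log (p x)) := by
      unfold ent; rw [integral_sub hE hp.ent_int]
    rw [e2]
    have e3 : s * (∫ x, Real.log (p x) * η x) + s * (s * (2 * C / m) * N) = ∫ x, ((s * η x + s * (Real.log (p x) * η x)) + s * (s * (2 * C / m) * |η x|)) := by
      rw [integral_add (iadd (hgb.integrable.const_mul s) (lI.const_mul s)) ((hgb.abs.integrable.const_mul _).const_mul _),
        integral_add (hgb.integrable.const_mul s) (lI.const_mul s)]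
      simp only [integral_const_mul]; rw [h0]; ring
    rw [e3]
    refine integral_mono (isub hE hp.ent_int) (iadd (iadd (hgb.integrable.const_mul s) (lI.const_mul s)) ((hgb.abs.integrable.const_mul _).const_mul _)) fun x => ?_
    have h1 := tangent_xlogx (hps.pos x) (hp.pos x).le
    have h2 : |Real.log (p x + s * η x) - Real.log (p x)| ≤ |p x + s * η x - p x| / (m/2 * kk a x) :=
      log_diff (by have := kk_pos ha x; positivity) (hps.lb x) (by have := hp.lb x; have := kk_pos ha x; nlinarith)
    have h3 : |p x + s * η x - p x| / (m/2 * kk a x) ≤ s * (2 * C / m) := by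
      rw [div_le_iff₀ (by have := kk_pos ha x; positivity), add_sub_cancel_left, abs_mul, abs_of_pos hsp]
      have : s * (2 * C / m) * (m / 2 * kk a x) = s * (C * kk a x) := by field_simp
      rw [this]; exact mul_le_mul_of_nonneg_left (hC x) hsp.le
    have h4 : (Real.log (p x + s * η x) - Real.log (p x)) * η x ≤ s * (2 * C / m) * |η x| := by
      refine (le_abs_self _).trans ?_
      rw [abs_mul]
      exact mul_le_mul_of_nonneg_right (h2.trans h3) (abs_nonneg _)
    have h5 := mul_le_mul_of_nonneg_left h4 hsp.le
    simp only at h1 ⊢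
    linarith
  have hFp : Fr G τ (fun x => p x + s * η x) - Fr G τ p ≤ s * (∫ x, ff G' τ p x * η x) + s * (θ/2) := by
    have e4 : ∫ x, ff G' τ p x * η x = (∫ x, G' (wd p) x * η x) + τ * ∫ x, Real.log (p x) * η x := by
      rw [← integral_const_mul, ← integral_add gI (lI.const_mul τ)]
      congr 1; ext x; unfold ff; ring
    rw [e4]
    have h1 := mul_le_mul_of_nonneg_left hent hτ.le
    have h2 := mul_lt_mul_of_pos_left ht3 hsp
    have h3 : (s0 * (∫ x, G' (wd p) x * η x) + s0 * (θ/4)) * t = s * (∫ x, G' (wd p) x * η x) + s * (θ/4) := by rw [hs]; ring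
    rw [h3] at ht1
    unfold Fr
    have h4 : s * (τ * (t * s0 * (2 * C / m) * N)) = τ * (s * (s * (2 * C / m) * N)) := by rw [hs]; ring
    nlinarith
  -- now n
  obtain ⟨A, hA, hFl⟩ := F_lip H (show 0 < m / 2 by positivity) ha (show 0 < 2 * M by have := hp.hM; positivity) hp.hb
  have hw : ∀ {q}, Dn m a M b q → Dn (m/2) a (2*M) b q := fun h => by
    have := pert h 0 le_rfl hs0p.le
    simpa using this
  have hev4 := (tendsto_order.1 (hconv.const_mul (2 * A + s * τ * (C / m)))).2 (s * (θ/2)) (by rw [mul_zero]; positivity)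
  filter_upwards [hev4] with n hn
  have hqs := pert (hq n) s hsp.le hss
  have t1 := tangent H (hq n) hqs.pd hqs.ent_int
  have e5 : ∫ x, ff G' τ (qn n) x * (qn n x + s * η x - qn n x) = s * ∫ x, ff G' τ (qn n) x * η x := by
    rw [← integral_const_mul]; congr 1; ext x; ring
  rw [e5] at t1
  set D := ∫ x, om x * |qn n x - p x| with hD
  have l1 := hFl _ _ hqs hps
  have e6 : ∫ x, om x * |qn n x + s * η x - (p x + s * η x)| = D := by
    rw [hD]; congr 1; ext x; congr 2; ring
  rw [e6] at l1
  have l2 := hFl _ _ (hw (hq n)) (hw hp)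
  have gI' : Integrable (fun x => G' (wd (qn n)) x * η x) := hpi (H.G'_pg (hq n).pd.isP2)
  have lI' : Integrable (fun x => Real.log (qn n x) * η x) := hpi (hq n).log_pg
  have e7 : ∫ x, (G' (wd (qn n)) x - G' (wd p) x) * η x = (∫ x, ff G' τ (qn n) x * η x) - (∫ x, ff G' τ p x * η x) - τ * ∫ x, (Real.log (qn n x) - Real.log (p x)) * η x := by
    rw [← integral_const_mul, ← integral_sub (hpi (H.ff_pg (hq n))) (hpi (H.ff_pg hp)), ← integral_sub (isub (hpi (H.ff_pg (hq n))) (hpi (H.ff_pg hp))) ((hpi ((hq n).log_pg.sub hp.log_pg)).const_mul τ)]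
    congr 1; ext x; unfold ff; ring
  have h8 : |∫ x, (Real.log (qn n x) - Real.log (p x)) * η x| ≤ C / m * D := by
    rw [hD, ← integral_const_mul]
    refine abs_int_le ((GB.PG_mul PG.om_pg ((hq n).sub_int hp).abs).integrable.const_mul _) fun x => ?_
    have hk := kk_pos ha x
    have h1 := log_diff (mul_pos hm hk) ((hq n).lb x) (hp.lb x)
    rw [abs_mul]
    calc _ ≤ |qn n x - p x| / (m * kk a x) * (C * kk a x) := by gcongr; exact hC x
      _ = C / m * (1 * |qn n x - p x|) := by field_simp
      _ ≤ C / m * (om x * |qn n x - p x|) := by gcongr; exact one_le_om x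
  rw [e7]
  have hD0 : 0 ≤ D := integral_nonneg fun x => mul_nonneg (om_pos x).le (abs_nonneg _)
  have b1 := (abs_le.1 l1).2
  have b2 := (abs_le.1 l2).1
  have b3 := (abs_le.1 h8).1
  have b4 : -(τ * ∫ x, (Real.log (qn n x) - Real.log (p x)) * η x) ≤ τ * (C/m*D) := by nlinarith
  have b5 : s * ∫ x, ff G' τ (qn n) x * η x ≤ s * (∫ x, ff G' τ p x * η x) + s * (θ/2) + 2 * A * D := by linarith
  have b6 := mul_le_mul_of_nonneg_left b4 hsp.le
  refine le_of_mul_le_mul_left ?_ hsp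
  linarith

open Filter Topology in
theorem demi_int (H : HF α L τ G G') {qn : ℕ → Ed d → ℝ} (hq : ∀ n, Dn m a M b (qn n)) (hp : Dn m a M b p)
    (hconv : Tendsto (fun n => ∫ x, om x * |qn n x - p x|) atTop (𝓝 0))
    {η : Ed d → ℝ} (hη : Measurable η) {C : ℝ} (hC : ∀ x, |η x| ≤ C * kk a x)
    (h0 : ∫ x, η x = 0) {θ : ℝ} (hθ : 0 < θ) :
    ∀ᶠ n in atTop, |∫ x, (G' (wd (qn n)) x - G' (wd p) x) * η x| ≤ θ := by
  have h1 := demi_aux H hq hp hconv hη hC h0 hθ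
  have h2 := demi_aux H hq hp hconv hη.neg (C := C) (by simpa using hC) (by simp [integral_neg, h0]) hθ
  filter_upwards [h1, h2] with n h1 h2
  simp only [Pi.neg_apply, mul_neg, integral_neg] at h2
  rw [abs_le]; constructor <;> linarith

/-- difference of first variations is Lipschitz -/
theorem HF.u_lip (H : HF α L τ G G') {μ ν : Measure (Ed d)} (hμ : IsP2 μ) (hν : IsP2 ν) (x y : Ed d) :
    |(G' μ x - G' ν x) - (G' μ y - G' ν y)| ≤ 2 * L * ‖x - y‖ := by
  obtain ⟨V, h1, h2, h3⟩ := H.split hμ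
  obtain ⟨W, k1, k2, k3⟩ := H.split hν
  have a1 := lip_of_fderiv (h1.differentiable (by norm_num)) h3 x y
  have a2 := lip_of_fderiv (k1.differentiable (by norm_num)) k3 x y
  rw [h2, h2, k2, k2]
  rw [show α / 2 * ‖x‖ ^ 2 + V x - (α / 2 * ‖x‖ ^ 2 + W x) - (α / 2 * ‖y‖ ^ 2 + V y - (α / 2 * ‖y‖ ^ 2 + W y)) = (V x - V y) - (W x - W y) by ring]
  refine (abs_sub _ _).trans ?_
  linarith

open Filter Topology in
theorem demi (H : HF α L τ G G') {qn : ℕ → Ed d → ℝ} (hq : ∀ n, Dn m a M b (qn n)) (hp : Dn m a M b p)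
    (hconv : Tendsto (fun n => ∫ x, om x * |qn n x - p x|) atTop (𝓝 0)) (x : Ed d) :
    Tendsto (fun n => (G' (wd (qn n)) x - G' (wd p) x) - (G' (wd (qn n)) 0 - G' (wd p) 0)) atTop (𝓝 0) := by
  rw [Metric.tendsto_atTop']
  intro θ hθ
  have hL := H.hL
  set ρ := θ / (16 * L) with hρ
  have hρ0 : 0 < ρ := by positivity
  set c := ((volume (Metric.ball (0 : Ed d) ρ)).toReal)⁻¹ with hc
  have hvpos : 0 < (volume (Metric.ball (0 : Ed d) ρ)).toReal :=
    ENNReal.toReal_pos (Metric.measure_ball_pos _ _ hρ0).ne' measure_ball_lt_top.ne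
  have hc0 : 0 < c := inv_pos.2 hvpos
  have hvol : ∀ y : Ed d, volume.real (Metric.ball y ρ) = (volume (Metric.ball (0 : Ed d) ρ)).toReal := fun y => by
    rw [Measure.real, Measure.addHaar_ball_center]
  set I : Ed d → Ed d → ℝ := fun y => (Metric.ball y ρ).indicator fun _ => c with hI
  have hIm : ∀ y, Measurable (I y) := fun y => measurable_const.indicator measurableSet_ball
  have hIint : ∀ y, ∫ z, I y z = 1 := fun y => by
    rw [hI]; simp only
    rw [integral_indicator measurableSet_ball, setIntegral_const, hvol, smul_eq_mul, hc]
    exact mul_inv_cancel₀ hvpos.ne'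
  have ha := hp.ha
  have hIb : ∀ y, ∃ C, 0 ≤ C ∧ ∀ z, |I y z| ≤ C * kk a z := fun y => by
    obtain ⟨z0, hz0, hmin⟩ := (isCompact_closedBall y ρ).exists_isMinOn (Metric.nonempty_closedBall.2 hρ0.le) (kk_cont a).continuousOn
    have hk := kk_pos ha z0
    refine ⟨c / kk a z0, by positivity, fun z => ?_⟩
    by_cases hz : z ∈ Metric.ball y ρ
    · simp only [hI, Set.indicator_of_mem hz, abs_of_pos hc0]
      have : kk a z0 ≤ kk a z := hmin (Metric.ball_subset_closedBall hz)
      rw [div_mul_eq_mul_div, le_div_iff₀ hk]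
      exact mul_le_mul_of_nonneg_left this hc0.le
    · simp only [hI, Set.indicator_of_notMem hz, abs_zero]
      have := kk_pos ha z; positivity
  have hIg : ∀ y, GB (I y) := fun y => by
    obtain ⟨C, _, h⟩ := hIb y; exact GB.mk_le (hIm y) ha h
  obtain ⟨C1, hC1, hb1⟩ := hIb x
  obtain ⟨C2, hC2, hb2⟩ := hIb 0
  have hev := demi_int H hq hp hconv (η := fun z => I x z - I 0 z) ((hIm x).sub (hIm 0)) (C := C1 + C2) (fun z => by
      refine (abs_sub _ _).trans ?_
      rw [add_mul]; exact add_le_add (hb1 z) (hb2 z)) (by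
      rw [integral_sub (hIg x).integrable (hIg 0).integrable, hIint, hIint, sub_self]) (θ := θ/2) (by positivity)
  obtain ⟨n0, hn0⟩ := eventually_atTop.1 hev
  refine ⟨n0, fun n hn => ?_⟩
  have h1 := hn0 n hn.le
  set u : Ed d → ℝ := fun z => G' (wd (qn n)) z - G' (wd p) z with hu
  have hul : ∀ z y, |u z - u y| ≤ 2 * L * ‖z - y‖ := H.u_lip (hq n).pd.isP2 hp.pd.isP2
  have hupg : PG u := (H.G'_pg (hq n).pd.isP2).sub (H.G'_pg hp.pd.isP2)
  have hav : ∀ y, |(∫ z, u z * I y z) - u y| ≤ 2 * L * ρ := fun y => by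
    have e : (∫ z, u z * I y z) - u y = ∫ z, (u z - u y) * I y z := by
      have : u y = ∫ z, u y * I y z := by rw [integral_const_mul, hIint, mul_one]
      conv_lhs => rw [this]
      rw [← integral_sub (GB.PG_mul hupg (hIg y)).integrable ((hIg y).integrable.const_mul _)]
      congr 1; ext z; ring
    rw [e]
    have : 2 * L * ρ = ∫ z, 2 * L * ρ * I y z := by rw [integral_const_mul, hIint, mul_one]
    rw [this]
    refine abs_int_le ((hIg y).integrable.const_mul _) fun z => ?_
    by_cases hz : z ∈ Metric.ball y ρ
    · have hz' : ‖z - y‖ < ρ := by rwa [Metric.mem_ball, dist_eq_norm] at hz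
      simp only [hI, Set.indicator_of_mem hz, abs_mul, abs_of_pos hc0]
      have := hul z y
      gcongr
      exact this.trans (by gcongr)
    · simp [hI, Set.indicator_of_notMem hz]
  have e : ∫ z, u z * (I x z - I 0 z) = (∫ z, u z * I x z) - ∫ z, u z * I 0 z := by
    rw [← integral_sub (GB.PG_mul hupg (hIg x)).integrable (GB.PG_mul hupg (hIg 0)).integrable]
    congr 1; ext z; ring
  simp only [hu] at e hav
  rw [e] at h1
  have a1 := hav x
  have a2 := hav 0
  have : 2 * L * ρ = θ / 8 := by rw [hρ]; field_simp; ring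
  rw [this] at a1 a2
  rw [Real.dist_eq, sub_zero]
  rw [abs_le] at a1 a2 h1
  rw [abs_lt]
  constructor <;> linarith [a1.1, a1.2, a2.1, a2.2, h1.1, h1.2]

end B2
end ModB2

section ModC1
section C1
variable {d : ℕ} {p w : Ed d → ℝ} {m a M b ε : ℝ}

theorem P_unif {C s : ℝ} (hs : 0 < s) (hC : 0 ≤ C) (hm : Measurable w) (hb : ∀ x, |w x| ≤ C * kk s x)
    (h0 : 0 < ε) (h1 : ε ≤ 1) (x : Ed d) :
    |Cv (kk ε) w x| ≤ C * ((s + 1) / s) ^ ((d:ℝ)/2) * kk (s + 1) x := by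
  have h := cv_bound (C := 1) (kk_cont ε).measurable hm h0 hs (fun x => by rw [abs_of_pos (kk_pos h0 x), one_mul]) hb x
  refine h.trans ?_
  rw [one_mul, mul_assoc]
  refine mul_le_mul_of_nonneg_left ?_ hC
  refine (kk_le (s' := s + 1) (by positivity) (by linarith) x).trans ?_
  refine mul_le_mul_of_nonneg_right ?_ (kk_pos (by positivity) x).le
  refine Real.rpow_le_rpow (by positivity) ?_ (by positivity)
  gcongr; linarith

theorem self_unif {C s : ℝ} (hs : 0 < s) (hC : 0 ≤ C) (hb : ∀ x, |w x| ≤ C * kk s x) (x : Ed d) :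
    |w x| ≤ C * ((s + 1) / s) ^ ((d:ℝ)/2) * kk (s + 1) x := by
  refine (hb x).trans ?_
  rw [mul_assoc]
  exact mul_le_mul_of_nonneg_left (kk_le hs (by linarith) x) hC

theorem P_gb (h0 : 0 < ε) (hw : GB w) : GB (Cv (kk ε) w) := (GB.kk_gb h0).cv (kk_cont ε) hw

open Filter Topology in
theorem P_wt {ε : ℕ → ℝ} (hε : ∀ n, 0 < ε n) (hε1 : ∀ n, ε n ≤ 1) (hε0 : Tendsto ε atTop (𝓝 0))
    (hw : GB w) {φ : Ed d → ℝ} (hφ : PG φ) :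
    Tendsto (fun n => ∫ x, |φ x * (Cv (kk (ε n)) w x - w x)|) atTop (𝓝 0) := by
  have hw' := hw
  have hφ' := hφ
  obtain ⟨hm, C, s, hC, hs, hb⟩ := hw
  obtain ⟨hm', C', j, hC', hb'⟩ := hφ
  have hI : ∀ n, GB (fun x => Cv (kk (ε n)) w x - w x) := fun n => (P_gb (hε n) hw').sub hw'
  refine tend_T (h := fun n x => Cv (kk (ε n)) w x - w x) (W := fun x => C' * om x ^ j)
    (Γ := fun x => C' * om x ^ j * (2 * (C * ((s + 1) / s) ^ ((d:ℝ)/2) * kk (s + 1) x))) (fun n => (hI n).integrable) (fun n => (GB.PG_mul hφ' (hI n)).integrable) ?_ ?_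
    (P_approx hε hε1 hε0 hw'.integrable) ?_ ?_
  · have := (om_kk_int (d := d) j (show 0 < s + 1 by positivity)).const_mul (C' * (2 * (C * ((s + 1) / s) ^ ((d:ℝ)/2))))
    refine this.congr (Eventually.of_forall fun x => ?_); simp only; ring
  · exact continuous_const.mul (om_cont.pow j)
  · intro n x
    rw [abs_mul]
    have h1 := P_unif hs hC hm hb (hε n) (hε1 n) x
    have h2 := self_unif hs hC hb x
    have h3 := abs_sub (Cv (kk (ε n)) w x) (w x)
    have := om_pos x
    refine mul_le_mul (hb' x) (by linarith) (abs_nonneg _) (by positivity)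
  · intro n x
    rw [abs_mul]; exact mul_le_mul_of_nonneg_right (hb' x) (abs_nonneg _)

open Filter Topology in
theorem P_wt' {ε : ℕ → ℝ} (hε : ∀ n, 0 < ε n) (hε1 : ∀ n, ε n ≤ 1) (hε0 : Tendsto ε atTop (𝓝 0))
    (hw : GB w) {φ : Ed d → ℝ} (hφ : PG φ) :
    Tendsto (fun n => ∫ x, φ x * (Cv (kk (ε n)) w x - w x)) atTop (𝓝 0) :=
  squeeze_zero_norm (fun n => norm_integral_le_integral_norm _) (P_wt hε hε1 hε0 hw hφ)

/-- lower factor -/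
def cl (d : ℕ) (a ε : ℝ) : ℝ := (a / (a + ε)) ^ ((d:ℝ)/2)

theorem cl_pos (ha : 0 < a) (hε : 0 < ε) : 0 < cl d a ε := by unfold cl; positivity
theorem cl_mono (ha : 0 < a) (hε : 0 < ε) (h1 : ε ≤ 1) : cl d a 1 ≤ cl d a ε := by
  unfold cl
  refine Real.rpow_le_rpow (by positivity) ?_ (by positivity)
  gcongr
theorem cl_le_one (ha : 0 < a) (hε : 0 < ε) : cl d a ε ≤ 1 := by
  unfold cl
  refine Real.rpow_le_one (by positivity) ?_ (by positivity)
  rw [div_le_one (by positivity)]; linarith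

theorem q_lower (hp : Dn m a M b p) (hε : 0 < ε) (x : Ed d) : m * cl d a ε * kk a x ≤ Cv (kk ε) p x := by
  have h := P_lower hε hp.ha hp.pd.int hp.lb x
  refine le_trans ?_ h
  rw [mul_assoc]
  refine mul_le_mul_of_nonneg_left ?_ hp.hm.le
  have ha := hp.ha
  have h1 := kk_le (s' := ε + a) hp.ha (by linarith) x
  have h2 : cl d a ε * ((ε + a) / a) ^ ((d:ℝ)/2) = 1 := by
    unfold cl
    rw [← Real.mul_rpow (by positivity) (by positivity)]
    rw [show a / (a + ε) * ((ε + a) / a) = 1 by rw [add_comm]; field_simp, Real.one_rpow]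
  calc cl d a ε * kk a x ≤ cl d a ε * (((ε + a) / a) ^ ((d:ℝ)/2) * kk (ε + a) x) := mul_le_mul_of_nonneg_left h1 (cl_pos ha hε).le
    _ = kk (ε + a) x := by rw [← mul_assoc, h2, one_mul]

def m1 (d : ℕ) (m a : ℝ) : ℝ := m * cl d a 1
def M1 (d : ℕ) (M b : ℝ) : ℝ := M * ((b + 1) / b) ^ ((d:ℝ)/2)

theorem q_Dn (hp : Dn m a M b p) (hε : 0 < ε) (h1 : ε ≤ 1) : Dn (m1 d m a) a (M1 d M b) (b + 1) (Cv (kk ε) p) := by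
  have hm := hp.hm
  have ha := hp.ha
  have hb := hp.hb
  have hM := hp.hM
  have hc := cl_pos (d := d) ha one_pos
  refine ⟨(P_gb hε hp.gb).meas, mul_pos hm hc, ha, by unfold M1; positivity, by positivity, fun x => ?_, fun x => ?_, ?_⟩
  · refine le_trans ?_ (q_lower hp hε x)
    unfold m1
    have := kk_pos ha x
    gcongr; exact cl_mono ha hε h1
  · refine (le_abs_self _).trans ?_
    exact P_unif hb hM.le hp.meas (fun x => by rw [abs_of_pos (hp.pos x)]; exact hp.ub x) hε h1 x
  · rw [cv_integral (kk_int hε) hp.pd.int, kk_integral hε, hp.mass, one_mul]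

theorem p_Dn (hp : Dn m a M b p) : Dn (m1 d m a) a (M1 d M b) (b + 1) p := by
  refine hp.weaken (mul_pos hp.hm (cl_pos hp.ha one_pos)) ?_ (by linarith) le_rfl
  unfold m1
  exact mul_le_of_le_one_right hp.hm.le (cl_le_one hp.ha one_pos)

open Filter Topology in
theorem q_conv {ε : ℕ → ℝ} (hε : ∀ n, 0 < ε n) (hε1 : ∀ n, ε n ≤ 1) (hε0 : Tendsto ε atTop (𝓝 0))
    (hp : Dn m a M b p) : Tendsto (fun n => ∫ x, om x * |Cv (kk (ε n)) p x - p x|) atTop (𝓝 0) := by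
  refine (P_wt hε hε1 hε0 hp.gb PG.om_pg).congr fun n => ?_
  congr 1; ext x; rw [abs_mul, abs_of_pos (om_pos x)]

/-- squared kernel for Fisher information -/
def JJ {d : ℕ} (ε : ℝ) (i : Fin d) (x : Ed d) : ℝ := (x i / ε) ^ 2 * kk ε x

theorem JJ_cont (i : Fin d) : Continuous (JJ ε i) := by
  unfold JJ; have := kk_cont (d := d) ε; fun_prop
theorem JJ_gb (hε : 0 < ε) (i : Fin d) : GB (JJ ε i) := by
  have h := GB.PG_mul ((PG.coord i).const_mul (1/ε)).sq (GB.kk_gb (d := d) hε)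
  unfold JJ; convert h using 2; ring

theorem JJ_cv_gb (hε : 0 < ε) (i : Fin d) (hw : GB w) : GB (Cv (JJ ε i) w) := (JJ_gb hε i).cv (JJ_cont i) hw

theorem k1_cv_gb (hε : 0 < ε) (i : Fin d) (hw : GB w) : GB (Cv (k1 ε i) w) := (kk_gb1 hε i).cv (k1_cont i) hw
theorem k2_cv_gb (hε : 0 < ε) (i : Fin d) (hw : GB w) : GB (Cv (k2 ε i) w) := (kk_gb2 hε i).cv (k2_cont i) hw

theorem fisher_bound (hp : Dn m a M b p) (hε : 0 < ε) (i : Fin d) (x : Ed d) :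
    (Cv (k1 ε i) p x) ^ 2 ≤ Cv (kk ε) p x * Cv (JJ ε i) p x := by
  have h := cs_weight (ν := (volume : Measure (Ed d))) (g := fun y => kk ε (x - y) * p y) (φ := fun y => -((x - y) i / ε))
    (fun y => mul_nonneg (kk_pos hε _).le (hp.pos y).le) (gb_cv_integrable_at (GB.kk_gb hε) hp.pd.int x) ?_ ?_
  · convert h using 1
    · unfold Cv; congr 2; ext y; unfold k1; ring
    · unfold Cv; congr 2; ext y; unfold JJ; ring
  · refine (gb_cv_integrable_at (kk_gb1 hε i) hp.pd.int x).congr (Filter.Eventually.of_forall fun y => ?_)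
    simp only; unfold k1; ring
  · refine (gb_cv_integrable_at (JJ_gb hε i) hp.pd.int x).congr (Filter.Eventually.of_forall fun y => ?_)
    simp only; unfold JJ; ring

/-- cross-term lemma -/
theorem kappa_bound (hp : Dn m a M b p) (hε : 0 < ε) {β : Ed d → ℝ} (hβ : PG β) (x : Ed d) :
    (Cv (kk ε) (fun y => p y * β y) x - β x * Cv (kk ε) p x) ^ 2 ≤ Cv (kk ε) p x *
      (Cv (kk ε) (fun y => p y * β y ^ 2) x - 2 * β x * Cv (kk ε) (fun y => p y * β y) x + β x ^ 2 * Cv (kk ε) p x) := by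
  have i0 := gb_cv_integrable_at (GB.kk_gb hε) hp.pd.int x
  have i1 := gb_cv_integrable_at (GB.kk_gb hε) (hp.gb.mul_PG hβ).integrable x
  have i2 := gb_cv_integrable_at (GB.kk_gb hε) (hp.gb.mul_PG hβ.sq).integrable x
  have h := cs_weight (ν := (volume : Measure (Ed d))) (g := fun y => kk ε (x - y) * p y) (φ := fun y => β y - β x)
    (fun y => mul_nonneg (kk_pos hε _).le (hp.pos y).le) i0 ?_ ?_
  · convert h using 2
    · unfold Cv; rw [← integral_const_mul, ← integral_sub i1 (i0.const_mul _)]; congr 1; ext y; ring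
    · rfl
    · unfold Cv; rw [← integral_const_mul, ← integral_const_mul, ← integral_sub i2 (i1.const_mul _), ← integral_add (isub i2 (i1.const_mul _)) (i0.const_mul _)]; congr 1; ext y; ring
  · refine (isub i1 (i0.const_mul (β x))).congr (Filter.Eventually.of_forall fun y => ?_)
    simp only; ring
  · refine (iadd (isub i2 (i1.const_mul (2 * β x))) (i0.const_mul (β x ^ 2))).congr (Filter.Eventually.of_forall fun y => ?_)
    simp only; ring

def ww {d : ℕ} (ε : ℝ) (p β : Ed d → ℝ) (x : Ed d) : ℝ :=
  Cv (kk ε) (fun y => p y * β y ^ 2) x - 2 * β x * Cv (kk ε) (fun y => p y * β y) x + β x ^ 2 * Cv (kk ε) p x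

theorem ww_nonneg (hp : Dn m a M b p) (hε : 0 < ε) {β : Ed d → ℝ} (hβ : PG β) (x : Ed d) : 0 ≤ ww ε p β x := by
  have h := kappa_bound hp hε hβ x
  have hq : 0 < Cv (kk ε) p x := lt_of_lt_of_le (mul_pos (mul_pos hp.hm (cl_pos (d := d) hp.ha hε)) (kk_pos hp.ha x)) (q_lower hp hε x)
  exact nonneg_of_mul_nonneg_right ((sq_nonneg _).trans h) hq

theorem ww_gb (hp : Dn m a M b p) (hε : 0 < ε) {β : Ed d → ℝ} (hβ : PG β) : GB (ww ε p β) := by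
  unfold ww
  exact ((P_gb hε (hp.gb.mul_PG hβ.sq)).sub (GB.PG_mul (hβ.const_mul 2) (P_gb hε (hp.gb.mul_PG hβ)))).add
    (GB.PG_mul hβ.sq (P_gb hε hp.gb))

open Filter Topology in
theorem ww_tend {ε : ℕ → ℝ} (hε : ∀ n, 0 < ε n) (hε1 : ∀ n, ε n ≤ 1) (hε0 : Tendsto ε atTop (𝓝 0))
    (hp : Dn m a M b p) {β : Ed d → ℝ} (hβ : PG β) : Tendsto (fun n => ∫ x, ww (ε n) p β x) atTop (𝓝 0) := by
  have g1 := hp.gb.mul_PG hβ.sq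
  have g2 := hp.gb.mul_PG hβ
  have t1 := P_wt' hε hε1 hε0 g1 (PG.const 1)
  have t2 := P_wt' hε hε1 hε0 g2 (hβ.const_mul 2)
  have t3 := P_wt' hε hε1 hε0 hp.gb hβ.sq
  have := (t1.sub t2).add t3
  simp only [sub_zero, add_zero] at this
  refine this.congr fun n => ?_
  have i1 := (GB.PG_mul (PG.const 1) ((P_gb (hε n) g1).sub g1)).integrable
  have i2 := (GB.PG_mul (hβ.const_mul 2) ((P_gb (hε n) g2).sub g2)).integrable
  have i3 := (GB.PG_mul hβ.sq ((P_gb (hε n) hp.gb).sub hp.gb)).integrable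
  rw [← integral_sub i1 i2, ← integral_add (isub i1 i2) i3]
  congr 1; ext x; unfold ww; ring

/-- uniform bound on `∫ w` -/
theorem ww_unif (hm : 0 < m) (ha : 0 < a) (hM : 0 < M) (hb : 0 < b) {B : ℝ} (hB : 0 ≤ B) :
    ∃ W, 0 ≤ W ∧ ∀ (p β : Ed d → ℝ) (ε : ℝ), Dn m a M b p → PG β → (∀ x, β x ^ 2 ≤ B * om x) → 0 < ε → ε ≤ 1 →
      ∫ x, ww ε p β x ≤ W := by
  obtain ⟨C, hC, hk⟩ := om_kk (d := d) 1 hb (show b < b + 1 by linarith)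
  set s := b + 1 with hs
  have hs0 : 0 < s := by positivity
  have hbd : ∀ (p β : Ed d → ℝ) (ε : ℝ), Dn m a M b p → PG β → (∀ x, β x ^ 2 ≤ B * om x) → 0 < ε → ε ≤ 1 → ∀ x, 
     ww ε p β x ≤ 2 * (B * M * C * ((s + 1) / s) ^ ((d:ℝ)/2) * kk (s + 1) x) + 2 * (B * (M1 d M b) * (om x ^ 1 * kk (b+1) x)) := by
    intro p β ε hp hβ hBβ h0 h1 x
    have g1 := hp.gb.mul_PG hβ.sq
    have e1 := (le_abs_self _).trans (P_unif (w := fun y => p y * β y ^ 2) (C := B * M * C) hs0 (by positivity) g1.meas (fun y => by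
      rw [abs_of_nonneg (mul_nonneg (hp.pos y).le (sq_nonneg _))]
      have h1 := hk y
      have h2 := hBβ y
      have h3 := hp.ub y
      have := om_pos y; have := kk_pos hb y
      calc p y * β y ^ 2 ≤ (M * kk b y) * (B * om y) := by gcongr
        _ = B * M * (om y ^ 1 * kk b y) := by ring
        _ ≤ B * M * (C * kk s y) := by gcongr
        _ = _ := by ring) h0 h1 x)
    have hq := (q_Dn hp h0 h1)
    have hqx := hq.pos x
    have e2 : β x ^ 2 * Cv (kk ε) p x ≤ B * (M1 d M b) * (om x ^ 1 * kk (b+1) x) := by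
      have := om_pos x
      calc _ ≤ (B * om x) * (M1 d M b * kk (b+1) x) := by gcongr; exact hBβ x; exact hq.ub x
        _ = _ := by ring
    have e3 : -(2 * β x * Cv (kk ε) (fun y => p y * β y) x) ≤ Cv (kk ε) (fun y => p y * β y ^ 2) x + β x ^ 2 * Cv (kk ε) p x := by
      -- from nonneg with -β replaced
      have i0 := gb_cv_integrable_at (GB.kk_gb h0) hp.pd.int x
      have i1 := gb_cv_integrable_at (GB.kk_gb h0) (hp.gb.mul_PG hβ).integrable x
      have i2 := gb_cv_integrable_at (GB.kk_gb h0) (hp.gb.mul_PG hβ.sq).integrable x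
      unfold Cv
      rw [← integral_const_mul, ← integral_const_mul, ← integral_neg, ← integral_add i2 (i0.const_mul _)]
      refine integral_mono (i1.const_mul _).neg (iadd i2 (i0.const_mul _)) fun y => ?_
      have := mul_nonneg (mul_nonneg (kk_pos h0 (x - y)).le (hp.pos y).le) (sq_nonneg (β y + β x))
      simp only
      linarith
    unfold ww
    linarith
  have hI : Integrable (fun x : Ed d => 2 * (B * M * C * ((s + 1) / s) ^ ((d:ℝ)/2) * kk (s + 1) x) + 2 * (B * (M1 d M b) * (om x ^ 1 * kk (b+1) x))) :=
    (((kk_int (by positivity)).const_mul _).const_mul _).add (((om_kk_int 1 (by positivity)).const_mul _).const_mul _)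
  refine ⟨∫ x : Ed d, (2 * (B * M * C * ((s + 1) / s) ^ ((d:ℝ)/2) * kk (s + 1) x) + 2 * (B * (M1 d M b) * (om x ^ 1 * kk (b+1) x))), ?_, ?_⟩
  · refine integral_nonneg fun x => ?_
    have := om_pos x; have := kk_pos (show 0 < s + 1 by positivity) x; have := kk_pos (show 0 < b + 1 by positivity) x
    have : 0 < M1 d M b := by unfold M1; positivity
    simp only [Pi.zero_apply]; positivity
  · intro p β ε hp hβ hBβ h0 h1
    exact integral_mono (ww_gb hp h0 hβ).integrable hI (hbd p β ε hp hβ hBβ h0 h1)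
end C1
end ModC1

section ModC2
section C2
variable {d : ℕ} {p w : Ed d → ℝ} {m a M b ε : ℝ}
variable {α L τ : ℝ} {G : Measure (Ed d) → ℝ} {G' : Measure (Ed d) → Ed d → ℝ}

def YY {d : ℕ} (τ ε : ℝ) (p : Ed d → ℝ) (β : Fin d → Ed d → ℝ) (i : Fin d) (x : Ed d) : ℝ :=
  Cv (kk ε) (fun y => p y * β i y) x + τ * Cv (k1 ε i) p x
def ll {d : ℕ} (τ ε : ℝ) (p : Ed d → ℝ) (β : Fin d → Ed d → ℝ) (x : Ed d) : ℝ :=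
  ∑ i, (Cv (k1 ε i) (fun y => p y * β i y) x + τ * Cv (k2 ε i) p x)

theorem YY_gb (hε : 0 < ε) (hp : GB p) {β : Fin d → Ed d → ℝ} (hβ : ∀ i, PG (β i)) (i : Fin d) : GB (YY τ ε p β i) :=
  (P_gb hε (hp.mul_PG (hβ i))).add ((k1_cv_gb hε i hp).const_mul τ)

theorem dY_gb (hε : 0 < ε) (hp : GB p) {β : Fin d → Ed d → ℝ} (hβ : ∀ i, PG (β i)) (i : Fin d) :
    GB (fun x => Cv (k1 ε i) (fun y => p y * β i y) x + τ * Cv (k2 ε i) p x) :=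
  (k1_cv_gb hε i (hp.mul_PG (hβ i))).add ((k2_cv_gb hε i hp).const_mul τ)

theorem ll_gb (hε : 0 < ε) (hp : GB p) {β : Fin d → Ed d → ℝ} (hβ : ∀ i, PG (β i)) : GB (ll τ ε p β) := by
  unfold ll
  exact GB.sum _ fun i _ => dY_gb hε hp hβ i

theorem YY_deriv (hε : 0 < ε) (hp : GB p) {β : Fin d → Ed d → ℝ} (hβ : ∀ i, PG (β i)) (i : Fin d) (x : Ed d) :
    DifferentiableAt ℝ (YY τ ε p β i) x ∧ fderiv ℝ (YY τ ε p β i) x (ee i) =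
      Cv (k1 ε i) (fun y => p y * β i y) x + τ * Cv (k2 ε i) p x := by
  obtain ⟨D, h1, h2⟩ := cvkk_hasFDerivAt hε (hp.mul_PG (hβ i)).integrable x
  obtain ⟨E, h3, h4⟩ := cvk1_hasFDerivAt hε i hp.integrable x
  have h := h1.add (h3.const_mul τ)
  refine ⟨h.differentiableAt, ?_⟩
  have e : fderiv ℝ (YY τ ε p β i) x = D + τ • E := h.fderiv
  rw [e]
  simp [h2, h4]

theorem ibp (hε : 0 < ε) (hp : GB p) {β : Fin d → Ed d → ℝ} (hβ : ∀ i, PG (β i)) {g : Ed d → ℝ}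
    (hg : Differentiable ℝ g) (hgp : PG g) (hgi : ∀ i, Integrable (fun x => fderiv ℝ g x (ee i) * YY τ ε p β i x)) :
    ∫ x, g x * ll τ ε p β x = - ∑ i, ∫ x, fderiv ℝ g x (ee i) * YY τ ε p β i x := by
  have h1 : ∀ i, ∫ x, g x * (Cv (k1 ε i) (fun y => p y * β i y) x + τ * Cv (k2 ε i) p x) = - ∫ x, fderiv ℝ g x (ee i) * YY τ ε p β i x := by
    intro i
    have e : ∀ x, fderiv ℝ (YY τ ε p β i) x (ee i) =
      Cv (k1 ε i) (fun y => p y * β i y) x + τ * Cv (k2 ε i) p x := fun x => (YY_deriv hε hp hβ i x).2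
    rw [← integral_mul_fderiv_eq_neg_fderiv_mul_of_integrable (v := ee i) (hgi i) ?_ (GB.PG_mul hgp (YY_gb hε hp hβ i)).integrable (fun x _ => hg x) (fun x _ => (YY_deriv hε hp hβ i x).1)]
    · simp_rw [e]
    · simp_rw [e]; exact (GB.PG_mul hgp (dY_gb hε hp hβ i)).integrable
  unfold ll
  simp_rw [Finset.mul_sum]
  rw [integral_finset_sum _ fun i _ => (GB.PG_mul hgp (dY_gb hε hp hβ i)).integrable, ← Finset.sum_neg_distrib]
  exact Finset.sum_congr rfl fun i _ => h1 i

theorem ll_int (hε : 0 < ε) (hp : GB p) {β : Fin d → Ed d → ℝ} (hβ : ∀ i, PG (β i)) : ∫ x, ll τ ε p β x = 0 := by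
  have := ibp (τ := τ) hε hp hβ (g := fun _ => 1) (differentiable_const _) (PG.const 1) (fun i => by simp)
  simpa using this

def db {d : ℕ} (G' : Measure (Ed d) → Ed d → ℝ) (μ : Measure (Ed d)) (i : Fin d) (x : Ed d) : ℝ :=
  fderiv ℝ (G' μ) x (ee i)

theorem norm_ee (i : Fin d) : ‖(ee i : Ed d)‖ = 1 := by simp [ee]

theorem HF.db_split (H : HF α L τ G G') {μ : Measure (Ed d)} (hμ : IsP2 μ) (i : Fin d) (x : Ed d) :
    ∃ v : ℝ, db G' μ i x = α * x i + v ∧ |v| ≤ L := by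
  obtain ⟨V, h1, h2, h3⟩ := H.split hμ
  refine ⟨fderiv ℝ V x (ee i), ?_, ?_⟩
  · have hd : HasFDerivAt (G' μ) ((α/2) • (2 • (innerSL ℝ x)) + fderiv ℝ V x) x := by
      have e : G' μ = fun x => α / 2 * ‖x‖ ^ 2 + V x := funext h2
      rw [e]
      exact ((hasStrictFDerivAt_norm_sq x).hasFDerivAt.const_mul (α/2)).add (h1.differentiable (by norm_num) x).hasFDerivAt
    unfold db
    rw [hd.fderiv]
    simp only [ContinuousLinearMap.add_apply, ContinuousLinearMap.smul_apply, innerSL_apply_apply, inner_ee, smul_eq_mul, nsmul_eq_mul]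
    push_cast; ring
  · refine ((fderiv ℝ V x).le_opNorm _).trans ?_
    rw [norm_ee, mul_one]; exact h3 x

theorem HF.db_cont (H : HF α L τ G G') {μ : Measure (Ed d)} (hμ : IsP2 μ) (i : Fin d) : Continuous (db G' μ i) := by
  have := (H.hA μ hμ).2.1.continuous_fderiv (by norm_num)
  exact this.clm_apply continuous_const

theorem HF.G'_diff (H : HF α L τ G G') {μ : Measure (Ed d)} (hμ : IsP2 μ) : Differentiable ℝ (G' μ) :=
  (H.hA μ hμ).2.1.differentiable (by norm_num)

theorem HF.db_sq (H : HF α L τ G G') {μ : Measure (Ed d)} (hμ : IsP2 μ) (i : Fin d) (x : Ed d) :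
    db G' μ i x ^ 2 ≤ (2 * α ^ 2 + 2 * L ^ 2) * om x := by
  obtain ⟨v, h1, h2⟩ := H.db_split hμ i x
  rw [h1]
  have h3 : (x i) ^ 2 ≤ ‖x‖ ^ 2 := by
    have := PiLp.norm_apply_le x i
    rw [← sq_abs, ← Real.norm_eq_abs]; gcongr
  have h4 : v ^ 2 ≤ L ^ 2 := by rw [← sq_abs v]; gcongr
  unfold om
  nlinarith [sq_nonneg (α * x i - v), mul_le_mul_of_nonneg_left h3 (sq_nonneg α), mul_nonneg (sq_nonneg L) (sq_nonneg ‖x‖), sq_nonneg α]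

theorem HF.db_pg (H : HF α L τ G G') {μ : Measure (Ed d)} (hμ : IsP2 μ) (i : Fin d) : PG (db G' μ i) := by
  refine PG.of_om (C := α + L) (H.db_cont hμ i).measurable fun x => ?_
  obtain ⟨v, h1, h2⟩ := H.db_split hμ i x
  rw [h1]
  refine (abs_add_le _ _).trans ?_
  rw [abs_mul, abs_of_pos H.hα]
  nlinarith [H.hα, H.hL, abs_coord_le x i, one_le_om x, mul_le_mul_of_nonneg_left (abs_coord_le x i) H.hα.le, mul_le_mul_of_nonneg_left (one_le_om x) H.hL.le]

theorem HF.db_diff (H : HF α L τ G G') {μ ν : Measure (Ed d)} (hμ : IsP2 μ) (hν : IsP2 ν) (i : Fin d) (x : Ed d) :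
    |db G' μ i x - db G' ν i x| ≤ 2 * L := by
  obtain ⟨v, h1, h2⟩ := H.db_split hμ i x
  obtain ⟨v', h1', h2'⟩ := H.db_split hν i x
  rw [h1, h1', show α * x i + v - (α * x i + v') = v - v' by ring]
  exact (abs_sub _ _).trans (by linarith)

/-- gradient of `G'[p] + τ log q` -/
def XX {d : ℕ} (τ ε : ℝ) (p : Ed d → ℝ) (β : Fin d → Ed d → ℝ) (i : Fin d) (x : Ed d) : ℝ :=
  β i x + τ * (Cv (k1 ε i) p x / Cv (kk ε) p x)

def kap {d : ℕ} (ε : ℝ) (p : Ed d → ℝ) (β : Fin d → Ed d → ℝ) (i : Fin d) (x : Ed d) : ℝ :=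
  Cv (kk ε) (fun y => p y * β i y) x - β i x * Cv (kk ε) p x

theorem q_pos (hp : Dn m a M b p) (hε : 0 < ε) (x : Ed d) : 0 < Cv (kk ε) p x :=
  lt_of_lt_of_le (mul_pos (mul_pos hp.hm (cl_pos (d := d) hp.ha hε)) (kk_pos hp.ha x)) (q_lower hp hε x)

theorem YY_eq (hp : Dn m a M b p) (hε : 0 < ε) {β : Fin d → Ed d → ℝ} (i : Fin d) (x : Ed d) :
    YY τ ε p β i x = Cv (kk ε) p x * XX τ ε p β i x + kap ε p β i x := by
  have := (q_pos hp hε x).ne'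
  unfold YY XX kap; field_simp; ring

theorem kap_sq (hp : Dn m a M b p) (hε : 0 < ε) {β : Fin d → Ed d → ℝ} (hβ : ∀ i, PG (β i)) (i : Fin d) (x : Ed d) :
    kap ε p β i x ^ 2 ≤ Cv (kk ε) p x * ww ε p (β i) x := kappa_bound hp hε (hβ i) x

theorem XX_meas (hp : Dn m a M b p) (hε : 0 < ε) {β : Fin d → Ed d → ℝ} (hβ : ∀ i, PG (β i)) (i : Fin d) :
    Measurable (XX τ ε p β i) :=
  (hβ i).1.add (((k1_cv_gb hε i hp.gb).meas.div (P_gb hε hp.gb).meas).const_mul τ)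

theorem kap_gb (hp : Dn m a M b p) (hε : 0 < ε) {β : Fin d → Ed d → ℝ} (hβ : ∀ i, PG (β i)) (i : Fin d) :
    GB (kap ε p β i) :=
  (P_gb hε (hp.gb.mul_PG (hβ i))).sub (GB.PG_mul (hβ i) (P_gb hε hp.gb))

theorem fish_gb (hp : Dn m a M b p) (hε : 0 < ε) (i : Fin d) :
    GB (fun x => Cv (k1 ε i) p x ^ 2 / Cv (kk ε) p x) := by
  refine (JJ_cv_gb hε i hp.gb).mono (((k1_cv_gb hε i hp.gb).meas.pow_const 2).div (P_gb hε hp.gb).meas) fun x => ?_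
  have hq := q_pos hp hε x
  rw [abs_of_nonneg (by positivity), div_le_iff₀ hq]
  refine (fisher_bound hp hε i x).trans ?_
  rw [mul_comm]; exact mul_le_mul_of_nonneg_right (le_abs_self _) hq.le

theorem qXX_gb (hp : Dn m a M b p) (hε : 0 < ε) {β : Fin d → Ed d → ℝ} (hβ : ∀ i, PG (β i)) (i : Fin d) :
    GB (fun x => Cv (kk ε) p x * XX τ ε p β i x ^ 2) := by
  have h : GB (fun x => 2 * (Cv (kk ε) p x * β i x ^ 2) + 2 * τ ^ 2 * (Cv (k1 ε i) p x ^ 2 / Cv (kk ε) p x)) :=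
    (((P_gb hε hp.gb).mul_PG (hβ i).sq).const_mul 2).add ((fish_gb hp hε i).const_mul _)
  refine h.mono ((P_gb hε hp.gb).meas.mul ((XX_meas hp hε hβ i).pow_const 2)) fun x => ?_
  have hq := q_pos hp hε x
  rw [abs_of_nonneg (by positivity), abs_of_nonneg (by positivity)]
  have e : 2 * τ ^ 2 * (Cv (k1 ε i) p x ^ 2 / Cv (kk ε) p x) = Cv (kk ε) p x * (2 * (τ * (Cv (k1 ε i) p x / Cv (kk ε) p x)) ^ 2) := by
    field_simp
  rw [e]
  unfold XX
  nlinarith [mul_nonneg hq.le (sq_nonneg (β i x - τ * (Cv (k1 ε i) p x / Cv (kk ε) p x)))]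

/-- AM-GM helper -/
theorem amgm {q X κ w : ℝ} (hq : 0 < q) (hw : 0 ≤ w) (h : κ ^ 2 ≤ q * w) {l : ℝ} (hl : 0 < l) :
    |X * κ| ≤ l / 2 * (q * X ^ 2) + 1 / (2 * l) * w := by
  have h1 : 0 ≤ q := hq.le
  -- |Xκ| ≤ sqrt(qX² w)
  have h2 : (X * κ) ^ 2 ≤ (l / 2 * (q * X ^ 2) + 1 / (2 * l) * w) ^ 2 := by
    have e : (l / 2 * (q * X ^ 2) + 1 / (2 * l) * w) ^ 2 = (l / 2 * (q * X ^ 2) - 1 / (2 * l) * w) ^ 2 + X ^ 2 * (q * w) := by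
      field_simp; ring
    rw [e, mul_pow]
    nlinarith [sq_nonneg (l / 2 * (q * X ^ 2) - 1 / (2 * l) * w), mul_le_mul_of_nonneg_left h (sq_nonneg X)]
  exact abs_le_of_sq_le_sq h2 (by positivity)

theorem Xkap_gb (hp : Dn m a M b p) (hε : 0 < ε) {β : Fin d → Ed d → ℝ} (hβ : ∀ i, PG (β i)) (i : Fin d) :
    GB (fun x => XX τ ε p β i x * kap ε p β i x) := by
  have h : GB (fun x => (1:ℝ)/2 * (Cv (kk ε) p x * XX τ ε p β i x ^ 2) + 1 / (2 * 1) * ww ε p (β i) x) :=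
    ((qXX_gb hp hε hβ i).const_mul _).add ((ww_gb hp hε (hβ i)).const_mul _)
  refine h.mono ((XX_meas hp hε hβ i).mul (kap_gb hp hε hβ i).meas) fun x => ?_
  exact (amgm (q_pos hp hε x) (ww_nonneg hp hε (hβ i) x) (kap_sq hp hε hβ i x) one_pos).trans (le_abs_self _)

theorem qX_gb (hp : Dn m a M b p) (hε : 0 < ε) {β : Fin d → Ed d → ℝ} (hβ : ∀ i, PG (β i)) (i : Fin d) :
    GB (fun x => Cv (kk ε) p x * XX τ ε p β i x) := by
  have h : (fun x => Cv (kk ε) p x * XX τ ε p β i x) = fun x => YY τ ε p β i x - kap ε p β i x := by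
    ext x; rw [YY_eq hp hε]; ring
  rw [h]
  exact (YY_gb hε hp.gb hβ i).sub (kap_gb hp hε hβ i)

/-- `X·Y` integrable -/
theorem XY_gb (hp : Dn m a M b p) (hε : 0 < ε) {β : Fin d → Ed d → ℝ} (hβ : ∀ i, PG (β i)) (i : Fin d) :
    GB (fun x => XX τ ε p β i x * YY τ ε p β i x) := by
  have : (fun x => XX τ ε p β i x * YY τ ε p β i x) = fun x => Cv (kk ε) p x * XX τ ε p β i x ^ 2 + XX τ ε p β i x * kap ε p β i x := by
    ext x; rw [YY_eq hp hε]; ring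
  rw [this]
  exact (qXX_gb hp hε hβ i).add (Xkap_gb hp hε hβ i)

theorem logq_deriv (hp : Dn m a M b p) (hε : 0 < ε) (x : Ed d) :
    ∃ D : Ed d →L[ℝ] ℝ, HasFDerivAt (fun x => Real.log (Cv (kk ε) p x)) D x ∧ ∀ i, D (ee i) = Cv (k1 ε i) p x / Cv (kk ε) p x := by
  obtain ⟨D, h1, h2⟩ := cvkk_hasFDerivAt hε hp.pd.int x
  refine ⟨_, h1.log (q_pos hp hε x).ne', fun i => ?_⟩
  simp [h2]; ring

/-- energy production of the mollified flow -/
def Le {d : ℕ} (G' : Measure (Ed d) → Ed d → ℝ) (τ ε : ℝ) (p : Ed d → ℝ) : ℝ :=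
  ∫ x, ff G' τ (Cv (kk ε) p) x * ll τ ε p (db G' (wd p)) x

theorem Le_eq (H : HF α L τ G G') (hp : Dn m a M b p) (hε : 0 < ε) (hε1 : ε ≤ 1) :
    Le G' τ ε p = - (∑ i, ∫ x, Cv (kk ε) p x * XX τ ε p (db G' (wd p)) i x ^ 2)
      - (∑ i, ∫ x, XX τ ε p (db G' (wd p)) i x * kap ε p (db G' (wd p)) i x)
      - ∑ i, ∫ x, (db G' (wd (Cv (kk ε) p)) i x - db G' (wd p) i x) * YY τ ε p (db G' (wd p)) i x := by
  have hq := q_Dn hp hε hε1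
  have hq2 := hq.pd.isP2
  have hp2 := hp.pd.isP2
  have hβ : ∀ i, PG (db G' (wd p) i) := fun i => H.db_pg hp2 i
  have hγ : ∀ i, PG (db G' (wd (Cv (kk ε) p)) i) := fun i => H.db_pg hq2 i
  have hder : ∀ x, ∃ D : Ed d →L[ℝ] ℝ, HasFDerivAt (ff G' τ (Cv (kk ε) p)) D x ∧ ∀ i, D (ee i) = XX τ ε p (db G' (wd p)) i x + (db G' (wd (Cv (kk ε) p)) i x - db G' (wd p) i x) := by
    intro x
    obtain ⟨D, h1, h2⟩ := logq_deriv hp hε x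
    refine ⟨_, (H.G'_diff hq2 x).hasFDerivAt.add (h1.const_mul τ), fun i => ?_⟩
    simp only [ContinuousLinearMap.add_apply, ContinuousLinearMap.smul_apply, h2, smul_eq_mul]
    unfold XX db; ring
  have hfd : ∀ x i, fderiv ℝ (ff G' τ (Cv (kk ε) p)) x (ee i) = XX τ ε p (db G' (wd p)) i x + (db G' (wd (Cv (kk ε) p)) i x - db G' (wd p) i x) := by
    intro x i; obtain ⟨D, h1, h2⟩ := hder x; rw [h1.fderiv, h2]
  have hXY := fun i => (XY_gb (τ := τ) hp hε hβ i).integrable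
  have hdY := fun i => (GB.PG_mul ((hγ i).sub (hβ i)) (YY_gb (τ := τ) hε hp.gb hβ i)).integrable
  unfold Le
  rw [ibp hε hp.gb hβ (fun x => (hder x).choose_spec.1.differentiableAt) (H.ff_pg hq)]
  · simp_rw [hfd, add_mul]
    have : ∀ i, ∫ x, (XX τ ε p (db G' (wd p)) i x * YY τ ε p (db G' (wd p)) i x + (db G' (wd (Cv (kk ε) p)) i x - db G' (wd p) i x) * YY τ ε p (db G' (wd p)) i x)
      = (∫ x, Cv (kk ε) p x * XX τ ε p (db G' (wd p)) i x ^ 2) + (∫ x, XX τ ε p (db G' (wd p)) i x * kap ε p (db G' (wd p)) i x) + ∫ x, (db G' (wd (Cv (kk ε) p)) i x - db G' (wd p) i x) * YY τ ε p (db G' (wd p)) i x := by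
      intro i
      rw [integral_add (hXY i) (hdY i), ← integral_add (qXX_gb hp hε hβ i).integrable (Xkap_gb hp hε hβ i).integrable]
      congr 2; ext x; rw [YY_eq hp hε]; ring
    simp_rw [this, Finset.sum_add_distrib]; ring
  · intro i
    simp_rw [hfd, add_mul]
    exact iadd (hXY i) (hdY i)

theorem u_ibp (H : HF α L τ G G') (hp : Dn m a M b p) {μ : Measure (Ed d)} (hμ : IsP2 μ) (hε : 0 < ε)  :
    ∫ x, (G' μ x - G' (wd p) x) * ll τ ε p (db G' (wd p)) x = - ∑ i, ∫ x, (db G' μ i x - db G' (wd p) i x) * YY τ ε p (db G' (wd p)) i x := by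
  have hp2 := hp.pd.isP2
  have hβ : ∀ i, PG (db G' (wd p) i) := fun i => H.db_pg hp2 i
  have hγ : ∀ i, PG (db G' μ i) := fun i => H.db_pg hμ i
  have hfd : ∀ x i, fderiv ℝ (fun x => G' μ x - G' (wd p) x) x (ee i) = db G' μ i x - db G' (wd p) i x := by
    intro x i; rw [fderiv_fun_sub (H.G'_diff hμ x) (H.G'_diff hp2 x)]; rfl
  rw [ibp (τ := τ) (g := fun x => G' μ x - G' (wd p) x) hε hp.gb hβ ((H.G'_diff hμ).sub (H.G'_diff hp2)) ((H.G'_pg hμ).sub (H.G'_pg hp2))]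
  · congr 1; refine Finset.sum_congr rfl fun i _ => ?_
    simp_rw [hfd]
  · intro i
    simp_rw [hfd]
    exact (GB.PG_mul ((hγ i).sub (hβ i)) (YY_gb hε hp.gb hβ i)).integrable

theorem claim1 (H : HF α L τ G G') (hp : Dn m a M b p) (hε : 0 < ε) (hε1 : ε ≤ 1) :
    Le G' τ ε p ≤ - (1/2) * (∑ i, ∫ x, Cv (kk ε) p x * XX τ ε p (db G' (wd p)) i x ^ 2)
      + 3 * ∑ i, ((∫ x, ww ε p (db G' (wd p) i) x) + 4 * L ^ 2) := by
  rw [Le_eq H hp hε hε1]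
  have hq := q_Dn hp hε hε1
  have hq2 := hq.pd.isP2
  have hp2 := hp.pd.isP2
  have hβ : ∀ i, PG (db G' (wd p) i) := fun i => H.db_pg hp2 i
  have hγ : ∀ i, PG (db G' (wd (Cv (kk ε) p)) i) := fun i => H.db_pg hq2 i
  rw [Finset.mul_sum, Finset.mul_sum, ← Finset.sum_add_distrib, ← Finset.sum_neg_distrib, ← Finset.sum_sub_distrib, ← Finset.sum_sub_distrib]
  refine Finset.sum_le_sum fun i _ => ?_
  have i1 := (qXX_gb (τ := τ) hp hε hβ i).integrable
  have i1n : Integrable (fun x => -(Cv (kk ε) p x * XX τ ε p (db G' (wd p)) i x ^ 2)) := i1.neg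
  have i2 := (Xkap_gb (τ := τ) hp hε hβ i).integrable
  have i3 := (GB.PG_mul ((hγ i).sub (hβ i)) (YY_gb (τ := τ) hε hp.gb hβ i)).integrable
  have i4 := (ww_gb hp hε (hβ i)).integrable
  have i5 := hq.pd.int
  have e : 3 * ((∫ x, ww ε p (db G' (wd p) i) x) + 4 * L ^ 2) = ∫ x, 3 * (ww ε p (db G' (wd p) i) x + 4 * L ^ 2 * Cv (kk ε) p x) := by
    rw [integral_const_mul, integral_add i4 (i5.const_mul _), integral_const_mul, hq.mass]; ring
  rw [e, ← integral_const_mul, ← integral_neg, ← integral_sub i1n i2, ← integral_sub (isub i1n i2) i3, ← integral_add (i1.const_mul _) ((iadd i4 (i5.const_mul _)).const_mul _)]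
  refine integral_mono (isub (isub i1n i2) i3) (iadd (i1.const_mul _) ((iadd i4 (i5.const_mul _)).const_mul _)) fun x => ?_
  simp only
  rw [YY_eq hp hε]
  set q := Cv (kk ε) p x
  set X := XX τ ε p (db G' (wd p)) i x
  set κ := kap ε p (db G' (wd p)) i x
  set w := ww ε p (db G' (wd p) i) x
  set δ := db G' (wd (Cv (kk ε) p)) i x - db G' (wd p) i x
  have hqp : 0 < q := hq.pos x
  have hw : 0 ≤ w := ww_nonneg hp hε (hβ i) x
  have hk : κ ^ 2 ≤ q * w := kap_sq hp hε hβ i x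
  have hδ : δ ^ 2 ≤ 4 * L ^ 2 := by
    have := H.db_diff hq2 hp2 i x
    rw [← sq_abs]; calc _ ≤ (2 * L) ^ 2 := by gcongr
      _ = _ := by ring
  have a1 := neg_abs_le (X * κ)
  have a2 := amgm (X := X) hqp hw hk (l := 1/2) (by norm_num)
  have a3 := neg_abs_le (δ * κ)
  have a4 := amgm (X := δ) hqp hw hk (l := 1) (by norm_num)
  have a5 := mul_nonneg hqp.le (sq_nonneg (X / 2 + δ))
  have a6 := mul_le_mul_of_nonneg_left hδ hqp.le
  rw [abs_mul] at a1 a2 a3 a4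
  norm_num at a2 a4
  nlinarith

end C2
end ModC2

section ModC3
section C3
open Filter Topology
variable {d : ℕ} {p w : Ed d → ℝ} {m a M b ε : ℝ}
variable {α L τ : ℝ} {G : Measure (Ed d) → ℝ} {G' : Measure (Ed d) → Ed d → ℝ}

/-- L¹ closeness from L² closeness plus Fisher-information type tails -/
theorem L1_of_L2 (d : ℕ) {B η : ℝ} (hB : 0 ≤ B) (hη : 0 < η) : ∃ η', 0 < η' ∧ ∀ (v w q r : Ed d → ℝ),
    Integrable (fun x => |v x - w x|) → Integrable (fun x => (v x - w x) ^ 2) →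
    (∀ x, 0 < q x) → (∀ x, 0 < r x) → Integrable (fun x => v x ^ 2 / q x) → Integrable (fun x => w x ^ 2 / r x) →
    Integrable (fun x => om x * q x) → Integrable (fun x => om x * r x) →
    ∫ x, v x ^ 2 / q x ≤ B → ∫ x, w x ^ 2 / r x ≤ B → ∫ x, om x * q x ≤ B → ∫ x, om x * r x ≤ B →
    ∫ x, (v x - w x) ^ 2 ≤ η' → ∫ x, |v x - w x| ≤ η := by
  set R : ℝ := (6 * B) / η + 1 with hR
  have hRp : 0 < R := by positivity
  set V : ℝ := (volume (Metric.closedBall (0 : Ed d) R)).toReal with hV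
  have hV0 : 0 ≤ V := ENNReal.toReal_nonneg
  set lam : ℝ := η / (V + 1) with hlam
  have hlamp : 0 < lam := by positivity
  refine ⟨lam * η / 3, by positivity, ?_⟩
  intro v w q r i1 i2 hq hr i3 i4 i5 i6 h3 h4 h5 h6 h2
  have hvolfin : volume (Metric.closedBall (0 : Ed d) R) ≠ ⊤ := measure_closedBall_lt_top.ne
  have i7 : Integrable (fun x : Ed d => (Metric.closedBall (0 : Ed d) R).indicator (fun _ => (1:ℝ)) x) :=
    (integrable_indicator_iff Metric.isClosed_closedBall.measurableSet).2 (integrableOn_const hvolfin)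
  have h7 : ∫ x : Ed d, (Metric.closedBall (0 : Ed d) R).indicator (fun _ => (1:ℝ)) x = V := by
    rw [integral_indicator Metric.isClosed_closedBall.measurableSet]; simp [hV, Measure.real]
  have key : ∫ x, |v x - w x| ≤ ∫ x, ((1 / (2 * lam)) * (v x - w x) ^ 2 + (lam / 2) * (Metric.closedBall (0 : Ed d) R).indicator (fun _ => (1:ℝ)) x
      + (1 / (2 * R)) * ((v x ^ 2 / q x + om x * q x) + (w x ^ 2 / r x + om x * r x))) := by
    refine integral_mono i1 (iadd (iadd (i2.const_mul _) (i7.const_mul _)) ((iadd (iadd i3 i5) (iadd i4 i6)).const_mul _)) fun x => ?_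
    simp only
    have n1 : 0 ≤ v x ^ 2 / q x := div_nonneg (sq_nonneg _) (hq x).le
    have n2 : 0 ≤ w x ^ 2 / r x := div_nonneg (sq_nonneg _) (hr x).le
    have n3 : 0 ≤ om x * q x := mul_nonneg (om_pos x).le (hq x).le
    have n4 : 0 ≤ om x * r x := mul_nonneg (om_pos x).le (hr x).le
    by_cases hx : x ∈ Metric.closedBall (0 : Ed d) R
    · rw [indicator_of_mem hx]
      have : |v x - w x| ≤ (1 / (2 * lam)) * (v x - w x) ^ 2 + lam / 2 := by
        rw [← sq_abs (v x - w x)]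
        have := sq_nonneg (|v x - w x| - lam)
        have e : 1 / (2 * lam) * |v x - w x| ^ 2 + lam / 2 - |v x - w x| = (1 / (2 * lam)) * (|v x - w x| - lam) ^ 2 := by
          field_simp; ring
        have : 0 ≤ 1 / (2 * lam) * (|v x - w x| - lam) ^ 2 := by positivity
        linarith
      have : 0 ≤ (1 / (2 * R)) * ((v x ^ 2 / q x + om x * q x) + (w x ^ 2 / r x + om x * r x)) := by positivity
      linarith
    · rw [indicator_of_notMem hx]
      have hxR : R ≤ ‖x‖ := by
        simp only [Metric.mem_closedBall, dist_zero_right, not_le] at hx; exact hx.le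
      have aux : ∀ (v q : ℝ), 0 < q → |v| ≤ (1 / (2 * R)) * (v ^ 2 / q + om x * q) := by
        intro v q hq
        have e1 : 2 * (‖x‖ * |v|) ≤ v ^ 2 / q + om x * q := by
          have : v ^ 2 / q + ‖x‖ ^ 2 * q - 2 * (‖x‖ * |v|) = (1 / q) * (|v| - ‖x‖ * q) ^ 2 := by
            rw [← sq_abs v]; field_simp; ring
          have h : 0 ≤ (1 / q) * (|v| - ‖x‖ * q) ^ 2 := by positivity
          have : om x * q = q + ‖x‖ ^ 2 * q := by unfold om; ring
          linarith
        have e2 : R * |v| ≤ ‖x‖ * |v| := by gcongr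
        rw [one_div, ← div_eq_inv_mul, le_div_iff₀ (by positivity)]
        linarith
      have := aux (v x) (q x) (hq x)
      have := aux (w x) (r x) (hr x)
      have := abs_sub (v x) (w x)
      have : 0 ≤ (1 / (2 * lam)) * (v x - w x) ^ 2 := by positivity
      linarith
  rw [integral_add (iadd (i2.const_mul _) (i7.const_mul _)) ((iadd (iadd i3 i5) (iadd i4 i6)).const_mul _), integral_add (i2.const_mul _) (i7.const_mul _),
    integral_const_mul, integral_const_mul, integral_const_mul, integral_add (iadd i3 i5) (iadd i4 i6), integral_add i3 i5, integral_add i4 i6, h7] at key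
  have b1 : 1 / (2 * lam) * ∫ x, (v x - w x) ^ 2 ≤ η / 6 := by
    calc _ ≤ 1 / (2 * lam) * (lam * η / 3) := by gcongr
      _ = η / 6 := by field_simp; norm_num
  have b2 : lam / 2 * V ≤ η / 2 := by
    rw [hlam]
    have : V / (V + 1) ≤ 1 := by rw [div_le_one (by positivity)]; linarith
    calc _ = η / 2 * (V / (V + 1)) := by ring
      _ ≤ η / 2 * 1 := by gcongr
      _ = _ := by ring
  have b3 : 1 / (2 * R) * ((∫ x, v x ^ 2 / q x) + (∫ x, om x * q x) + ((∫ x, w x ^ 2 / r x) + ∫ x, om x * r x)) ≤ η / 3 := by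
    calc _ ≤ 1 / (2 * R) * (B + B + (B + B)) := by gcongr
      _ ≤ η / 3 := by
        rw [one_div, ← div_eq_inv_mul, div_le_iff₀ (by positivity), hR]
        have : η * (6 * B / η) = 6 * B := by field_simp
        nlinarith
  linarith

/-- uniform second moment on a class -/
theorem om_mom (hb : 0 < b) (hM : 0 < M) : ∃ B, 0 ≤ B ∧ ∀ q : Ed d → ℝ, Dn m a M b q → ∫ x, om x * q x ≤ B := by
  have hi : Integrable (fun x : Ed d => om x * kk b x) := by simpa using om_kk_int (d := d) 1 hb
  refine ⟨M * ∫ x : Ed d, om x * kk b x, ?_, fun q hq => ?_⟩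
  · exact mul_nonneg hM.le (integral_nonneg fun x => mul_nonneg (om_pos x).le (kk_pos hb x).le)
  · rw [← integral_const_mul]
    refine integral_mono hq.pd.int_om (hi.const_mul _) fun x => ?_
    have := mul_le_mul_of_nonneg_left (hq.ub x) (om_pos x).le
    simp only; linarith

theorem fish_le (H : HF α L τ G G') (hp : Dn m a M b p) : ∃ A, 0 ≤ A ∧ ∀ ε, 0 < ε → ε ≤ 1 → ∀ i,
    τ ^ 2 * ∫ x, Cv (k1 ε i) p x ^ 2 / Cv (kk ε) p x ≤ 2 * (∫ x, Cv (kk ε) p x * XX τ ε p (db G' (wd p)) i x ^ 2) + A := by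
  have hp2 := hp.pd.isP2
  have hβ : ∀ i, PG (db G' (wd p) i) := fun i => H.db_pg hp2 i
  obtain ⟨B, hB, hBq⟩ := om_mom (d := d) (m := m1 d m a) (a := a) (p_Dn hp).hb (p_Dn hp).hM
  refine ⟨2 * ((2 * α ^ 2 + 2 * L ^ 2) * B), by positivity, fun ε hε hε1 i => ?_⟩
  have hq := q_Dn hp hε hε1
  have i1 := (qXX_gb (τ := τ) hp hε hβ i).integrable
  have i2 := hq.pd.int_om
  have h1 : τ ^ 2 * ∫ x, Cv (k1 ε i) p x ^ 2 / Cv (kk ε) p x ≤ ∫ x, (2 * (Cv (kk ε) p x * XX τ ε p (db G' (wd p)) i x ^ 2) + (2 * (2 * α ^ 2 + 2 * L ^ 2)) * (om x * Cv (kk ε) p x)) := by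
    rw [← integral_const_mul]
    refine integral_mono ((fish_gb hp hε i).integrable.const_mul _) (iadd (i1.const_mul _) (i2.const_mul _)) fun x => ?_
    simp only
    have hqp := hq.pos x
    have e : τ ^ 2 * (Cv (k1 ε i) p x ^ 2 / Cv (kk ε) p x) = Cv (kk ε) p x * (XX τ ε p (db G' (wd p)) i x - db G' (wd p) i x) ^ 2 := by
      unfold XX; field_simp; ring
    rw [e]
    have := H.db_sq hp2 i x
    have h2 := mul_le_mul_of_nonneg_left this hqp.le
    have h3 := mul_nonneg hqp.le (sq_nonneg (XX τ ε p (db G' (wd p)) i x + db G' (wd p) i x))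
    nlinarith
  rw [integral_add (i1.const_mul _) (i2.const_mul _), integral_const_mul, integral_const_mul] at h1
  have := mul_le_mul_of_nonneg_left (hBq _ hq) (by positivity : 0 ≤ 2 * (2 * α ^ 2 + 2 * L ^ 2))
  linarith

theorem Y_cauchy (H : HF α L τ G G') (hp : Dn m a M b p) {ε : ℕ → ℝ} (hε : ∀ n, 0 < ε n) (hε1 : ∀ n, ε n ≤ 1)
    (hε0 : Tendsto ε atTop (𝓝 0)) (hanti : StrictAnti ε) {D : ℝ} (hD0 : 0 ≤ D)
    (hD : ∀ n i, ∫ x, Cv (kk (ε n)) p x * XX τ (ε n) p (db G' (wd p)) i x ^ 2 ≤ D) {η : ℝ} (hη : 0 < η) (i : Fin d) :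
    ∃ N, ∀ n0, N ≤ n0 → ∀ n, n0 < n → ∫ x, |YY τ (ε n) p (db G' (wd p)) i x - YY τ (ε n0) p (db G' (wd p)) i x| ≤ η := by
  have hp2 := hp.pd.isP2
  have hτ := H.hτ
  have hβ : ∀ i, PG (db G' (wd p) i) := fun i => H.db_pg hp2 i
  obtain ⟨A, hA, hfi⟩ := fish_le H hp
  obtain ⟨B, hB, hBq⟩ := om_mom (d := d) (m := m1 d m a) (a := a) (p_Dn hp).hb (p_Dn hp).hM
  have hf : ∀ n, ∫ x, Cv (k1 (ε n) i) p x ^ 2 / Cv (kk (ε n)) p x ≤ (2 * D + A) / τ ^ 2 := by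
    intro n
    rw [le_div_iff₀ (by positivity)]
    have := hfi _ (hε n) (hε1 n) i
    have := hD n i
    linarith
  set B' := max B ((2 * D + A) / τ ^ 2) with hB'
  have hB'0 : 0 ≤ B' := hB.trans (le_max_left _ _)
  obtain ⟨η', hη', hL⟩ := L1_of_L2 d hB'0 (show 0 < η / (2 * τ) by positivity)
  -- monotone bounded L2 norms
  set Nn : ℕ → ℝ := fun n => ∫ x, Cv (k1 (ε n) i) p x ^ 2 with hNn
  have hsm : ∀ n0 n, n0 < n → Cv (kk (ε n0 - ε n)) (Cv (k1 (ε n) i) p) = Cv (k1 (ε n0) i) p := by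
    intro n0 n h
    rw [P_k1 (sub_pos.2 (hanti h)) (hε n) i hp.gb.integrable]; congr 2; ring
  have hmono : Monotone Nn := by
    refine monotone_nat_of_le_succ fun n => ?_
    have := P_L2 (sub_pos.2 (hanti (Nat.lt_succ_self n))) (k1_cv_gb (hε (n+1)) i hp.gb)
    rw [hsm n (n+1) (Nat.lt_succ_self n)] at this
    exact this
  set S := M1 d M b * (2 * π * (b+1)) ^ (-(d : ℝ) / 2) with hS
  have hbdd : ∀ n, Nn n ≤ S * B' := by
    intro n
    have hq := q_Dn hp (hε n) (hε1 n)
    have hS0 : 0 ≤ S := mul_nonneg hq.hM.le (rpow_nonneg (by have := hp.hb; positivity) _)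
    calc Nn n ≤ ∫ x, S * (Cv (k1 (ε n) i) p x ^ 2 / Cv (kk (ε n)) p x) := by
          refine integral_mono (k1_cv_gb (hε n) i hp.gb).sq.integrable ((fish_gb hp (hε n) i).integrable.const_mul _) fun x => ?_
          simp only
          have hqp := hq.pos x
          have hqS : Cv (kk (ε n)) p x ≤ S := (hq.ub x).trans (mul_le_mul_of_nonneg_left (kk_le_const hq.hb x) hq.hM.le)
          have e : Cv (k1 (ε n) i) p x ^ 2 = Cv (kk (ε n)) p x * (Cv (k1 (ε n) i) p x ^ 2 / Cv (kk (ε n)) p x) := by field_simp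
          calc _ = _ := e
            _ ≤ _ := mul_le_mul_of_nonneg_right hqS (by positivity)
      _ ≤ S * B' := by
          rw [integral_const_mul]
          exact mul_le_mul_of_nonneg_left ((hf n).trans (le_max_right _ _)) hS0
  have hconv : ∃ l, Tendsto Nn atTop (𝓝 l) :=
    ⟨_, tendsto_atTop_ciSup hmono ⟨S * B', by rintro _ ⟨n, rfl⟩; exact hbdd n⟩⟩
  obtain ⟨l, hl⟩ := hconv
  obtain ⟨N1, hN1⟩ := (Metric.tendsto_atTop.1 hl) (η' / 2) (by positivity)
  have hap := P_approx hε hε1 hε0 (w := fun y => p y * db G' (wd p) i y) (hp.gb.mul_PG (hβ i)).integrable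
  obtain ⟨N2, hN2⟩ := (Metric.tendsto_atTop.1 hap) (η / 4) (by positivity)
  refine ⟨max N1 N2, fun n0 h0 n hn => ?_⟩
  have gv := k1_cv_gb (hε n) i hp.gb
  have gv0 := k1_cv_gb (hε n0) i hp.gb
  have hqn := q_Dn hp (hε n) (hε1 n)
  have hqn0 := q_Dn hp (hε n0) (hε1 n0)
  have h1 : ∫ x, |Cv (k1 (ε n) i) p x - Cv (k1 (ε n0) i) p x| ≤ η / (2 * τ) := by
    refine hL _ _ (Cv (kk (ε n)) p) (Cv (kk (ε n0)) p) (gv.sub gv0).abs.integrable (gv.sub gv0).sq.integrable hqn.pos hqn0.pos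
      (fish_gb hp (hε n) i).integrable (fish_gb hp (hε n0) i).integrable hqn.pd.int_om hqn0.pd.int_om
      ((hf n).trans (le_max_right _ _)) ((hf n0).trans (le_max_right _ _)) ((hBq _ hqn).trans (le_max_left _ _)) ((hBq _ hqn0).trans (le_max_left _ _)) ?_
    have hd := P_L2_defect (sub_pos.2 (hanti hn)) gv
    rw [hsm n0 n hn] at hd
    have d1 := hN1 n (by omega)
    have d2 := hN1 n0 (by omega)
    rw [Real.dist_eq] at d1 d2
    have := abs_lt.1 d1
    have := abs_lt.1 d2
    simp only [hNn] at *
    linarith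
  set w := fun y => p y * db G' (wd p) i y with hw
  have gw : GB w := hp.gb.mul_PG (hβ i)
  have gP := fun n => P_gb (hε n) gw
  have d1 := hN2 n (by omega)
  have d2 := hN2 n0 (by omega)
  rw [dist_zero_right, Real.norm_of_nonneg (integral_nonneg fun x => abs_nonneg _)] at d1 d2
  have j1 := ((gP n).sub gw).abs.integrable
  have j2 := ((gP n0).sub gw).abs.integrable
  have j3 := (gv.sub gv0).abs.integrable
  have h3 : ∫ x, |YY τ (ε n) p (db G' (wd p)) i x - YY τ (ε n0) p (db G' (wd p)) i x| ≤
      ∫ x, (|Cv (kk (ε n)) w x - w x| + |Cv (kk (ε n0)) w x - w x| + τ * |Cv (k1 (ε n) i) p x - Cv (k1 (ε n0) i) p x|) := by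
    refine integral_mono ((YY_gb (hε n) hp.gb hβ i).sub (YY_gb (hε n0) hp.gb hβ i)).abs.integrable (iadd (iadd j1 j2) (j3.const_mul _)) fun x => ?_
    simp only [YY]
    have e : Cv (kk (ε n)) w x + τ * Cv (k1 (ε n) i) p x - (Cv (kk (ε n0)) w x + τ * Cv (k1 (ε n0) i) p x)
      = (Cv (kk (ε n)) w x - w x) - (Cv (kk (ε n0)) w x - w x) + τ * (Cv (k1 (ε n) i) p x - Cv (k1 (ε n0) i) p x) := by ring
    rw [e]
    refine (abs_add_le _ _).trans ?_
    rw [abs_mul, abs_of_pos hτ]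
    gcongr
    exact abs_sub _ _
  rw [integral_add (iadd j1 j2) (j3.const_mul _), integral_add j1 j2, integral_const_mul] at h3
  have h4 : τ * ∫ x, |Cv (k1 (ε n) i) p x - Cv (k1 (ε n0) i) p x| ≤ η / 2 := by
    calc _ ≤ τ * (η / (2 * τ)) := by gcongr
      _ = _ := by field_simp
  linarith

end C3
end ModC3

section ModC4
section C4
open Filter Topology
variable {d : ℕ} {p w : Ed d → ℝ} {m a M b ε : ℝ}
variable {α L τ : ℝ} {G : Measure (Ed d) → ℝ} {G' : Measure (Ed d) → Ed d → ℝ}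

theorem u_tend0 (H : HF α L τ G G') (hp : Dn m a M b p) {ε : ℕ → ℝ} (hε : ∀ n, 0 < ε n) (hε1 : ∀ n, ε n ≤ 1)
    (hε0 : Tendsto ε atTop (𝓝 0)) {s : ℝ} (hs : 0 < s) :
    Tendsto (fun n => ∫ x, (G' (wd (Cv (kk (ε n)) p)) x - G' (wd p) x) * ll τ s p (db G' (wd p)) x) atTop (𝓝 0) := by
  have hp2 := hp.pd.isP2
  have hβ : ∀ i, PG (db G' (wd p) i) := fun i => H.db_pg hp2 i
  have hq := fun n => q_Dn hp (hε n) (hε1 n)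
  have gl := ll_gb (τ := τ) hs hp.gb hβ
  have hpg : ∀ n, PG (fun x => G' (wd (Cv (kk (ε n)) p)) x - G' (wd p) x) := fun n => (H.G'_pg (hq n).pd.isP2).sub (H.G'_pg hp2)
  have e : ∀ n, ∫ x, (G' (wd (Cv (kk (ε n)) p)) x - G' (wd p) x) * ll τ s p (db G' (wd p)) x =
      ∫ x, ((G' (wd (Cv (kk (ε n)) p)) x - G' (wd p) x) - (G' (wd (Cv (kk (ε n)) p)) 0 - G' (wd p) 0)) * ll τ s p (db G' (wd p)) x := fun n =>
    int_shift (GB.PG_mul (hpg n) gl).integrable gl.integrable (ll_int hs hp.gb hβ) _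
  simp_rw [e]
  rw [show (0:ℝ) = ∫ x : Ed d, (0:ℝ) by simp]
  refine tendsto_integral_of_dominated_convergence (fun x => 2 * L * (‖x‖ * |ll τ s p (db G' (wd p)) x|)) ?_ ?_ ?_ ?_
  · intro n
    exact (GB.PG_mul ((hpg n).sub (PG.const _)) gl).integrable.aestronglyMeasurable
  · exact (GB.PG_mul PG.norm_pg gl.abs).integrable.const_mul _
  · intro n
    refine Eventually.of_forall fun x => ?_
    rw [Real.norm_eq_abs, abs_mul, ← mul_assoc]
    gcongr
    simpa using H.u_lip (hq n).pd.isP2 hp2 x 0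
  · refine Eventually.of_forall fun x => ?_
    have := (demi H hq (p_Dn hp) (q_conv hε hε1 hε0 hp) x).mul_const (ll τ s p (db G' (wd p)) x)
    simpa using this

theorem u_tend (H : HF α L τ G G') (hp : Dn m a M b p) {ε : ℕ → ℝ} (hε : ∀ n, 0 < ε n) (hε1 : ∀ n, ε n ≤ 1)
    (hε0 : Tendsto ε atTop (𝓝 0)) (hanti : StrictAnti ε) {D : ℝ} (hD0 : 0 ≤ D)
    (hD : ∀ n i, ∫ x, Cv (kk (ε n)) p x * XX τ (ε n) p (db G' (wd p)) i x ^ 2 ≤ D) :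
    Tendsto (fun n => ∑ i, ∫ x, (db G' (wd (Cv (kk (ε n)) p)) i x - db G' (wd p) i x) * YY τ (ε n) p (db G' (wd p)) i x) atTop (𝓝 0) := by
  have hp2 := hp.pd.isP2
  have hL := H.hL
  have hβ : ∀ i, PG (db G' (wd p) i) := fun i => H.db_pg hp2 i
  have hq := fun n => q_Dn hp (hε n) (hε1 n)
  rw [Metric.tendsto_atTop]
  intro η hη
  set η' := η / (2 * (2 * L * (d + 1))) with hη'
  have hη'0 : 0 < η' := by positivity
  choose N hN using fun i => Y_cauchy H hp hε hε1 hε0 hanti hD0 hD hη'0 i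
  set n0 := ∑ i, N i with hn0
  have hn0i : ∀ i, N i ≤ n0 := fun i => Finset.single_le_sum (f := N) (fun _ _ => Nat.zero_le _) (Finset.mem_univ i)
  obtain ⟨N1, hN1⟩ := Metric.tendsto_atTop.1 (u_tend0 H hp hε hε1 hε0 (hε n0)) (η/2) (by positivity)
  refine ⟨max N1 (n0 + 1), fun n hn => ?_⟩
  have h1 := hN1 n (by omega)
  rw [u_ibp H hp (hq n).pd.isP2 (hε n0), dist_zero_right, norm_neg, Real.norm_eq_abs] at h1
  rw [dist_zero_right, Real.norm_eq_abs]
  have hδ : ∀ i, PG (fun x => db G' (wd (Cv (kk (ε n)) p)) i x - db G' (wd p) i x) := fun i => (H.db_pg (hq n).pd.isP2 i).sub (hβ i)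
  have i1 := fun i => (GB.PG_mul (hδ i) (YY_gb (τ := τ) (hε n) hp.gb hβ i)).integrable
  have i0 := fun i => (GB.PG_mul (hδ i) (YY_gb (τ := τ) (hε n0) hp.gb hβ i)).integrable
  have h2 : |(∑ i, ∫ x, (db G' (wd (Cv (kk (ε n)) p)) i x - db G' (wd p) i x) * YY τ (ε n) p (db G' (wd p)) i x) -
     ∑ i, ∫ x, (db G' (wd (Cv (kk (ε n)) p)) i x - db G' (wd p) i x) * YY τ (ε n0) p (db G' (wd p)) i x| ≤ ∑ i : Fin d, 2 * L * η' := by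
    rw [← Finset.sum_sub_distrib]
    refine (Finset.abs_sum_le_sum_abs _ _).trans (Finset.sum_le_sum fun i _ => ?_)
    rw [← integral_sub (i1 i) (i0 i)]
    calc _ ≤ ∫ x, 2 * L * |YY τ (ε n) p (db G' (wd p)) i x - YY τ (ε n0) p (db G' (wd p)) i x| := by
          refine abs_int_le (((YY_gb (hε n) hp.gb hβ i).sub (YY_gb (hε n0) hp.gb hβ i)).abs.integrable.const_mul _) fun x => ?_
          rw [← mul_sub, abs_mul]
          gcongr
          exact H.db_diff (hq n).pd.isP2 hp2 i x
      _ ≤ _ := by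
          rw [integral_const_mul]
          have := hN i n0 (hn0i i) n (by omega)
          gcongr
  have h3 : ∑ i : Fin d, 2 * L * η' ≤ η / 2 := by
    simp only [Finset.sum_const, Finset.card_univ, Fintype.card_fin, nsmul_eq_mul]
    rw [hη', ← sub_nonneg]
    have : η / 2 - d * (2 * L * (η / (2 * (2 * L * (d + 1))))) = η / (2 * (d + 1)) := by field_simp; ring
    rw [this]; positivity
  have := abs_sub_abs_le_abs_sub (∑ i, ∫ x, (db G' (wd (Cv (kk (ε n)) p)) i x - db G' (wd p) i x) * YY τ (ε n) p (db G' (wd p)) i x) (∑ i, ∫ x, (db G' (wd (Cv (kk (ε n)) p)) i x - db G' (wd p) i x) * YY τ (ε n0) p (db G' (wd p)) i x)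
  linarith

theorem D_bdd (H : HF α L τ G G') (hp : Dn m a M b p) {A0 : ℝ} : ∃ D, 0 ≤ D ∧ ∀ ε, 0 < ε → ε ≤ 1 → - A0 ≤ Le G' τ ε p →
    ∑ i, ∫ x, Cv (kk ε) p x * XX τ ε p (db G' (wd p)) i x ^ 2 ≤ D := by
  have hp2 := hp.pd.isP2
  have hβ : ∀ i, PG (db G' (wd p) i) := fun i => H.db_pg hp2 i
  obtain ⟨W, hW, hWb⟩ := ww_unif (d := d) hp.hm hp.ha hp.hM hp.hb (show 0 ≤ 2 * α ^ 2 + 2 * L ^ 2 by positivity)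
  refine ⟨max 0 (2 * A0 + 6 * ∑ i : Fin d, (W + 4 * L ^ 2)), le_max_left _ _, fun ε h0 h1 h => le_max_of_le_right ?_⟩
  have c := claim1 H hp h0 h1
  have : ∑ i, ((∫ x, ww ε p (db G' (wd p) i) x) + 4 * L ^ 2) ≤ ∑ i : Fin d, (W + 4 * L ^ 2) := by
    refine Finset.sum_le_sum fun i _ => ?_
    have := hWb p _ ε hp (hβ i) (fun x => H.db_sq hp2 i x) h0 h1
    linarith
  linarith

theorem D_lim (H : HF α L τ G G') (hp : Dn m a M b p) {ε : ℕ → ℝ} (hε : ∀ n, 0 < ε n) (hε1 : ∀ n, ε n ≤ 1)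
    (hε0 : Tendsto ε atTop (𝓝 0)) (hanti : StrictAnti ε) {A0 : ℝ} (hA : ∀ n, - A0 ≤ Le G' τ (ε n) p) {θ : ℝ} (hθ : 0 < θ) :
    ∀ᶠ n in atTop, ∑ i, ∫ x, Cv (kk (ε n)) p x * XX τ (ε n) p (db G' (wd p)) i x ^ 2 ≤ A0 + θ := by
  have hp2 := hp.pd.isP2
  have hβ : ∀ i, PG (db G' (wd p) i) := fun i => H.db_pg hp2 i
  have hq := fun n => q_Dn hp (hε n) (hε1 n)
  obtain ⟨D, hD0, hD⟩ := D_bdd (A0 := A0) H hp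
  have hD' := fun n => hD _ (hε n) (hε1 n) (hA n)
  have hnn : ∀ n i, 0 ≤ ∫ x, Cv (kk (ε n)) p x * XX τ (ε n) p (db G' (wd p)) i x ^ 2 := fun n i =>
    integral_nonneg fun x => mul_nonneg ((hq n).pos x).le (sq_nonneg _)
  have hDi : ∀ n i, ∫ x, Cv (kk (ε n)) p x * XX τ (ε n) p (db G' (wd p)) i x ^ 2 ≤ D := fun n i =>
    (Finset.single_le_sum (f := fun i => ∫ x, Cv (kk (ε n)) p x * XX τ (ε n) p (db G' (wd p)) i x ^ 2) (fun j _ => hnn n j) (Finset.mem_univ i)).trans (hD' n)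
  have hu := u_tend H hp hε hε1 hε0 hanti hD0 hDi
  set lam := θ / (D + 1) with hlam
  have hl0 : 0 < lam := by positivity
  have hw : Tendsto (fun n => 1 / (2 * lam) * ∑ i, ∫ x, ww (ε n) p (db G' (wd p) i) x) atTop (𝓝 0) := by
    have := (tendsto_finset_sum Finset.univ fun i _ => ww_tend hε hε1 hε0 hp (hβ i)).const_mul (1 / (2 * lam))
    simpa using this
  have e1 := (Metric.tendsto_nhds.1 hu) (θ / 4) (by positivity)
  have e2 := (Metric.tendsto_nhds.1 hw) (θ / 4) (by positivity)
  filter_upwards [e1, e2] with n h1 h2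
  rw [dist_zero_right, Real.norm_eq_abs] at h1 h2
  have hLe := hA n
  rw [Le_eq H hp (hε n) (hε1 n)] at hLe
  have h3 : |∑ i, ∫ x, XX τ (ε n) p (db G' (wd p)) i x * kap (ε n) p (db G' (wd p)) i x| ≤
      lam / 2 * (∑ i, ∫ x, Cv (kk (ε n)) p x * XX τ (ε n) p (db G' (wd p)) i x ^ 2) + 1 / (2 * lam) * ∑ i, ∫ x, ww (ε n) p (db G' (wd p) i) x := by
    rw [Finset.mul_sum, Finset.mul_sum, ← Finset.sum_add_distrib]
    refine (Finset.abs_sum_le_sum_abs _ _).trans (Finset.sum_le_sum fun i _ => ?_)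
    have i1 := (qXX_gb (τ := τ) hp (hε n) hβ i).integrable
    have i2 := (ww_gb hp (hε n) (hβ i)).integrable
    rw [← integral_const_mul, ← integral_const_mul, ← integral_add (i1.const_mul _) (i2.const_mul _)]
    refine abs_int_le (iadd (i1.const_mul _) (i2.const_mul _)) fun x => ?_
    exact amgm ((hq n).pos x) (ww_nonneg hp (hε n) (hβ i) x) (kap_sq hp (hε n) hβ i x) hl0
  have h4 : lam / 2 * (∑ i, ∫ x, Cv (kk (ε n)) p x * XX τ (ε n) p (db G' (wd p)) i x ^ 2) ≤ θ / 2 := by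
    calc _ ≤ lam / 2 * D := by gcongr; exact hD' n
      _ ≤ lam / 2 * (D + 1) := by gcongr; linarith
      _ = _ := by rw [hlam]; field_simp
  have := abs_lt.1 h1
  have := abs_lt.1 h2
  have := abs_le.1 h3
  linarith

end C4
end ModC4

section ModE1
section E1
open Filter Topology
variable {d : ℕ}

theorem kk_one_meas : Measurable (kk 1 : Ed d → ℝ) := (kk_cont 1).measurable

theorem wd_kk_one : (wd (kk 1) : Measure (Ed d)) = stdGaussian (Ed d) := by
  have hP : IsP2 (wd (kk 1) : Measure (Ed d)) := by
    apply Pd.isP2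
    exact ⟨kk_one_meas, fun x => (kk_pos one_pos x).le, by simpa using om_kk_int (d := d) 1 one_pos, kk_integral one_pos⟩
  have := hP.1
  apply Measure.ext_of_charFun
  ext t
  rw [charFun_stdGaussian, charFun_apply, wd, integral_withDensity_eq_integral_toReal_smul₀]
  · have h1 := GaussianFourier.integral_cexp_neg_mul_sq_norm_add (V := Ed d) (b := 1/2) (by norm_num) Complex.I t
    have e : ∀ x : Ed d, (ENNReal.ofReal (kk 1 x)).toReal • Complex.exp (⟪x, t⟫ * Complex.I) =
        ((2 * π) ^ (-(d:ℝ)/2) : ℝ) * Complex.exp (-(1/2) * ‖x‖ ^ 2 + Complex.I * ⟪t, x⟫) := by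
      intro x
      rw [ENNReal.toReal_ofReal (kk_pos one_pos x).le]
      unfold kk
      rw [Complex.real_smul, Complex.ofReal_mul, Complex.ofReal_exp, mul_assoc, ← Complex.exp_add, real_inner_comm]
      congr 2
      · simp
      · push_cast; ring
    simp_rw [e]
    rw [integral_const_mul]
    rw [h1]
    rw [← mul_assoc]
    have e2 : (((2 * π) ^ (-(d:ℝ)/2) : ℝ) : ℂ) * (↑π / (1 / 2)) ^ ((Module.finrank ℝ (Ed d) : ℂ) / 2) = 1 := by
      have : ((↑π / (1 / 2) : ℂ)) = ((2 * π : ℝ) : ℂ) := by push_cast; ring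
      rw [this]
      have h2 : ((Module.finrank ℝ (Ed d) : ℂ) / 2) = (((d:ℝ)/2 : ℝ) : ℂ) := by simp
      rw [h2, ← Complex.ofReal_cpow (by positivity), ← Complex.ofReal_mul, ← Real.rpow_add (by positivity)]
      simp [neg_div]
    rw [e2, one_mul]
    congr 1
    rw [Complex.I_sq]; ring
  · exact (kk_one_meas.ennreal_ofReal).aemeasurable
  · exact Eventually.of_forall fun x => ENNReal.ofReal_lt_top

theorem std_dual_sq (A : StrongDual ℝ (Ed d)) : ∫⁻ y, ENNReal.ofReal ((A y) ^ 2) ∂(stdGaussian (Ed d)) = ENNReal.ofReal (‖A‖ ^ 2) := by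
  have hm : MemLp A 2 (stdGaussian (Ed d)) := IsGaussian.memLp_dual _ A 2 (by simp)
  have h := variance_dual_stdGaussian (E := Ed d) A
  rw [variance_of_integral_eq_zero A.continuous.aemeasurable (integral_strongDual_stdGaussian A)] at h
  rw [← ofReal_integral_eq_lintegral_ofReal hm.integrable_sq (Eventually.of_forall fun x => sq_nonneg _), h]

theorem path_bound {f : Ed d → ℝ} (hf : ContDiff ℝ 1 f) (x y : Ed d) :
    ENNReal.ofReal ((f y - f x) ^ 2) ≤ ENNReal.ofReal (π / 2) * ∫⁻ θ in Icc 0 (π/2),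
      ENNReal.ofReal ((fderiv ℝ f (Real.cos θ • x + Real.sin θ • y) (- Real.sin θ • x + Real.cos θ • y)) ^ 2) := by
  have hfc : Continuous (fderiv ℝ f) := hf.continuous_fderiv (by norm_num)
  set φ : ℝ → ℝ := fun θ => fderiv ℝ f (Real.cos θ • x + Real.sin θ • y) (- Real.sin θ • x + Real.cos θ • y) with hφ
  have hφc : Continuous φ := by
    refine (hfc.comp (by fun_prop)).clm_apply (by fun_prop)
  have hder : ∀ θ ∈ uIcc 0 (π/2), HasDerivAt (fun θ => f (Real.cos θ • x + Real.sin θ • y)) (φ θ) θ := by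
    intro θ _
    have h1 : HasDerivAt (fun θ => Real.cos θ • x + Real.sin θ • y) (- Real.sin θ • x + Real.cos θ • y) θ :=
      ((Real.hasDerivAt_cos θ).smul_const x).add ((Real.hasDerivAt_sin θ).smul_const y)
    exact ((hf.differentiable (by norm_num) _).hasFDerivAt).comp_hasDerivAt θ h1
  have hint := intervalIntegral.integral_eq_sub_of_hasDerivAt hder (hφc.intervalIntegrable _ _)
  simp only [cos_pi_div_two, sin_pi_div_two, cos_zero, sin_zero, zero_smul, one_smul, zero_add, add_zero] at hint
  have hpi : (0:ℝ) ≤ π / 2 := by positivity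
  rw [intervalIntegral.integral_of_le hpi, ← integral_Icc_eq_integral_Ioc] at hint
  have hi1 : Integrable (fun _ : ℝ => (1:ℝ)) (volume.restrict (Icc 0 (π/2))) := integrable_const _
  have hi2 : Integrable (fun θ => 1 * φ θ) (volume.restrict (Icc 0 (π/2))) := (by fun_prop : Continuous fun θ => 1 * φ θ).continuousOn.integrableOn_compact isCompact_Icc
  have hi3 : Integrable (fun θ => 1 * φ θ ^ 2) (volume.restrict (Icc 0 (π/2))) := (by fun_prop : Continuous fun θ => 1 * φ θ ^ 2).continuousOn.integrableOn_compact isCompact_Icc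
  have cs := cs_weight (fun _ => zero_le_one) hi1 hi2 hi3
  simp only [one_mul] at cs hi3
  rw [hint] at cs
  have hv : ∫ θ in Icc 0 (π/2), (1:ℝ) = π / 2 := by simp [Measure.real, hpi]
  rw [hv] at cs
  rw [← ofReal_integral_eq_lintegral_ofReal hi3 (Eventually.of_forall fun x => sq_nonneg _), ← ENNReal.ofReal_mul hpi]
  exact ENNReal.ofReal_le_ofReal cs

theorem poincare_std {f : Ed d → ℝ} (hf : ContDiff ℝ 1 f) :
    ∫⁻ z, ENNReal.ofReal ((f z.2 - f z.1) ^ 2) ∂((stdGaussian (Ed d)).prod (stdGaussian (Ed d))) ≤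
      ENNReal.ofReal (π ^ 2 / 4) * ∫⁻ x, ENNReal.ofReal (‖fderiv ℝ f x‖ ^ 2) ∂(stdGaussian (Ed d)) := by
  have hfc : Continuous (fderiv ℝ f) := hf.continuous_fderiv (by norm_num)
  set γ := stdGaussian (Ed d)
  set Φ : Ed d × Ed d → ℝ≥0∞ := fun z => ENNReal.ofReal ((fderiv ℝ f z.1 z.2) ^ 2) with hΦ
  have hΦc : Continuous fun z : Ed d × Ed d => (fderiv ℝ f z.1 z.2) ^ 2 := ((hfc.comp continuous_fst).clm_apply continuous_snd).pow 2
  have hΦm : Measurable Φ := (ENNReal.continuous_ofReal.comp hΦc).measurable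
  have hrot : ∀ θ : ℝ, ∫⁻ z, Φ (Real.cos θ • z.1 + Real.sin θ • z.2, - Real.sin θ • z.1 + Real.cos θ • z.2) ∂(γ.prod γ) = ∫⁻ z, Φ z ∂(γ.prod γ) := by
    intro θ
    have h := IsGaussian.map_rotation_eq_self_of_forall_strongDual_eq_zero (μ := γ) integral_strongDual_stdGaussian θ
    conv_rhs => rw [← h]
    rw [lintegral_map hΦm (by fun_prop)]
    rfl
  have hval : ∫⁻ z, Φ z ∂(γ.prod γ) = ∫⁻ x, ENNReal.ofReal (‖fderiv ℝ f x‖ ^ 2) ∂γ := by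
    rw [lintegral_prod _ hΦm.aemeasurable]
    exact lintegral_congr fun x => std_dual_sq (fderiv ℝ f x)
  have hjm : AEMeasurable (Function.uncurry fun (z : Ed d × Ed d) (θ : ℝ) => Φ (Real.cos θ • z.1 + Real.sin θ • z.2, - Real.sin θ • z.1 + Real.cos θ • z.2))
      ((γ.prod γ).prod (volume.restrict (Icc 0 (π/2)))) := by
    refine Measurable.aemeasurable ?_
    refine hΦm.comp (Continuous.measurable ?_)
    fun_prop
  calc _ ≤ ∫⁻ z, ENNReal.ofReal (π / 2) * (∫⁻ θ in Icc 0 (π/2), Φ (Real.cos θ • z.1 + Real.sin θ • z.2, - Real.sin θ • z.1 + Real.cos θ • z.2)) ∂(γ.prod γ) :=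
        lintegral_mono fun z => path_bound hf z.1 z.2
    _ = ENNReal.ofReal (π / 2) * ∫⁻ z, (∫⁻ θ in Icc 0 (π/2), Φ (Real.cos θ • z.1 + Real.sin θ • z.2, - Real.sin θ • z.1 + Real.cos θ • z.2)) ∂(γ.prod γ) :=
        lintegral_const_mul' _ _ ENNReal.ofReal_ne_top
    _ = ENNReal.ofReal (π / 2) * ∫⁻ θ in Icc 0 (π/2), (∫⁻ z, Φ (Real.cos θ • z.1 + Real.sin θ • z.2, - Real.sin θ • z.1 + Real.cos θ • z.2) ∂(γ.prod γ)) := by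
        rw [lintegral_lintegral_swap hjm]
    _ = ENNReal.ofReal (π ^ 2 / 4) * ∫⁻ x, ENNReal.ofReal (‖fderiv ℝ f x‖ ^ 2) ∂γ := by
        simp_rw [hrot, hval]
        rw [setLIntegral_const, Real.volume_Icc, mul_comm (∫⁻ x, _ ∂γ), ← mul_assoc, ← ENNReal.ofReal_mul (by positivity)]
        congr 2; ring

end E1
end ModE1

section ModE2
section E2
open Filter Topology
variable {d : ℕ}

theorem norm_sq_dual (A : Ed d →L[ℝ] ℝ) : ‖A‖ ^ 2 = ∑ i, (A (ee i)) ^ 2 := by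
  set v := (InnerProductSpace.toDual ℝ (Ed d)).symm A with hv
  have h1 : ‖v‖ = ‖A‖ := LinearIsometryEquiv.norm_map _ _
  have h2 : ∀ i, A (ee i) = v i := by
    intro i
    rw [← inner_ee v i, hv, InnerProductSpace.toDual_symm_apply]
  rw [← h1, EuclideanSpace.norm_sq_eq]
  refine Finset.sum_congr rfl fun i _ => ?_
  rw [h2, Real.norm_eq_abs, sq_abs]

theorem kk_scale {a : ℝ} (ha : 0 < a) (z : Ed d) : kk a (Real.sqrt a • z) = a ^ (-(d:ℝ)/2) * kk 1 z := by
  unfold kk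
  rw [norm_smul, mul_pow, Real.norm_eq_abs, sq_abs, Real.sq_sqrt ha.le, mul_one, Real.mul_rpow (by positivity) ha.le]
  have : -(a * ‖z‖ ^ 2) / (2 * a) = -‖z‖ ^ 2 / (2 * 1) := by field_simp
  rw [this]; ring

theorem scale_int {a : ℝ} (ha : 0 < a) (φ : Ed d → ℝ) : ∫ z, φ (Real.sqrt a • z) * kk 1 z = ∫ x, φ x * kk a x := by
  have h := P_scale ha (fun y => φ (-y)) (0 : Ed d)
  unfold Cv at h
  rw [← integral_neg_eq_self (fun x => φ x * kk a x)]
  simp only [zero_sub, neg_neg] at h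
  simp_rw [mul_comm (φ _)]
  exact h.symm

theorem scale_integrable {a : ℝ} (ha : 0 < a) {φ : Ed d → ℝ} (h : Integrable (fun x => φ x * kk a x)) :
    Integrable (fun z => φ (Real.sqrt a • z) * kk 1 z) := by
  have h1 := h.comp_smul (Real.sqrt_pos.2 ha).ne'
  have h2 := h1.const_mul ((a ^ (-(d:ℝ)/2))⁻¹)
  refine h2.congr (Eventually.of_forall fun z => ?_)
  simp only
  rw [kk_scale ha]
  have : a ^ (-(d:ℝ)/2) ≠ 0 := by positivity
  field_simp

theorem poincare_var_std {F : Ed d → ℝ} (hF : ContDiff ℝ 1 F) (hFp : PG F)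
    (hg : Integrable (fun x => ‖fderiv ℝ F x‖ ^ 2 * kk 1 x)) (c : ℝ) (hc : c = ∫ x, F x * kk 1 x) :
    ∫ x, (F x - c) ^ 2 * kk 1 x ≤ π ^ 2 / 8 * ∫ x, ‖fderiv ℝ F x‖ ^ 2 * kk 1 x := by
  have hkm := kk_one_meas (d := d)
  have hkn : ∀ x : Ed d, 0 ≤ kk 1 x := fun x => (kk_pos one_pos x).le
  have hw : ∀ φ : Ed d → ℝ, ∫ x, φ x * kk 1 x = ∫ x, φ x ∂(stdGaussian (Ed d)) := by
    intro φ; rw [← wd_kk_one, wd_integral hkm hkn]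
  have hwi : ∀ φ : Ed d → ℝ, Integrable (fun x => φ x * kk 1 x) → Integrable φ (stdGaussian (Ed d)) := by
    intro φ h; rw [← wd_kk_one, wd_integrable hkm hkn]; exact h
  have hp := poincare_std hF
  set γ := stdGaussian (Ed d) with hγ
  have hFi : Integrable F γ := hwi _ (GB.PG_mul hFp (GB.kk_gb one_pos)).integrable
  have hFc : Integrable (fun x => F x - c) γ := isub hFi (integrable_const _)
  have hFc2 : Integrable (fun x => (F x - c) ^ 2) γ := hwi _ (GB.PG_mul (hFp.sub (PG.const c)).sq (GB.kk_gb one_pos)).integrable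
  have hg' : Integrable (fun x => ‖fderiv ℝ F x‖ ^ 2) γ := hwi _ hg
  rw [hw] at hc
  rw [hw (fun x => (F x - c) ^ 2), hw (fun x => ‖fderiv ℝ F x‖ ^ 2)]
  have e0 : ∫ x, (F x - c) ∂γ = 0 := by
    rw [integral_sub hFi (integrable_const _), ← hc]; simp
  have j1 : Integrable (fun z : Ed d × Ed d => (F z.1 - c) ^ 2) (γ.prod γ) := hFc2.comp_fst γ
  have j2 : Integrable (fun z : Ed d × Ed d => (F z.2 - c) ^ 2) (γ.prod γ) := hFc2.comp_snd γ
  have j3 : Integrable (fun z : Ed d × Ed d => (F z.1 - c) * (F z.2 - c)) (γ.prod γ) := hFc.mul_prod hFc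
  have e1 : ∫ z, (F z.1 - c) ^ 2 ∂(γ.prod γ) = ∫ x, (F x - c) ^ 2 ∂γ := by
    have := integral_fun_fst (μ := γ) (ν := γ) (fun x => (F x - c) ^ 2)
    simpa using this
  have e2 : ∫ z, (F z.2 - c) ^ 2 ∂(γ.prod γ) = ∫ x, (F x - c) ^ 2 ∂γ := by
    have := integral_fun_snd (μ := γ) (ν := γ) (fun x => (F x - c) ^ 2)
    simpa using this
  have e3 : ∫ z, (F z.1 - c) * (F z.2 - c) ∂(γ.prod γ) = 0 := by
    rw [integral_prod_mul (fun x => F x - c) (fun x => F x - c), e0]; simp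
  have hexp : (fun z : Ed d × Ed d => (F z.2 - F z.1) ^ 2) = fun z => ((F z.1 - c) ^ 2 + (F z.2 - c) ^ 2) - 2 * ((F z.1 - c) * (F z.2 - c)) := by
    ext z; ring
  have j4 : Integrable (fun z : Ed d × Ed d => (F z.2 - F z.1) ^ 2) (γ.prod γ) := by
    rw [hexp]; exact isub (iadd j1 j2) (j3.const_mul 2)
  have e4 : ∫ z, (F z.2 - F z.1) ^ 2 ∂(γ.prod γ) = 2 * ∫ x, (F x - c) ^ 2 ∂γ := by
    rw [hexp, integral_sub (iadd j1 j2) (j3.const_mul 2), integral_add j1 j2, integral_const_mul, e1, e2, e3]; ring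
  rw [← ofReal_integral_eq_lintegral_ofReal j4 (Eventually.of_forall fun x => sq_nonneg _),
    ← ofReal_integral_eq_lintegral_ofReal hg' (Eventually.of_forall fun x => sq_nonneg _), ← ENNReal.ofReal_mul (by positivity),
    ENNReal.ofReal_le_ofReal_iff (mul_nonneg (by positivity) (integral_nonneg fun x => sq_nonneg _)), e4] at hp
  linarith

theorem poincare_var {a : ℝ} (ha : 0 < a) {f : Ed d → ℝ} (hf : ContDiff ℝ 1 f) (hfp : PG f)
    (hg : Integrable (fun x => ‖fderiv ℝ f x‖ ^ 2 * kk a x)) (c : ℝ) (hc : c = ∫ x, f x * kk a x) :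
    ∫ x, (f x - c) ^ 2 * kk a x ≤ π ^ 2 / 8 * a * ∫ x, ‖fderiv ℝ f x‖ ^ 2 * kk a x := by
  set s := Real.sqrt a with hs
  have hs2 : s ^ 2 = a := Real.sq_sqrt ha.le
  have hF : ContDiff ℝ 1 (fun z => f (s • z)) := hf.comp (contDiff_const_smul s)
  have hfd : ∀ z, ‖fderiv ℝ (fun z => f (s • z)) z‖ ^ 2 = a * ‖fderiv ℝ f (s • z)‖ ^ 2 := by
    intro z
    have h1 := ((hf.differentiable (by norm_num) (s • z)).hasFDerivAt).comp z ((hasFDerivAt_id z).const_smul s)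
    have h2 : fderiv ℝ (fun z => f (s • z)) z = s • fderiv ℝ f (s • z) := by
      have h3 : HasFDerivAt (fun z => f (s • z)) (fderiv ℝ f (s • z) ∘SL (s • ContinuousLinearMap.id ℝ (Ed d))) z := h1
      rw [h3.fderiv]
      ext v; simp
    rw [h2, norm_smul, mul_pow, Real.norm_eq_abs, sq_abs, hs2]
  have hFp : PG (fun z => f (s • z)) := by
    obtain ⟨hm, C, j, hC, hb⟩ := hfp
    refine ⟨hm.comp (measurable_const_smul s), C * (1 + a) ^ j, j, by positivity, fun z => ?_⟩
    have h1 : om (s • z) ≤ (1 + a) * om z := by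
      unfold om; rw [norm_smul, mul_pow, Real.norm_eq_abs, sq_abs, hs2]; nlinarith [sq_nonneg ‖z‖]
    calc _ ≤ C * om (s • z) ^ j := hb _
      _ ≤ C * ((1 + a) * om z) ^ j := by gcongr; exact (om_pos _).le
      _ = _ := by rw [mul_pow]; ring
  have h := poincare_var_std hF hFp ?_ c ?_
  · simp_rw [hfd] at h
    rw [scale_int ha (fun x => (f x - c) ^ 2), scale_int ha (fun x => a * ‖fderiv ℝ f x‖ ^ 2)] at h
    simp_rw [mul_assoc] at h
    rw [integral_const_mul] at h
    simp_rw [mul_assoc]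
    exact h
  · simp_rw [hfd]
    exact scale_integrable ha (φ := fun x => a * ‖fderiv ℝ f x‖ ^ 2) (by simp_rw [mul_assoc]; exact hg.const_mul a)
  · rw [hc, scale_int ha f]

theorem poincare_dual {a : ℝ} (ha : 0 < a) {f : Ed d → ℝ} (hf : ContDiff ℝ 1 f) (hfp : PG f)
    (hg : Integrable (fun x => ‖fderiv ℝ f x‖ ^ 2 * kk a x)) {h : Ed d → ℝ} (hh : GB h) (h0 : ∫ x, h x = 0)
    (hhi : Integrable (fun x => h x ^ 2 / kk a x)) :
    (∫ x, f x * h x) ^ 2 ≤ (π ^ 2 / 8 * a * ∫ x, ‖fderiv ℝ f x‖ ^ 2 * kk a x) * ∫ x, h x ^ 2 / kk a x := by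
  set c := ∫ x, f x * kk a x with hc
  have hv := poincare_var ha hf hfp hg c hc
  have i1 := (GB.PG_mul hfp hh).integrable
  have e : ∫ x, f x * h x = ∫ x, (f x - c) * h x := int_shift i1 hh.integrable h0 c
  have i2 := (GB.PG_mul (hfp.sub (PG.const c)) hh).integrable
  have i3 := (GB.PG_mul (hfp.sub (PG.const c)).sq (GB.kk_gb (d := d) ha)).integrable
  set A := ∫ x, (f x - c) ^ 2 * kk a x with hA
  set B := ∫ x, h x ^ 2 / kk a x with hB
  have hA0 : 0 ≤ A := integral_nonneg fun x => mul_nonneg (sq_nonneg _) (kk_pos ha x).le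
  have hB0 : 0 ≤ B := integral_nonneg fun x => div_nonneg (sq_nonneg _) (kk_pos ha x).le
  have key : ∀ l : ℝ, 0 ≤ A * (l * l) + (-2 * ∫ x, f x * h x) * l + B := by
    intro l
    have : 0 ≤ ∫ x, (l ^ 2 * ((f x - c) ^ 2 * kk a x) - 2 * l * ((f x - c) * h x) + h x ^ 2 / kk a x) := by
      refine integral_nonneg fun x => ?_
      have hk := kk_pos ha x
      have : l ^ 2 * ((f x - c) ^ 2 * kk a x) - 2 * l * ((f x - c) * h x) + h x ^ 2 / kk a x = (l * (f x - c) * kk a x - h x) ^ 2 / kk a x := by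
        field_simp; ring
      show 0 ≤ _
      rw [this]; positivity
    rw [integral_add (isub (i3.const_mul _) (i2.const_mul _)) hhi, integral_sub (i3.const_mul _) (i2.const_mul _), integral_const_mul, integral_const_mul, ← e] at this
    linarith
  have hd := discrim_le_zero key
  unfold discrim at hd
  calc _ ≤ A * B := by nlinarith
    _ ≤ _ := mul_le_mul_of_nonneg_right hv hB0

end E2
end ModE2

section ModC5
section C5
open Filter Topology
variable {d : ℕ} {p w : Ed d → ℝ} {m a M b ε : ℝ}
variable {α L τ : ℝ} {G : Measure (Ed d) → ℝ} {G' : Measure (Ed d) → Ed d → ℝ}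

theorem kk_sq_div (ha : 0 < a) (hb : 0 < b) (hab : b < 2 * a) (x : Ed d) :
    kk b x ^ 2 / kk a x = (2 * (b / a) - (b / a) ^ 2) ^ (-(d:ℝ)/2) * kk (a * b / (2 * a - b)) x := by
  have h2 : 0 < 2 * a - b := by linarith
  unfold kk
  have e1 : 2 * (b / a) - (b / a) ^ 2 = (2 * π * b) * (2 * π * b) / ((2 * π * a) * (2 * π * (a * b / (2 * a - b)))) := by
    field_simp
  have hA : 0 < (2 * π * a) ^ (-(d:ℝ)/2) := by positivity
  have hS : 0 < (2 * π * (a * b / (2 * a - b))) ^ (-(d:ℝ)/2) := by positivity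
  rw [e1, Real.div_rpow (by positivity) (by positivity), Real.mul_rpow (x := 2 * π * b) (y := 2 * π * b) (by positivity) (by positivity),
    Real.mul_rpow (x := 2 * π * a) (y := 2 * π * (a * b / (2 * a - b))) (by positivity) (by positivity)]
  have e2 : Real.exp (-‖x‖ ^ 2 / (2 * b)) ^ 2 = Real.exp (-‖x‖ ^ 2 / (2 * (a * b / (2 * a - b)))) * Real.exp (-‖x‖ ^ 2 / (2 * a)) := by
    rw [← Real.exp_nat_mul, ← Real.exp_add]
    congr 1; field_simp; push_cast; ring
  rw [mul_pow, e2]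
  have hE := (Real.exp_pos (-‖x‖ ^ 2 / (2 * a)))
  generalize Real.exp (-‖x‖ ^ 2 / (2 * a)) = E1 at *
  generalize Real.exp (-‖x‖ ^ 2 / (2 * (a * b / (2 * a - b)))) = E2 at *
  generalize (2 * π * a) ^ (-(d:ℝ)/2) = A1 at *
  generalize (2 * π * (a * b / (2 * a - b))) ^ (-(d:ℝ)/2) = S1 at *
  generalize (2 * π * b) ^ (-(d:ℝ)/2) = B1 at *
  field_simp

def JC (d : ℕ) (a b : ℝ) : ℝ := (2 * (b / a) - (b / a) ^ 2) ^ (-(d:ℝ)/2)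

theorem JC_pos (ha : 0 < a) (hb : 0 < b) (hab : b < 2 * a) : 0 < JC d a b := by
  unfold JC
  apply Real.rpow_pos_of_pos
  have : 2 * (b / a) - (b / a) ^ 2 = b * (2 * a - b) / a ^ 2 := by field_simp
  rw [this]
  have h2 : 0 < 2 * a - b := by linarith
  positivity

theorem sq_div_bound (ha : 0 < a) (hb : 0 < b) (hab : b < 2 * a) {h : Ed d → ℝ} (hm : Measurable h) {M' : ℝ}
    (hh : ∀ x, |h x| ≤ M' * kk b x) : Integrable (fun x => h x ^ 2 / kk a x) ∧ ∫ x, h x ^ 2 / kk a x ≤ M' ^ 2 * JC d a b := by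
  have h2 : 0 < 2 * a - b := by linarith
  have hs : 0 < a * b / (2 * a - b) := by positivity
  have hle : ∀ x, h x ^ 2 / kk a x ≤ M' ^ 2 * JC d a b * kk (a * b / (2 * a - b)) x := by
    intro x
    rw [mul_assoc, JC, ← kk_sq_div ha hb hab, ← mul_div_assoc, ← mul_pow]
    have := kk_pos ha x
    gcongr ?_ / _
    rw [← sq_abs]; have := hh x; gcongr
  have hi : Integrable fun x : Ed d => M' ^ 2 * JC d a b * kk (a * b / (2 * a - b)) x := (kk_int hs).const_mul _
  have hI : Integrable (fun x => h x ^ 2 / kk a x) := by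
    refine hi.mono' ((hm.pow_const 2).div (kk_cont a).measurable).aestronglyMeasurable (Eventually.of_forall fun x => ?_)
    rw [Real.norm_of_nonneg (div_nonneg (sq_nonneg _) (kk_pos ha x).le)]
    exact hle x
  refine ⟨hI, (integral_mono hI hi hle).trans ?_⟩
  rw [integral_const_mul, kk_integral hs, mul_one]

theorem clm_eq_sum (A : Ed d →L[ℝ] ℝ) : A = ∑ i, (A (ee i)) • pr i := by
  ext x
  have hx : x = ∑ i, x i • (ee i : Ed d) := by
    ext j
    simp [ee, Finset.sum_apply, PiLp.single_apply, Pi.single_apply]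
  conv_lhs => rw [hx]
  simp [pr_apply, mul_comm]

theorem logq_C1 (hp : Dn m a M b p) (hε : 0 < ε) : ContDiff ℝ 1 (fun x => Real.log (Cv (kk ε) p x)) := by
  choose D hD hDi using logq_deriv hp hε
  rw [contDiff_one_iff_fderiv]
  refine ⟨fun x => (hD x).differentiableAt, ?_⟩
  have e : fderiv ℝ (fun x => Real.log (Cv (kk ε) p x)) = fun x => ∑ i, (Cv (k1 ε i) p x / Cv (kk ε) p x) • pr i := by
    ext1 x
    rw [(hD x).fderiv, clm_eq_sum (D x)]
    simp_rw [hDi]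
  rw [e]
  obtain ⟨B, _, hB⟩ := (GB.kk_gb (d := d) hε).bdd
  refine continuous_finset_sum _ fun i _ => ?_
  obtain ⟨B', _, hB'⟩ := (kk_gb1 (d := d) hε i).bdd
  have hc : Continuous fun x => Cv (k1 ε i) p x / Cv (kk ε) p x := (cv_continuous (k1_cont i) hB' hp.gb.integrable).div (cv_continuous (kk_cont ε) hB hp.gb.integrable) fun x => (q_pos hp hε x).ne'
  exact hc.smul continuous_const

theorem logq_tend (hp : Dn m a M b p) {ε : ℕ → ℝ} (hε : ∀ n, 0 < ε n) (hε1 : ∀ n, ε n ≤ 1)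
    (hε0 : Tendsto ε atTop (𝓝 0)) {h : Ed d → ℝ} (hh : GB h) :
    Tendsto (fun n => ∫ x, (Real.log (Cv (kk (ε n)) p x) - Real.log (p x)) * h x) atTop (𝓝 0) := by
  have hq := fun n => q_Dn hp (hε n) (hε1 n)
  have hp' := p_Dn hp
  obtain ⟨A, hA, hAb⟩ := log_bound (d := d) hp'.hm hp'.ha hp'.hM hp'.hb
  obtain ⟨B, hB, hBb⟩ := hh.bdd
  have hm1 := hp'.hm
  have hΨ : ∀ n, Integrable fun x => (Real.log (Cv (kk (ε n)) p x) - Real.log (p x)) * h x := fun n =>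
    (GB.PG_mul ((hq n).log_pg.sub hp'.log_pg) hh).integrable
  have := tend_T (l := atTop) (h := fun n x => Cv (kk (ε n)) p x - p x) (Ψ := fun n x => (Real.log (Cv (kk (ε n)) p x) - Real.log (p x)) * h x)
    (W := fun x => B / (m1 d m a * kk a x)) (Γ := fun x => 2 * A * (om x * |h x|))
    (fun n => ((hq n).gb.sub hp'.gb).integrable) hΨ ((GB.PG_mul PG.om_pg hh.abs).integrable.const_mul _)
    (continuous_const.div (continuous_const.mul (kk_cont a)) fun x => (mul_pos hm1 (kk_pos hp.ha x)).ne')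
    (P_approx hε hε1 hε0 hp.gb.integrable) ?_ ?_
  · rw [tendsto_zero_iff_abs_tendsto_zero]
    refine squeeze_zero (fun n => abs_nonneg _) (fun n => ?_) this
    exact abs_integral_le_integral_abs
  · intro n x
    rw [abs_mul]
    have h1 := hAb _ (hq n) x
    have h2 := hAb _ hp' x
    have h3 := abs_sub (Real.log (Cv (kk (ε n)) p x)) (Real.log (p x))
    calc _ ≤ (2 * A * om x) * |h x| := by gcongr; linarith
      _ = _ := by ring
  · intro n x
    rw [abs_mul]
    have hk := mul_pos hm1 (kk_pos hp.ha x)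
    have h1 := log_diff hk ((hq n).lb x) (hp'.lb x)
    calc _ ≤ (|Cv (kk (ε n)) p x - p x| / (m1 d m a * kk a x)) * B := by gcongr; exact hBb x
      _ = _ := by ring

theorem claim2 (H : HF α L τ G G') (hp : Dn m a M b p) (hab : b < 2 * a) {ε : ℕ → ℝ} (hε : ∀ n, 0 < ε n) (hε1 : ∀ n, ε n ≤ 1)
    (hε0 : Tendsto ε atTop (𝓝 0)) (hanti : StrictAnti ε) {A0 : ℝ} (hA : ∀ n, - A0 ≤ Le G' τ (ε n) p)
    {r : Ed d → ℝ} {M' : ℝ} (hMM : M ≤ M') (hrm : Measurable r) (hr0 : ∀ x, 0 ≤ r x) (hru : ∀ x, r x ≤ M' * kk b x) (hr1 : ∫ x, r x = 1) :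
    8 * m * (∫ x, ff G' τ p x * (p x - r x)) ^ 2 ≤ π ^ 2 * a * M' ^ 2 * JC d a b * A0 := by
  have ha := hp.ha
  have hb := hp.hb
  have hm := hp.hm
  have hp2 := hp.pd.isP2
  have hβ : ∀ i, PG (db G' (wd p) i) := fun i => H.db_pg hp2 i
  have hq := fun n => q_Dn hp (hε n) (hε1 n)
  have hJ := JC_pos (d := d) ha hb hab
  set h : Ed d → ℝ := fun x => p x - r x with hh
  have hhb : ∀ x, |h x| ≤ M' * kk b x := by
    intro x
    have h1 := (hp.pos x).le
    have h2 := (hp.ub x).trans (mul_le_mul_of_nonneg_right hMM (kk_pos hb x).le)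
    have h3 := hr0 x
    have h4 := hru x
    rw [abs_le]; simp only [hh]; constructor <;> linarith
  have hhg : GB h := GB.mk_le (hp.meas.sub hrm) hb hhb
  have hrg : GB r := GB.mk_le hrm hb fun x => by rw [abs_of_nonneg (hr0 x)]; exact hru x
  have hh0 : ∫ x, h x = 0 := by
    simp only [hh]; rw [integral_sub hp.gb.integrable hrg.integrable, hp.mass, hr1]; ring
  obtain ⟨hhi, hhJ⟩ := sq_div_bound ha hb hab hhg.meas hhb
  set f : ℕ → Ed d → ℝ := fun n x => G' (wd p) x + τ * Real.log (Cv (kk (ε n)) p x) with hf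
  have hfC : ∀ n, ContDiff ℝ 1 (f n) := fun n => (H.hA (wd p) hp2).2.1.add (contDiff_const.mul (logq_C1 hp (hε n)))
  have hfp : ∀ n, PG (f n) := fun n => (H.G'_pg hp2).add ((hq n).log_pg.const_mul τ)
  have hfd : ∀ n x i, fderiv ℝ (f n) x (ee i) = XX τ (ε n) p (db G' (wd p)) i x := by
    intro n x i
    obtain ⟨D, hD, hDi⟩ := logq_deriv hp (hε n) x
    have h1 : HasFDerivAt (f n) (fderiv ℝ (G' (wd p)) x + τ • D) x := (H.G'_diff hp2 x).hasFDerivAt.add (hD.const_mul τ)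
    rw [h1.fderiv]
    simp [XX, db, hDi]
  have hns : ∀ n x, ‖fderiv ℝ (f n) x‖ ^ 2 = ∑ i, XX τ (ε n) p (db G' (wd p)) i x ^ 2 := by
    intro n x; rw [norm_sq_dual]; simp_rw [hfd]
  set Dn' : ℕ → ℝ := fun n => ∑ i, ∫ x, Cv (kk (ε n)) p x * XX τ (ε n) p (db G' (wd p)) i x ^ 2 with hDn
  have hDs : ∀ n, Dn' n = ∫ x, ∑ i, Cv (kk (ε n)) p x * XX τ (ε n) p (db G' (wd p)) i x ^ 2 := by
    intro n; rw [integral_finset_sum _ fun i _ => (qXX_gb hp (hε n) hβ i).integrable]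
  have hcl : ∀ n, 0 < m * cl d a (ε n) := fun n => mul_pos hm (cl_pos ha (hε n))
  have hpt : ∀ n x, (m * cl d a (ε n)) * (‖fderiv ℝ (f n) x‖ ^ 2 * kk a x) ≤ ∑ i, Cv (kk (ε n)) p x * XX τ (ε n) p (db G' (wd p)) i x ^ 2 := by
    intro n x
    rw [hns, ← Finset.mul_sum]
    have := mul_le_mul_of_nonneg_right (q_lower hp (hε n) x) (Finset.sum_nonneg fun i _ => sq_nonneg (XX τ (ε n) p (db G' (wd p)) i x) : 0 ≤ ∑ i, XX τ (ε n) p (db G' (wd p)) i x ^ 2)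
    linarith
  have hsi : ∀ n, Integrable (fun x => ∑ i, Cv (kk (ε n)) p x * XX τ (ε n) p (db G' (wd p)) i x ^ 2) := fun n =>
    integrable_finset_sum _ fun i _ => (qXX_gb hp (hε n) hβ i).integrable
  have hgi' : ∀ n, Integrable (fun x => (m * cl d a (ε n)) * (‖fderiv ℝ (f n) x‖ ^ 2 * kk a x)) := by
    intro n
    refine (hsi n).mono' ?_ (Eventually.of_forall fun x => ?_)
    · have h1 : Continuous (fderiv ℝ (f n)) := (hfC n).continuous_fderiv (by norm_num)
      have h2 := kk_cont (d := d) a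
      exact (by fun_prop : Continuous fun x => (m * cl d a (ε n)) * (‖fderiv ℝ (f n) x‖ ^ 2 * kk a x)).aestronglyMeasurable
    · rw [Real.norm_of_nonneg (mul_nonneg (hcl n).le (mul_nonneg (sq_nonneg _) (kk_pos ha x).le))]
      exact hpt n x
  have hgi : ∀ n, Integrable (fun x => ‖fderiv ℝ (f n) x‖ ^ 2 * kk a x) := by
    intro n
    have := (hgi' n).const_mul (m * cl d a (ε n))⁻¹
    refine this.congr (Eventually.of_forall fun x => ?_)
    simp only; rw [← mul_assoc, inv_mul_cancel₀ (hcl n).ne', one_mul]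
  have hn : ∀ n, 8 * m * cl d a (ε n) * (∫ x, f n x * h x) ^ 2 ≤ π ^ 2 * a * M' ^ 2 * JC d a b * Dn' n := by
    intro n
    have h1 := poincare_dual ha (hfC n) (hfp n) (hgi n) hhg hh0 hhi
    have h2 : (m * cl d a (ε n)) * ∫ x, ‖fderiv ℝ (f n) x‖ ^ 2 * kk a x ≤ Dn' n := by
      rw [← integral_const_mul, hDs]
      exact integral_mono (hgi' n) (hsi n) (hpt n)
    have hV0 : 0 ≤ ∫ x, ‖fderiv ℝ (f n) x‖ ^ 2 * kk a x := integral_nonneg fun x => mul_nonneg (sq_nonneg _) (kk_pos ha x).le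
    have h3 : (∫ x, f n x * h x) ^ 2 ≤ (π ^ 2 / 8 * a * ∫ x, ‖fderiv ℝ (f n) x‖ ^ 2 * kk a x) * (M' ^ 2 * JC d a b) :=
      h1.trans (mul_le_mul_of_nonneg_left hhJ (mul_nonneg (by positivity) hV0))
    calc 8 * m * cl d a (ε n) * (∫ x, f n x * h x) ^ 2 = 8 * (m * cl d a (ε n)) * (∫ x, f n x * h x) ^ 2 := by ring
      _ ≤ 8 * (m * cl d a (ε n)) * ((π ^ 2 / 8 * a * ∫ x, ‖fderiv ℝ (f n) x‖ ^ 2 * kk a x) * (M' ^ 2 * JC d a b)) :=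
        mul_le_mul_of_nonneg_left h3 (by have := hcl n; positivity)
      _ = π ^ 2 * a * M' ^ 2 * JC d a b * ((m * cl d a (ε n)) * ∫ x, ‖fderiv ℝ (f n) x‖ ^ 2 * kk a x) := by ring
      _ ≤ _ := mul_le_mul_of_nonneg_left h2 (by positivity)
  have hlim1 : Tendsto (fun n => ∫ x, f n x * h x) atTop (𝓝 (∫ x, ff G' τ p x * h x)) := by
    have h1 := (logq_tend hp hε hε1 hε0 hhg).const_mul τ
    have h2 := h1.add_const (∫ x, ff G' τ p x * h x)
    simp only [mul_zero, zero_add] at h2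
    refine h2.congr fun n => ?_
    rw [← integral_const_mul, ← integral_add ((GB.PG_mul ((hq n).log_pg.sub hp.log_pg) hhg).integrable.const_mul τ) (GB.PG_mul (H.ff_pg hp) hhg).integrable]
    congr 1; ext x; simp only [hf, ff]; ring
  have hlim2 : Tendsto (fun n => cl d a (ε n)) atTop (𝓝 1) := by
    unfold cl
    have h1 : Tendsto (fun n => a / (a + ε n)) atTop (𝓝 (a / (a + 0))) := tendsto_const_nhds.div (tendsto_const_nhds.add hε0) (by simpa using ha.ne')
    rw [add_zero, div_self ha.ne'] at h1
    have := h1.rpow_const (p := (d:ℝ)/2) (Or.inl one_ne_zero)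
    simpa using this
  have hlim3 : Tendsto (fun n => 8 * m * cl d a (ε n) * (∫ x, f n x * h x) ^ 2) atTop (𝓝 (8 * m * (∫ x, ff G' τ p x * h x) ^ 2)) := by
    have := (hlim2.const_mul (8 * m)).mul (hlim1.pow 2)
    simpa using this
  set Kc := π ^ 2 * a * M' ^ 2 * JC d a b with hKc
  have hK0 : 0 ≤ Kc := by positivity
  have hθ : ∀ θ > 0, 8 * m * (∫ x, ff G' τ p x * h x) ^ 2 ≤ Kc * (A0 + θ) := by
    intro θ hθ
    refine le_of_tendsto hlim3 ?_
    filter_upwards [D_lim H hp hε hε1 hε0 hanti hA hθ] with n h1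
    exact (hn n).trans (mul_le_mul_of_nonneg_left h1 hK0)
  have hT : Tendsto (fun θ => Kc * (A0 + θ)) (𝓝[>] 0) (𝓝 (Kc * (A0 + 0))) := by
    apply Tendsto.mono_left _ nhdsWithin_le_nhds
    exact (Continuous.tendsto (by fun_prop) 0)
  rw [add_zero] at hT
  exact ge_of_tendsto hT (by filter_upwards [self_mem_nhdsWithin] with θ h using hθ θ h)

end C5
end ModC5

section ModD1
section D1
open Filter Topology
variable {d : ℕ} {m a M b ε : ℝ}
variable {α L τ : ℝ} {G : Measure (Ed d) → ℝ} {G' : Measure (Ed d) → Ed d → ℝ}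

def pd {d : ℕ} (i : Fin d) (φ : Ed d → ℝ) (y : Ed d) : ℝ := fderiv ℝ φ y (ee i)

def EE {d : ℕ} (τ : ℝ) (β : Fin d → Ed d → ℝ) (φ : Ed d → ℝ) (y : Ed d) : ℝ :=
  ∑ i, (-(pd i φ y) * β i y + τ * pd i (pd i φ) y)

def LL {d : ℕ} (τ : ℝ) (p : Ed d → ℝ) (β : Fin d → Ed d → ℝ) (φ : Ed d → ℝ) : ℝ :=
  ∫ y, EE τ β φ y * p y

theorem pd_contDiff {φ : Ed d → ℝ} (hφ : ContDiff ℝ (⊤ : ℕ∞) φ) (i : Fin d) : ContDiff ℝ (⊤ : ℕ∞) (pd i φ) := by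
  unfold pd
  exact (hφ.fderiv_right (by simp)).clm_apply contDiff_const

theorem EE_std {φ : Ed d → ℝ} (hφ : ContDiff ℝ (⊤ : ℕ∞) φ) {g : Ed d → ℝ} (y : Ed d) :
    - ⟪gradient φ y, gradient g y⟫ + τ * lap φ y = EE τ (fun i z => fderiv ℝ g z (ee i)) φ y := by
  have h1 : ∀ (f : Ed d → ℝ) (i : Fin d), (gradient f y) i = fderiv ℝ f y (ee i) := by
    intro f i
    rw [← inner_ee, gradient, InnerProductSpace.toDual_symm_apply]
  have h2 : ∀ i, iteratedFDeriv ℝ 2 φ y ![EuclideanSpace.single i 1, EuclideanSpace.single i 1] = pd i (pd i φ) y := by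
    intro i
    rw [iteratedFDeriv_two_apply]
    unfold pd
    have hd : DifferentiableAt ℝ (fderiv ℝ φ) y := by
      have : ContDiff ℝ (⊤ : ℕ∞) (fderiv ℝ φ) := hφ.fderiv_right (by simp)
      exact (this.differentiable (by simp)) y
    rw [fderiv_clm_apply hd (differentiableAt_const _)]
    simp
  unfold EE lap
  rw [PiLp.inner_apply]
  simp_rw [h1, h2]
  rw [Finset.sum_add_distrib, Finset.mul_sum, ← Finset.sum_neg_distrib]
  simp [pd, mul_comm]

theorem pd_mul {u v : Ed d → ℝ} (hu : Differentiable ℝ u) (hv : Differentiable ℝ v) (i : Fin d) :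
    pd i (fun y => u y * v y) = fun y => u y * pd i v y + pd i u y * v y := by
  ext y; unfold pd
  rw [fderiv_fun_mul (hu y) (hv y)]; simp; ring

theorem pd_add {u v : Ed d → ℝ} (hu : Differentiable ℝ u) (hv : Differentiable ℝ v) (i : Fin d) :
    pd i (fun y => u y + v y) = fun y => pd i u y + pd i v y := by
  ext y; unfold pd
  rw [fderiv_fun_add (hu y) (hv y)]; simp

theorem pd_cm {u : Ed d → ℝ} (c : ℝ) (hu : Differentiable ℝ u) (i : Fin d) :
    pd i (fun y => c * u y) = fun y => c * pd i u y := by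
  ext y; unfold pd
  rw [fderiv_const_mul (hu y)]; simp

theorem pd_scale {u : Ed d → ℝ} (c : ℝ) (hu : Differentiable ℝ u) (i : Fin d) :
    pd i (fun y => u (c • y)) = fun y => c * pd i u (c • y) := by
  ext y; unfold pd
  have h1 : HasFDerivAt (fun y : Ed d => c • y) (c • ContinuousLinearMap.id ℝ (Ed d)) y := (hasFDerivAt_id y).const_smul c
  have := ((hu (c • y)).hasFDerivAt.comp y h1).fderiv
  change fderiv ℝ (fun y => u (c • y)) y = _ at this
  rw [this]; simp

theorem pd_refl {u : Ed d → ℝ} (x : Ed d) (hu : Differentiable ℝ u) (i : Fin d) :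
    pd i (fun y => u (x - y)) = fun y => - pd i u (x - y) := by
  ext y; unfold pd
  have h1 : HasFDerivAt (fun y : Ed d => x - y) (- ContinuousLinearMap.id ℝ (Ed d)) y := (hasFDerivAt_id y).const_sub x
  have := ((hu (x - y)).hasFDerivAt.comp y h1).fderiv
  change fderiv ℝ (fun y => u (x - y)) y = _ at this
  rw [this]; simp

theorem pd_kk (i : Fin d) : pd i (kk ε) = k1 ε i := by
  ext y; unfold pd; rw [(kk_hasFDerivAt y).fderiv, kkD_ee]
theorem pd_k1 (i : Fin d) : pd i (k1 ε i) = k2 ε i := by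
  ext y; unfold pd; rw [(k1_hasFDerivAt i y).fderiv, k1D_ee]
theorem kk_diff : Differentiable ℝ (kk ε : Ed d → ℝ) := fun x => (kk_hasFDerivAt x).differentiableAt
theorem k1_diff (i : Fin d) : Differentiable ℝ (k1 ε i) := fun x => (k1_hasFDerivAt i x).differentiableAt

theorem kk_smooth : ContDiff ℝ (⊤ : ℕ∞) (kk ε : Ed d → ℝ) := by
  unfold kk
  have : ContDiff ℝ (⊤ : ℕ∞) fun x : Ed d => ‖x‖ ^ 2 := contDiff_norm_sq ℝ
  fun_prop

def tst {d : ℕ} (χ : Ed d → ℝ) (c ε : ℝ) (x y : Ed d) : ℝ := χ (c • y) * kk ε (x - y)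

theorem tst_smooth {χ : Ed d → ℝ} (hχ : ContDiff ℝ (⊤ : ℕ∞) χ) (c : ℝ) (x : Ed d) : ContDiff ℝ (⊤ : ℕ∞) (tst χ c ε x) := by
  unfold tst
  have h1 : ContDiff ℝ (⊤ : ℕ∞) fun y => χ (c • y) := hχ.comp (contDiff_const_smul c)
  have h2 : ContDiff ℝ (⊤ : ℕ∞) fun y => kk ε (x - y) := kk_smooth.comp (contDiff_const.sub contDiff_id)
  exact h1.mul h2

theorem tst_supp {χ : Ed d → ℝ} (hχ : HasCompactSupport χ) {c : ℝ} (hc : c ≠ 0) (x : Ed d) : HasCompactSupport (tst χ c ε x) := by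
  unfold tst
  exact (hχ.comp_smul hc).mul_right

theorem tst_pd1 {χ : Ed d → ℝ} (hχ : ContDiff ℝ (⊤ : ℕ∞) χ) (c : ℝ) (x : Ed d) (i : Fin d) :
    pd i (tst χ c ε x) = fun y => (-1) * (χ (c • y) * k1 ε i (x - y)) + c * (pd i χ (c • y) * kk ε (x - y)) := by
  have h1 : ContDiff ℝ (⊤ : ℕ∞) fun y => χ (c • y) := hχ.comp (contDiff_const_smul c)
  have h2 : ContDiff ℝ (⊤ : ℕ∞) fun y => kk ε (x - y) := kk_smooth.comp (contDiff_const.sub contDiff_id)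
  unfold tst
  rw [pd_mul (h1.differentiable (by simp)) (h2.differentiable (by simp)), pd_refl x kk_diff, pd_kk,
    pd_scale c (hχ.differentiable (by simp))]
  ext y; ring

theorem tst_pd2 {χ : Ed d → ℝ} (hχ : ContDiff ℝ (⊤ : ℕ∞) χ) (c : ℝ) (x : Ed d) (i : Fin d) :
    pd i (pd i (tst χ c ε x)) = fun y => χ (c • y) * k2 ε i (x - y) - 2 * c * (pd i χ (c • y) * k1 ε i (x - y))
      + c ^ 2 * (pd i (pd i χ) (c • y) * kk ε (x - y)) := by
  have hχ1 := pd_contDiff hχ i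
  have h1 : ContDiff ℝ (⊤ : ℕ∞) fun y => χ (c • y) := hχ.comp (contDiff_const_smul c)
  have h1' : ContDiff ℝ (⊤ : ℕ∞) fun y => pd i χ (c • y) := hχ1.comp (contDiff_const_smul c)
  have h2 : ContDiff ℝ (⊤ : ℕ∞) fun y => kk ε (x - y) := kk_smooth.comp (contDiff_const.sub contDiff_id)
  have h3 : Differentiable ℝ fun y => k1 ε i (x - y) := (k1_diff i).comp (differentiable_const x |>.sub differentiable_id)
  have g1 := h1.differentiable (by simp)
  have g1' := h1'.differentiable (by simp)
  have g2 := h2.differentiable (by simp)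
  have g4 : Differentiable ℝ fun y => χ (c • y) * k1 ε i (x - y) := g1.mul h3
  have g5 : Differentiable ℝ fun y => pd i χ (c • y) * kk ε (x - y) := g1'.mul g2
  rw [tst_pd1 hχ, pd_add (g4.const_mul _) (g5.const_mul _), pd_cm _ g4, pd_cm _ g5,
    pd_mul g1 h3, pd_mul g1' g2, pd_refl x kk_diff, pd_kk, pd_refl x (k1_diff i), pd_k1,
    pd_scale c (hχ.differentiable (by simp)), pd_scale c (hχ1.differentiable (by simp))]
  ext y; ring

theorem HF.db_om (H : HF α L τ G G') {μ : Measure (Ed d)} (hμ : IsP2 μ) (i : Fin d) (x : Ed d) :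
    |db G' μ i x| ≤ (1 + (2 * α ^ 2 + 2 * L ^ 2)) * om x := by
  have h1 := H.db_sq hμ i x
  have h2 := one_le_om x
  have h3 : |db G' μ i x| ≤ 1 + db G' μ i x ^ 2 := by
    rw [← sq_abs]; nlinarith [sq_nonneg (|db G' μ i x| - 1), abs_nonneg (db G' μ i x)]
  nlinarith

theorem bdd_of_cs {φ : Ed d → ℝ} (hc : Continuous φ) (hs : HasCompactSupport φ) : ∃ B, 0 ≤ B ∧ ∀ x, |φ x| ≤ B := by
  obtain ⟨C, hC⟩ := hs.exists_bound_of_continuous hc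
  exact ⟨|C|, abs_nonneg _, fun x => (hC x).trans (le_abs_self C)⟩

theorem pd_supp {φ : Ed d → ℝ} (hs : HasCompactSupport φ) (i : Fin d) : HasCompactSupport (pd i φ) := by
  unfold pd
  exact hs.fderiv_apply ℝ (ee i)

/-- uniform bound on test terms -/
theorem tst_bound (hε : 0 < ε) {χ : Ed d → ℝ} (hχ : ContDiff ℝ (⊤ : ℕ∞) χ) (hs : HasCompactSupport χ) :
    ∃ K, 0 ≤ K ∧ ∀ c, 0 ≤ c → c ≤ 1 → ∀ (x : Ed d) i y, |pd i (tst χ c ε x) y| ≤ K ∧ |pd i (pd i (tst χ c ε x)) y| ≤ K := by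
  obtain ⟨B0, hB0, hB0'⟩ := bdd_of_cs hχ.continuous hs
  have h1 : ∃ B, 0 ≤ B ∧ ∀ (i : Fin d) x, |pd i χ x| ≤ B ∧ |pd i (pd i χ) x| ≤ B ∧ |k1 ε i x| ≤ B ∧ |k2 ε i x| ≤ B := by
    choose B1 hB1 hB1' using fun i : Fin d => bdd_of_cs (pd_contDiff hχ i).continuous (pd_supp hs i)
    choose B2 hB2 hB2' using fun i : Fin d => bdd_of_cs (pd_contDiff (pd_contDiff hχ i) i).continuous (pd_supp (pd_supp hs i) i)
    choose B3 hB3 hB3' using fun i : Fin d => (kk_gb1 (d := d) hε i).bdd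
    choose B4 hB4 hB4' using fun i : Fin d => (kk_gb2 (d := d) hε i).bdd
    refine ⟨∑ i, (B1 i + B2 i + B3 i + B4 i), Finset.sum_nonneg fun i _ => by have := hB1 i; have := hB2 i; have := hB3 i; have := hB4 i; positivity, fun i x => ?_⟩
    have := Finset.single_le_sum (f := fun i => B1 i + B2 i + B3 i + B4 i) (fun i _ => by have := hB1 i; have := hB2 i; have := hB3 i; have := hB4 i; positivity) (Finset.mem_univ i)
    have := hB1 i; have := hB2 i; have := hB3 i; have := hB4 i
    have := hB1' i x; have := hB2' i x; have := hB3' i x; have := hB4' i x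
    refine ⟨?_, ?_, ?_, ?_⟩ <;> linarith
  obtain ⟨B, hB, hB'⟩ := h1
  obtain ⟨Bk, hBk, hBk'⟩ := (GB.kk_gb (d := d) hε).bdd
  refine ⟨B0 * B + 2 * (B * B) + B * Bk, by positivity, fun c hc0 hc1 x i y => ?_⟩
  rw [tst_pd2 hχ, tst_pd1 hχ]
  obtain ⟨u1, u2, -, -⟩ := hB' i (c • y)
  obtain ⟨-, -, u3, u4⟩ := hB' i (x - y)
  have u0 := hB0' (c • y)
  have uk := hBk' (x - y)
  have hBB := mul_nonneg hB hB
  have hc2 : c ^ 2 ≤ 1 := pow_le_one₀ hc0 hc1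
  constructor
  · calc _ ≤ |(-1) * (χ (c • y) * k1 ε i (x - y))| + |c * (pd i χ (c • y) * kk ε (x - y))| := abs_add_le _ _
      _ = |χ (c • y)| * |k1 ε i (x - y)| + c * (|pd i χ (c • y)| * |kk ε (x - y)|) := by
        simp [abs_mul, abs_of_nonneg hc0]
      _ ≤ B0 * B + 1 * (B * Bk) := by gcongr
      _ ≤ _ := by linarith
  · calc _ ≤ |χ (c • y) * k2 ε i (x - y)| + |2 * c * (pd i χ (c • y) * k1 ε i (x - y))| + |c ^ 2 * (pd i (pd i χ) (c • y) * kk ε (x - y))| :=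
        (abs_add_le _ _).trans (add_le_add_left (abs_sub _ _) _)
      _ = |χ (c • y)| * |k2 ε i (x - y)| + 2 * c * (|pd i χ (c • y)| * |k1 ε i (x - y)|) + c ^ 2 * (|pd i (pd i χ) (c • y)| * |kk ε (x - y)|) := by
        simp [abs_mul, abs_of_nonneg hc0]
      _ ≤ B0 * B + 2 * 1 * (B * B) + 1 * (B * Bk) := by gcongr
      _ ≤ _ := by linarith

theorem tst_lim1 {χ : Ed d → ℝ} (hχ : ContDiff ℝ (⊤ : ℕ∞) χ) (h0 : χ 0 = 1) {c : ℕ → ℝ} (hc : Tendsto c atTop (𝓝 0)) (x : Ed d) (i : Fin d) (y : Ed d) :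
    Tendsto (fun n => pd i (tst χ (c n) ε x) y) atTop (𝓝 (- k1 ε i (x - y))) := by
  have : Continuous fun c : ℝ => (-1) * (χ (c • y) * k1 ε i (x - y)) + c * (pd i χ (c • y) * kk ε (x - y)) := by
    have h1 := hχ.continuous
    have h2 := (pd_contDiff hχ i).continuous
    fun_prop
  have := (this.tendsto 0).comp hc
  simp only [tst_pd1 hχ]
  simpa [h0, Function.comp_def] using this

theorem tst_lim2 {χ : Ed d → ℝ} (hχ : ContDiff ℝ (⊤ : ℕ∞) χ) (h0 : χ 0 = 1) {c : ℕ → ℝ} (hc : Tendsto c atTop (𝓝 0)) (x : Ed d) (i : Fin d) (y : Ed d) :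
    Tendsto (fun n => pd i (pd i (tst χ (c n) ε x)) y) atTop (𝓝 (k2 ε i (x - y))) := by
  have : Continuous fun c : ℝ => χ (c • y) * k2 ε i (x - y) - 2 * c * (pd i χ (c • y) * k1 ε i (x - y))
      + c ^ 2 * (pd i (pd i χ) (c • y) * kk ε (x - y)) := by
    have h1 := hχ.continuous
    have h2 := (pd_contDiff hχ i).continuous
    have h3 := (pd_contDiff (pd_contDiff hχ i) i).continuous
    fun_prop
  have := (this.tendsto 0).comp hc
  simp only [tst_pd2 hχ]
  simpa [h0, Function.comp_def] using this
end D1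
end ModD1

section ModD2
section D2
open Filter Topology
variable {d : ℕ} {m a M b ε : ℝ}
variable {α L τ : ℝ} {G : Measure (Ed d) → ℝ} {G' : Measure (Ed d) → Ed d → ℝ} {p : ℝ → Ed d → ℝ}

def lam {d : ℕ} (G' : Measure (Ed d) → Ed d → ℝ) (τ : ℝ) (p : ℝ → Ed d → ℝ) (φ : Ed d → ℝ) (s : ℝ) : ℝ :=
  LL τ (p s) (db G' (wd (p s))) φ

structure Fl {d : ℕ} (G' : Measure (Ed d) → Ed d → ℝ) (τ m a M b : ℝ) (p : ℝ → Ed d → ℝ) : Prop where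
  dn : ∀ t, 0 ≤ t → Dn m a M b (p t)
  pde : ∀ φ : Ed d → ℝ, ContDiff ℝ (⊤ : ℕ∞) φ → HasCompactSupport φ → ∀ t₁ t₂ : ℝ, 0 ≤ t₁ → t₁ ≤ t₂ →
    (∫ x, φ x * p t₂ x) - (∫ x, φ x * p t₁ x) = ∫ s in t₁..t₂, lam G' τ p φ s

theorem bdd_pg {φ : Ed d → ℝ} (hc : Continuous φ) {B : ℝ} (hB : ∀ x, |φ x| ≤ B) : PG φ :=
  (PG.const B).mono hc.measurable fun x => (hB x).trans (le_abs_self B)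

theorem cs_pg {φ : Ed d → ℝ} (hc : Continuous φ) (hs : HasCompactSupport φ) : PG φ := by
  obtain ⟨B, _, hB⟩ := bdd_of_cs hc hs
  exact bdd_pg hc hB

theorem EE_pg {φ : Ed d → ℝ} (hφ : ContDiff ℝ (⊤ : ℕ∞) φ) (hs : HasCompactSupport φ) {β : Fin d → Ed d → ℝ} (hβ : ∀ i, PG (β i)) :
    PG (EE τ β φ) := by
  unfold EE
  refine PG.sum _ fun i _ => ?_
  exact ((cs_pg (pd_contDiff hφ i).continuous (pd_supp hs i)).neg.mul (hβ i)).add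
    ((cs_pg (pd_contDiff (pd_contDiff hφ i) i).continuous (pd_supp (pd_supp hs i) i)).const_mul τ)

theorem EE_add {φ ψ : Ed d → ℝ} (hφ : ContDiff ℝ (⊤ : ℕ∞) φ) (hψ : ContDiff ℝ (⊤ : ℕ∞) ψ) (β : Fin d → Ed d → ℝ) (y : Ed d) :
    EE τ β (fun y => φ y + ψ y) y = EE τ β φ y + EE τ β ψ y := by
  unfold EE
  rw [← Finset.sum_add_distrib]
  refine Finset.sum_congr rfl fun i _ => ?_
  have h1 := pd_add (hφ.differentiable (by simp)) (hψ.differentiable (by simp)) i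
  have h2 := pd_add ((pd_contDiff hφ i).differentiable (by simp)) ((pd_contDiff hψ i).differentiable (by simp)) i
  rw [h1, h2]; ring

theorem lam_add (H : HF α L τ G G') (F : Fl G' τ m a M b p) {φ ψ : Ed d → ℝ} (hφ : ContDiff ℝ (⊤ : ℕ∞) φ) (hsφ : HasCompactSupport φ)
    (hψ : ContDiff ℝ (⊤ : ℕ∞) ψ) (hsψ : HasCompactSupport ψ) {s : ℝ} (hs : 0 ≤ s) :
    lam G' τ p (fun y => φ y + ψ y) s = lam G' τ p φ s + lam G' τ p ψ s := by
  have hp := F.dn s hs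
  have hβ := fun i => H.db_pg hp.pd.isP2 i
  unfold lam LL
  rw [← integral_add (GB.PG_mul (EE_pg hφ hsφ hβ) hp.gb).integrable (GB.PG_mul (EE_pg hψ hsψ hβ) hp.gb).integrable]
  congr 1; ext y
  rw [EE_add hφ hψ]; ring

def sim {d : ℕ} (p : ℝ → Ed d → ℝ) (s t : ℝ) : Prop :=
  ∀ φ : Ed d → ℝ, ContDiff ℝ (⊤ : ℕ∞) φ → HasCompactSupport φ → ∫ x, φ x * p s x = ∫ x, φ x * p t x

theorem nsim_int (H : HF α L τ G G') (F : Fl G' τ m a M b p) {s t : ℝ} (hs : 0 ≤ s) (hst : s ≤ t) (h : ¬ sim p s t)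
    {φ : Ed d → ℝ} (hφ : ContDiff ℝ (⊤ : ℕ∞) φ) (hsφ : HasCompactSupport φ) :
    IntervalIntegrable (lam G' τ p φ) volume s t := by
  have key : ∀ φ : Ed d → ℝ, ContDiff ℝ (⊤ : ℕ∞) φ → HasCompactSupport φ → ∫ x, φ x * p s x ≠ ∫ x, φ x * p t x →
      IntervalIntegrable (lam G' τ p φ) volume s t := by
    intro φ hφ hsφ hne
    by_contra hni
    have := F.pde φ hφ hsφ s t hs hst
    rw [intervalIntegral.integral_undef hni] at this
    exact hne (by linarith)
  unfold sim at h; push Not at h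
  obtain ⟨ψ, hψ, hsψ, hne⟩ := h
  by_cases h2 : ∫ x, φ x * p s x = ∫ x, φ x * p t x
  · have hi : ∀ u, 0 ≤ u → ∀ f : Ed d → ℝ, ContDiff ℝ (⊤ : ℕ∞) f → HasCompactSupport f → Integrable fun x => f x * p u x := fun u hu f hf hsf =>
      (GB.PG_mul (cs_pg hf.continuous hsf) (F.dn u hu).gb).integrable
    have h3 := key (fun y => φ y + ψ y) (hφ.add hψ) (hsφ.add hsψ) (by
      simp_rw [add_mul]
      rw [integral_add (hi s hs φ hφ hsφ) (hi s hs ψ hψ hsψ), integral_add (hi t (hs.trans hst) φ hφ hsφ) (hi t (hs.trans hst) ψ hψ hsψ), h2]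
      intro h; exact hne (by linarith))
    refine (h3.sub (key ψ hψ hsψ hne)).congr ?_
    intro u hu
    rw [uIoc_of_le hst] at hu
    have := lam_add H F hφ hsφ hψ hsψ (s := u) (by linarith [hu.1])
    simp only [this]; simp
  · exact key φ hφ hsφ h2

theorem sim_eq (F : Fl G' τ m a M b p) {s t : ℝ} (hs : 0 ≤ s) (ht : 0 ≤ t) (h : sim p s t) : p s =ᵐ[volume] p t := by
  refine ae_eq_of_integral_contDiff_smul_eq (F.dn s hs).gb.integrable.locallyIntegrable (F.dn t ht).gb.integrable.locallyIntegrable ?_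
  intro g hg hsg
  simpa using h g hg hsg

theorem lam_int (H : HF α L τ G G') (F : Fl G' τ m a M b p) {T : ℝ} (hT : 0 ≤ T) {φ : Ed d → ℝ} (hφ : ContDiff ℝ (⊤ : ℕ∞) φ) (hsφ : HasCompactSupport φ) :
    IntervalIntegrable (lam G' τ p φ) volume 0 T := by
  by_cases h1 : sim p 0 T
  · by_cases h2 : ∃ s ∈ Icc 0 T, ¬ sim p 0 s
    · obtain ⟨s, hs, hn⟩ := h2
      have hn' : ¬ sim p s T := by
        intro h; apply hn; intro f hf hsf
        rw [h1 f hf hsf, h f hf hsf]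
      exact (nsim_int H F le_rfl hs.1 hn hφ hsφ).trans (nsim_int H F hs.1 hs.2 hn' hφ hsφ)
    · push Not at h2
      refine (intervalIntegrable_const (c := lam G' τ p φ 0)).congr ?_
      intro s hs
      rw [uIoc_of_le hT] at hs
      have he := sim_eq F le_rfl hs.1.le (h2 s ⟨hs.1.le, hs.2⟩)
      have hw : wd (p 0) = wd (p s) := by
        unfold wd; apply withDensity_congr_ae
        filter_upwards [he] with x hx; rw [hx]
      simp only [lam, LL]
      rw [hw]
      apply integral_congr_ae
      filter_upwards [he] with x hx; rw [hx]
  · exact nsim_int H F le_rfl hT h1 hφ hsφ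

theorem lam_int' (H : HF α L τ G G') (F : Fl G' τ m a M b p) {s t : ℝ} (hs : 0 ≤ s) (ht : 0 ≤ t) {φ : Ed d → ℝ} (hφ : ContDiff ℝ (⊤ : ℕ∞) φ) (hsφ : HasCompactSupport φ) :
    IntervalIntegrable (lam G' τ p φ) volume s t :=
  (lam_int H F hs hφ hsφ).symm.trans (lam_int H F ht hφ hsφ)

/-- the mollified drift -/
def ldr {d : ℕ} (G' : Measure (Ed d) → Ed d → ℝ) (τ ε : ℝ) (p : ℝ → Ed d → ℝ) (s : ℝ) (x : Ed d) : ℝ :=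
  ll τ ε (p s) (db G' (wd (p s))) x

theorem ldr_eq (H : HF α L τ G G') (F : Fl G' τ m a M b p) (hε : 0 < ε) {s : ℝ} (hs : 0 ≤ s) (x : Ed d) :
    ldr G' τ ε p s x = ∫ y, (∑ i, (k1 ε i (x - y) * db G' (wd (p s)) i y + τ * k2 ε i (x - y))) * p s y := by
  have hp := F.dn s hs
  have hβ := fun i => H.db_pg hp.pd.isP2 i
  have i1 : ∀ i, Integrable fun y => k1 ε i (x - y) * (p s y * db G' (wd (p s)) i y) := fun i =>
    gb_cv_integrable_at (kk_gb1 hε i) (hp.gb.mul_PG (hβ i)).integrable x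
  have i2 : ∀ i, Integrable fun y => k2 ε i (x - y) * p s y := fun i =>
    gb_cv_integrable_at (kk_gb2 hε i) hp.gb.integrable x
  unfold ldr ll Cv
  simp_rw [← integral_const_mul]
  have e : ∀ i : Fin d, (∫ y, k1 ε i (x - y) * (p s y * db G' (wd (p s)) i y)) + ∫ y, τ * (k2 ε i (x - y) * p s y) =
      ∫ y, (k1 ε i (x - y) * (p s y * db G' (wd (p s)) i y) + τ * (k2 ε i (x - y) * p s y)) := fun i =>
    (integral_add (i1 i) ((i2 i).const_mul τ)).symm
  rw [Finset.sum_congr rfl fun i _ => e i, ← integral_finset_sum _ (fun i _ => iadd (i1 i) ((i2 i).const_mul τ))]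
  congr 1; ext y
  rw [Finset.sum_mul]
  exact Finset.sum_congr rfl fun i _ => by ring

theorem tst_lam (H : HF α L τ G G') (hm : 0 < m) (ha : 0 < a) (hM : 0 < M) (hb : 0 < b) (F : Fl G' τ m a M b p) (hε : 0 < ε) {χ : Ed d → ℝ} (hχ : ContDiff ℝ (⊤ : ℕ∞) χ) (hsχ : HasCompactSupport χ)
    (h0 : χ 0 = 1) : ∃ K, 0 ≤ K ∧ (∀ c, 0 ≤ c → c ≤ 1 → ∀ x s, 0 ≤ s → |lam G' τ p (tst χ c ε x) s| ≤ K) ∧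
      (∀ c : ℕ → ℝ, (∀ n, 0 ≤ c n) → (∀ n, c n ≤ 1) → Tendsto c atTop (𝓝 0) → ∀ x s, 0 ≤ s → Tendsto (fun n => lam G' τ p (tst χ (c n) ε x) s) atTop (𝓝 (ldr G' τ ε p s x))) := by
  obtain ⟨K0, hK0, hK⟩ := tst_bound (d := d) hε hχ hsχ
  obtain ⟨B, hB, hBm⟩ := om_mom (d := d) (m := m) (a := a) hb hM
  have hτ := H.hτ
  set A := (1 + (2 * α ^ 2 + 2 * L ^ 2)) with hA
  have hA0 : 0 ≤ A := by positivity
  have hbd : ∀ c, 0 ≤ c → c ≤ 1 → ∀ x s, 0 ≤ s → ∀ y, |EE τ (db G' (wd (p s))) (tst χ c ε x) y * p s y| ≤ d * (K0 * A + τ * K0) * (om y * p s y) := by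
    intro c hc0 hc1 x s hs y
    have hp := F.dn s hs
    rw [abs_mul, abs_of_pos (hp.pos y), ← mul_assoc]
    have hpp := hp.pos y
    gcongr
    unfold EE
    refine (Finset.abs_sum_le_sum_abs _ _).trans ?_
    calc _ ≤ ∑ i : Fin d, (K0 * A + τ * K0) * om y := by
          refine Finset.sum_le_sum fun i _ => ?_
          obtain ⟨u1, u2⟩ := hK c hc0 hc1 x i y
          have u3 := H.db_om hp.pd.isP2 i y
          have h1 := one_le_om y
          calc _ ≤ |-(pd i (tst χ c ε x) y) * db G' (wd (p s)) i y| + |τ * pd i (pd i (tst χ c ε x)) y| := abs_add_le _ _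
            _ = |pd i (tst χ c ε x) y| * |db G' (wd (p s)) i y| + τ * |pd i (pd i (tst χ c ε x)) y| := by
              rw [abs_mul, abs_mul, abs_neg, abs_of_pos hτ]
            _ ≤ K0 * (A * om y) + τ * (K0 * 1) := by rw [mul_one]; gcongr
            _ ≤ K0 * (A * om y) + τ * (K0 * om y) := by gcongr
            _ = _ := by ring
      _ = _ := by simp; ring
  have hi : ∀ s, 0 ≤ s → Integrable fun y => d * (K0 * A + τ * K0) * (om y * p s y) := fun s hs => (F.dn s hs).pd.int_om.const_mul _
  refine ⟨d * (K0 * A + τ * K0) * B, by positivity, fun c hc0 hc1 x s hs => ?_, fun c hc0 hc1 hc x s hs => ?_⟩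
  · refine (abs_int_le (hi s hs) (hbd c hc0 hc1 x s hs)).trans ?_
    rw [integral_const_mul]
    gcongr
    exact hBm _ (F.dn s hs)
  · rw [ldr_eq H F hε hs]
    have hp := F.dn s hs
    have hβ := fun i => H.db_pg hp.pd.isP2 i
    refine tendsto_integral_of_dominated_convergence _ (fun n => ?_) (hi s hs) (fun n => Eventually.of_forall fun y => hbd (c n) (hc0 n) (hc1 n) x s hs y) (Eventually.of_forall fun y => ?_)
    · refine (Measurable.mul ?_ hp.meas).aestronglyMeasurable
      unfold EE
      have h1 := fun i => (pd_contDiff (tst_smooth (ε := ε) hχ (c n) x) i)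
      refine Finset.measurable_sum _ fun i _ => ?_
      exact ((h1 i).continuous.measurable.neg.mul (hβ i).1).add ((pd_contDiff (h1 i) i).continuous.measurable.const_mul τ)
    · refine Tendsto.mul_const _ ?_
      unfold EE
      refine tendsto_finset_sum _ fun i _ => ?_
      have h1 := ((tst_lim1 (ε := ε) hχ h0 hc x i y).neg.mul_const (db G' (wd (p s)) i y)).add ((tst_lim2 (ε := ε) hχ h0 hc x i y).const_mul τ)
      simpa using h1

theorem exists_cutoff (d : ℕ) : ∃ χ : Ed d → ℝ, ContDiff ℝ (⊤ : ℕ∞) χ ∧ HasCompactSupport χ ∧ χ 0 = 1 := by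
  let f : ContDiffBump (0 : Ed d) := ⟨1, 2, one_pos, one_lt_two⟩
  exact ⟨f, f.contDiff, f.hasCompactSupport, f.one_of_mem_closedBall (by simp [f])⟩

theorem moll_pde (H : HF α L τ G G') (hm : 0 < m) (ha : 0 < a) (hM : 0 < M) (hb : 0 < b) (F : Fl G' τ m a M b p) (hε : 0 < ε)
    {s t : ℝ} (hs : 0 ≤ s) (hst : s ≤ t) (x : Ed d) :
    IntervalIntegrable (fun u => ldr G' τ ε p u x) volume s t ∧
    Cv (kk ε) (p t) x - Cv (kk ε) (p s) x = ∫ u in s..t, ldr G' τ ε p u x := by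
  obtain ⟨χ, hχ, hsχ, h0⟩ := exists_cutoff d
  obtain ⟨K, hK0, hK, hlim⟩ := tst_lam H hm ha hM hb F hε hχ hsχ h0
  set c : ℕ → ℝ := fun n => 1 / ((n:ℝ) + 1) with hc
  have hc0 : ∀ n, 0 < c n := fun n => by simp only [hc]; positivity
  have hc1 : ∀ n, c n ≤ 1 := fun n => by simp only [hc]; rw [div_le_one (by positivity)]; linarith [(n.cast_nonneg : (0:ℝ) ≤ n)]
  have hct : Tendsto c atTop (𝓝 0) := tendsto_one_div_add_atTop_nhds_zero_nat
  have hl := hlim c (fun n => (hc0 n).le) hc1 hct x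
  have hii : ∀ n, IntervalIntegrable (lam G' τ p (tst χ (c n) ε x)) volume s t := fun n =>
    lam_int' H F hs (hs.trans hst) (tst_smooth hχ _ _) (tst_supp hsχ (hc0 n).ne' x)
  have hmem : ∀ u ∈ uIoc s t, 0 ≤ u := fun u hu => by rw [uIoc_of_le hst] at hu; linarith [hu.1]
  have hmeas : AEStronglyMeasurable (fun u => ldr G' τ ε p u x) (volume.restrict (uIoc s t)) := by
    refine aestronglyMeasurable_of_tendsto_ae atTop (f := fun n => lam G' τ p (tst χ (c n) ε x)) (fun n => ?_) ?_
    · exact (intervalIntegrable_iff.1 (hii n)).aestronglyMeasurable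
    · refine (ae_restrict_iff' measurableSet_uIoc).2 (Eventually.of_forall fun u hu => hl u (hmem u hu))
  have hbd : ∀ u ∈ uIoc s t, |ldr G' τ ε p u x| ≤ K := fun u hu =>
    le_of_tendsto (hl u (hmem u hu)).abs (Eventually.of_forall fun n => hK _ (hc0 n).le (hc1 n) x u (hmem u hu))
  have hI : IntervalIntegrable (fun u => ldr G' τ ε p u x) volume s t := by
    rw [intervalIntegrable_iff]
    refine Integrable.mono' (g := fun _ => K) (by rw [integrable_const_iff]; right; constructor; rw [Measure.restrict_apply_univ, uIoc_of_le hst]; simp) hmeas ?_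
    exact (ae_restrict_iff' measurableSet_uIoc).2 (Eventually.of_forall fun u hu => hbd u hu)
  refine ⟨hI, ?_⟩
  have hT : Tendsto (fun n => ∫ u in s..t, lam G' τ p (tst χ (c n) ε x) u) atTop (𝓝 (∫ u in s..t, ldr G' τ ε p u x)) := by
    refine intervalIntegral.tendsto_integral_filter_of_dominated_convergence (fun _ => K) (Eventually.of_forall fun n => ?_) (Eventually.of_forall fun n => ?_) intervalIntegrable_const ?_
    · exact (intervalIntegrable_iff.1 (hii n)).aestronglyMeasurable
    · exact Eventually.of_forall fun u hu => hK _ (hc0 n).le (hc1 n) x u (hmem u hu)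
    · exact Eventually.of_forall fun u hu => hl u (hmem u hu)
  have hS : ∀ u, 0 ≤ u → Tendsto (fun n => ∫ y, tst χ (c n) ε x y * p u y) atTop (𝓝 (Cv (kk ε) (p u) x)) := by
    intro u hu
    have hp := F.dn u hu
    obtain ⟨B0, hB0, hB0'⟩ := bdd_of_cs hχ.continuous hsχ
    have hi : Integrable fun y => B0 * (kk ε (x - y) * p u y) := (gb_cv_integrable_at (GB.kk_gb hε) hp.gb.integrable x).const_mul B0
    unfold Cv
    refine tendsto_integral_of_dominated_convergence _ (fun n => ?_) hi (fun n => Eventually.of_forall fun y => ?_) (Eventually.of_forall fun y => ?_)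
    · exact ((tst_smooth hχ (c n) x).continuous.measurable.mul hp.meas).aestronglyMeasurable
    · simp only [tst]
      have h1 := hB0' (c n • y)
      have h2 := kk_pos hε (x - y)
      have h3 := hp.pos y
      rw [mul_assoc, norm_mul, Real.norm_eq_abs, Real.norm_of_nonneg (by positivity)]
      gcongr
    · refine Tendsto.mul_const _ ?_
      simp only [tst]
      have : Continuous fun c : ℝ => χ (c • y) * kk ε (x - y) := by have := hχ.continuous; fun_prop
      have := (this.tendsto 0).comp hct
      simpa [h0, Function.comp_def] using this
  refine tendsto_nhds_unique ((hS t (hs.trans hst)).sub (hS s hs)) ?_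
  refine hT.congr fun n => ?_
  rw [F.pde _ (tst_smooth hχ _ _) (tst_supp hsχ (hc0 n).ne' x) s t hs hst]
end D2
end ModD2

section ModD3
section D3
open Filter Topology
variable {d : ℕ} {m a M b ε : ℝ}
variable {α L τ : ℝ} {G : Measure (Ed d) → ℝ} {G' : Measure (Ed d) → Ed d → ℝ} {p : ℝ → Ed d → ℝ}

/-- uniform Gaussian bound of the drift flux -/
theorem pb_unif (H : HF α L τ G G') (hM : 0 < M) (hb : 0 < b) (F : Fl G' τ m a M b p) :
    ∃ C, 0 ≤ C ∧ ∀ s, 0 ≤ s → ∀ i x, |p s x * db G' (wd (p s)) i x| ≤ C * kk (b + 1) x := by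
  obtain ⟨C, hC, hC'⟩ := om_kk (d := d) 1 hb (show b < b + 1 by linarith)
  have hA0 : 0 ≤ (1 + (2 * α ^ 2 + 2 * L ^ 2)) := by positivity
  refine ⟨M * (1 + (2 * α ^ 2 + 2 * L ^ 2)) * C, by positivity, fun s hs i x => ?_⟩
  have hp := F.dn s hs
  rw [abs_mul, abs_of_pos (hp.pos x)]
  have h1 := hp.ub x
  have h2 := H.db_om hp.pd.isP2 i x
  have h3 := hC' x
  have h4 := (hp.pos x).le
  have h5 := (kk_pos hb x).le
  have h6 := (om_pos x).le
  calc _ ≤ (M * kk b x) * ((1 + (2 * α ^ 2 + 2 * L ^ 2)) * om x) := by gcongr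
    _ = M * (1 + (2 * α ^ 2 + 2 * L ^ 2)) * (om x ^ 1 * kk b x) := by ring
    _ ≤ M * (1 + (2 * α ^ 2 + 2 * L ^ 2)) * (C * kk (b + 1) x) := by gcongr
    _ = _ := by ring

theorem ldr_unif (H : HF α L τ G G') (hM : 0 < M) (hb : 0 < b) (F : Fl G' τ m a M b p) (hε : 0 < ε) :
    ∃ Γ : Ed d → ℝ, GB Γ ∧ ∀ s, 0 ≤ s → ∀ x, |ldr G' τ ε p s x| ≤ Γ x := by
  obtain ⟨C, hC, hCb⟩ := pb_unif H hM hb F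
  have hτ := H.hτ
  choose C1 s1 hC1 hs1 h1 using fun i : Fin d => (kk_gb1 (d := d) hε i).2
  choose C2 s2 hC2 hs2 h2 using fun i : Fin d => (kk_gb2 (d := d) hε i).2
  refine ⟨fun x => ∑ i, (C1 i * C * kk (s1 i + (b + 1)) x + τ * (C2 i * M * kk (s2 i + b) x)), ?_, fun s hs x => ?_⟩
  · refine GB.sum _ fun i _ => ?_
    exact ((GB.kk_gb (by have := hs1 i; positivity)).const_mul _).add (((GB.kk_gb (by have := hs2 i; positivity)).const_mul _).const_mul τ)
  · have hp := F.dn s hs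
    have hβ := fun i => H.db_pg hp.pd.isP2 i
    unfold ldr ll
    refine (Finset.abs_sum_le_sum_abs _ _).trans (Finset.sum_le_sum fun i _ => ?_)
    refine (abs_add_le _ _).trans ?_
    rw [abs_mul τ, abs_of_pos hτ]
    gcongr
    · exact cv_bound (kk_gb1 hε i).meas (hp.meas.mul (hβ i).1) (hs1 i) (by linarith) (h1 i) (fun y => hCb s hs i y) x
    · exact cv_bound (kk_gb2 hε i).meas hp.meas (hs2 i) hb (h2 i) (fun y => by rw [abs_of_pos (hp.pos y)]; exact hp.ub y) x

theorem ldr_lip (H : HF α L τ G G') (hM : 0 < M) (hb : 0 < b) (F : Fl G' τ m a M b p) (hε : 0 < ε) :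
    ∃ D, 0 ≤ D ∧ ∀ s, 0 ≤ s → ∀ x y, |ldr G' τ ε p s x - ldr G' τ ε p s y| ≤ D * ‖x - y‖ := by
  obtain ⟨C, hC, hCb⟩ := pb_unif H hM hb F
  have hτ := H.hτ
  choose B1 hB1 h1 using fun i : Fin d => (kk_gb1 (d := d) hε i).bdd
  choose B2 hB2 h2 using fun i : Fin d => (kk_gb2 (d := d) hε i).bdd
  choose D1 hD1 g1 using fun i : Fin d => (norm_k1D_gb (d := d) hε i).bdd
  choose D2 hD2 g2 using fun i : Fin d => (norm_k2D_gb (d := d) hε i).bdd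
  refine ⟨∑ i, (D1 i * C + τ * D2 i), Finset.sum_nonneg fun i _ => by have := hD1 i; have := hD2 i; positivity, fun s hs x y => ?_⟩
  have hp := F.dn s hs
  have hβ := fun i => H.db_pg hp.pd.isP2 i
  unfold ldr ll
  rw [← Finset.sum_sub_distrib, Finset.sum_mul]
  refine (Finset.abs_sum_le_sum_abs _ _).trans (Finset.sum_le_sum fun i _ => ?_)
  have e1 := cv_lipschitz (kk_gb1 hε i).meas (h1 i) (lip_of_D (k1_hasFDerivAt i) fun x => (le_abs_self _).trans (g1 i x)) (hp.gb.mul_PG (hβ i)).integrable x y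
  have e2 := cv_lipschitz (kk_gb2 hε i).meas (h2 i) (lip_of_D (k2_hasFDerivAt i) fun x => (le_abs_self _).trans (g2 i x)) hp.gb.integrable x y
  have e3 : ∫ y, |p s y * db G' (wd (p s)) i y| ≤ C := by
    refine (integral_mono (hp.gb.mul_PG (hβ i)).abs.integrable ((kk_int (by linarith : 0 < b + 1)).const_mul C) fun y => hCb s hs i y).trans ?_
    rw [integral_const_mul, kk_integral (by linarith), mul_one]
  have e4 : ∫ y, |p s y| = 1 := by
    rw [← hp.mass]; congr 1; ext y; exact abs_of_pos (hp.pos y)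
  rw [e4] at e2
  have := hD1 i
  have e5 : D1 i * ‖x - y‖ * (∫ y, |p s y * db G' (wd (p s)) i y|) ≤ D1 i * ‖x - y‖ * C := by gcongr
  calc _ = |(Cv (k1 ε i) (fun y => p s y * db G' (wd (p s)) i y) x - Cv (k1 ε i) (fun y => p s y * db G' (wd (p s)) i y) y)
          + τ * (Cv (k2 ε i) (p s) x - Cv (k2 ε i) (p s) y)| := by congr 1; ring
    _ ≤ |Cv (k1 ε i) (fun y => p s y * db G' (wd (p s)) i y) x - Cv (k1 ε i) (fun y => p s y * db G' (wd (p s)) i y) y|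
          + τ * |Cv (k2 ε i) (p s) x - Cv (k2 ε i) (p s) y| := by
        refine (abs_add_le _ _).trans ?_; rw [abs_mul τ, abs_of_pos hτ]
    _ ≤ D1 i * ‖x - y‖ * C + τ * (D2 i * ‖x - y‖ * 1) := by gcongr; linarith
    _ = _ := by ring

theorem q_lip (H : HF α L τ G G') (hm : 0 < m) (ha : 0 < a) (hM : 0 < M) (hb : 0 < b) (F : Fl G' τ m a M b p) (hε : 0 < ε)
    {Γ : Ed d → ℝ} (hΓ : ∀ s, 0 ≤ s → ∀ x, |ldr G' τ ε p s x| ≤ Γ x) {s t : ℝ} (hs : 0 ≤ s) (ht : 0 ≤ t) (x : Ed d) :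
    |Cv (kk ε) (p t) x - Cv (kk ε) (p s) x| ≤ Γ x * |t - s| := by
  wlog hst : s ≤ t generalizing s t
  · rw [abs_sub_comm, abs_sub_comm t s]; exact this ht hs (by linarith)
  rw [(moll_pde H hm ha hM hb F hε hs hst x).2, ← Real.norm_eq_abs]
  refine intervalIntegral.norm_integral_le_of_norm_le_const fun u hu => ?_
  rw [uIoc_of_le hst] at hu
  exact hΓ u (by linarith [hu.1]) x

/-- the mollified energy -/
def en {d : ℕ} (G : Measure (Ed d) → ℝ) (τ ε : ℝ) (p : ℝ → Ed d → ℝ) (t : ℝ) : ℝ := Fr G τ (Cv (kk ε) (p t))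

theorem en_lip (H : HF α L τ G G') (hm : 0 < m) (ha : 0 < a) (hM : 0 < M) (hb : 0 < b) (F : Fl G' τ m a M b p) (hε : 0 < ε) (hε1 : ε ≤ 1) :
    ∃ K : ℝ≥0, LipschitzOnWith K (en G τ ε p) (Ici 0) := by
  obtain ⟨Γ, hΓg, hΓ⟩ := ldr_unif H hM hb F hε
  have d0 := q_Dn (F.dn 0 le_rfl) hε hε1
  obtain ⟨A, hA, hAb⟩ := F_lip (d := d) H d0.hm d0.ha d0.hM d0.hb
  have hi : Integrable fun x => om x * Γ x := (GB.PG_mul PG.om_pg hΓg).integrable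
  have hI0 : 0 ≤ ∫ x, om x * Γ x := integral_nonneg fun x => mul_nonneg (om_pos x).le ((abs_nonneg _).trans (hΓ 0 le_rfl x))
  refine ⟨Real.toNNReal (A * ∫ x, om x * Γ x), LipschitzOnWith.of_dist_le_mul fun t ht s hs => ?_⟩
  simp only [mem_Ici] at ht hs
  rw [Real.dist_eq, Real.dist_eq]
  refine (hAb _ _ (q_Dn (F.dn t ht) hε hε1) (q_Dn (F.dn s hs) hε hε1)).trans ?_
  have hgb := (P_gb hε (F.dn t ht).gb).sub (P_gb hε (F.dn s hs).gb)
  have : ∫ x, om x * |Cv (kk ε) (p t) x - Cv (kk ε) (p s) x| ≤ (∫ x, om x * Γ x) * |t - s| := by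
    rw [← integral_mul_const]
    refine integral_mono (GB.PG_mul PG.om_pg hgb.abs).integrable (hi.mul_const _) fun x => ?_
    have := q_lip H hm ha hM hb F hε hΓ hs ht x
    have h0 := (om_pos x).le
    simp only
    rw [mul_assoc]; gcongr
  calc _ ≤ A * ((∫ x, om x * Γ x) * |t - s|) := by gcongr
    _ = _ := by rw [Real.coe_toNNReal _ (by positivity)]; ring
end D3
end ModD3

section ModD4
section D4
open Filter Topology
variable {d : ℕ} {m a M b ε : ℝ}
variable {α L τ : ℝ} {G : Measure (Ed d) → ℝ} {G' : Measure (Ed d) → Ed d → ℝ} {p : ℝ → Ed d → ℝ}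

def hs (t : ℝ) (n : ℕ) : ℝ := t / ((n:ℝ) + 2)

theorem hs_pos {t : ℝ} (ht : 0 < t) (n : ℕ) : 0 < hs t n := by unfold hs; positivity
theorem hs_lt {t : ℝ} (ht : 0 < t) (n : ℕ) : hs t n < t := by
  unfold hs; rw [div_lt_iff₀ (by positivity)]; nlinarith [(n.cast_nonneg : (0:ℝ) ≤ n)]
theorem hs_tend (t : ℝ) : Tendsto (hs t) atTop (𝓝 0) := by
  unfold hs
  exact tendsto_const_nhds.div_atTop (tendsto_atTop_add_const_right _ _ tendsto_natCast_atTop_atTop)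

theorem left_quot {g : ℝ → ℝ} {g' t : ℝ} (ht : 0 < t) (h : HasDerivAt g g' t) :
    Tendsto (fun n => (g t - g (t - hs t n)) / hs t n) atTop (𝓝 g') := by
  have h1 := h.tendsto_slope
  have h2 : Tendsto (fun n => t - hs t n) atTop (𝓝[≠] t) := by
    rw [tendsto_nhdsWithin_iff]
    refine ⟨by simpa using (tendsto_const_nhds (x := t)).sub (hs_tend t), Eventually.of_forall fun n => ?_⟩
    have := hs_pos ht n
    simp only [mem_compl_iff, mem_singleton_iff]; intro h; linarith
  refine (h1.comp h2).congr fun n => ?_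
  have := (hs_pos ht n).ne'
  simp only [Function.comp, slope_def_field]
  rw [show t - hs t n - t = - hs t n by ring, div_neg, ← neg_div]; congr 1; ring

theorem q_deriv (H : HF α L τ G G') (hm : 0 < m) (ha : 0 < a) (hM : 0 < M) (hb : 0 < b) (F : Fl G' τ m a M b p) (hε : 0 < ε)
    {T : ℝ} (hT : 0 < T) : ∀ᵐ t, t ∈ Ioo 0 T → ∀ x,
      Tendsto (fun n => (Cv (kk ε) (p t) x - Cv (kk ε) (p (t - hs t n)) x) / hs t n) atTop (𝓝 (ldr G' τ ε p t x)) := by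
  obtain ⟨S, hSc, hSd⟩ := TopologicalSpace.exists_countable_dense (Ed d)
  obtain ⟨D, hD0, hD⟩ := ldr_lip H hM hb F hε
  have h1 : ∀ᵐ t, ∀ x ∈ S, t ∈ uIcc 0 T → ∀ c ∈ uIcc 0 T, HasDerivAt (fun t => ∫ u in c..t, ldr G' τ ε p u x) (ldr G' τ ε p t x) t := by
    rw [ae_ball_iff hSc]
    intro x hx
    exact IntervalIntegrable.ae_hasDerivAt_integral (moll_pde H hm ha hM hb F hε le_rfl hT.le x).1
  filter_upwards [h1] with t ht htT x
  have ht0 := htT.1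
  have hpd : ∀ n x, Cv (kk ε) (p t) x - Cv (kk ε) (p (t - hs t n)) x = ∫ u in (t - hs t n)..t, ldr G' τ ε p u x := fun n x =>
    (moll_pde H hm ha hM hb F hε (by linarith [hs_lt ht0 n]) (by linarith [hs_pos ht0 n]) x).2
  have hS : ∀ x ∈ S, Tendsto (fun n => (Cv (kk ε) (p t) x - Cv (kk ε) (p (t - hs t n)) x) / hs t n) atTop (𝓝 (ldr G' τ ε p t x)) := by
    intro x hx
    have := left_quot ht0 (ht x hx (by rw [uIcc_of_le hT.le]; exact ⟨ht0.le, htT.2.le⟩) 0 left_mem_uIcc)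
    refine this.congr fun n => ?_
    have e1 := (moll_pde H hm ha hM hb F hε le_rfl ht0.le x).2
    have e2 := (moll_pde H hm ha hM hb F hε le_rfl (show (0:ℝ) ≤ t - hs t n by linarith [hs_lt ht0 n]) x).2
    rw [← e1, ← e2]; congr 1; ring
  have hq : ∀ n x y, |(Cv (kk ε) (p t) x - Cv (kk ε) (p (t - hs t n)) x) / hs t n - (Cv (kk ε) (p t) y - Cv (kk ε) (p (t - hs t n)) y) / hs t n| ≤ D * ‖x - y‖ := by
    intro n x y
    have hh := hs_pos ht0 n
    have hle : t - hs t n ≤ t := by linarith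
    have h0 : 0 ≤ t - hs t n := by linarith [hs_lt ht0 n]
    rw [← sub_div, abs_div, abs_of_pos hh, div_le_iff₀ hh, hpd, hpd,
      ← intervalIntegral.integral_sub (moll_pde H hm ha hM hb F hε h0 hle x).1 (moll_pde H hm ha hM hb F hε h0 hle y).1, ← Real.norm_eq_abs]
    refine (intervalIntegral.norm_integral_le_of_norm_le_const (C := D * ‖x - y‖) fun u hu => ?_).trans ?_
    · rw [uIoc_of_le hle] at hu
      exact hD u (by linarith [hu.1]) x y
    · rw [show t - (t - hs t n) = hs t n by ring, abs_of_pos hh]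
  rw [Metric.tendsto_atTop]
  intro η hη
  obtain ⟨y, hy, hyS⟩ := Metric.dense_iff.1 hSd x (η / (3 * (D + 1))) (by positivity)
  have hy' : D * ‖x - y‖ ≤ η / 3 := by
    rw [Metric.mem_ball, dist_eq_norm, norm_sub_rev] at hy
    calc D * ‖x - y‖ ≤ (D + 1) * (η / (3 * (D + 1))) := by gcongr; linarith
      _ = η / 3 := by field_simp
  obtain ⟨N, hN⟩ := Metric.tendsto_atTop.1 (hS y hyS) (η / 3) (by positivity)
  refine ⟨N, fun n hn => ?_⟩
  have h3 := hN n hn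
  have h4 := hq n x y
  have h5 := hD t ht0.le x y
  rw [Real.dist_eq, abs_lt] at *
  rw [abs_le] at h4 h5
  constructor <;> linarith [h3.1, h3.2, h4.1, h4.2, h5.1, h5.2]

theorem en_deriv (H : HF α L τ G G') (hm : 0 < m) (ha : 0 < a) (hM : 0 < M) (hb : 0 < b) (F : Fl G' τ m a M b p) (hε : 0 < ε) (hε1 : ε ≤ 1)
    {T : ℝ} (hT : 0 < T) : ∀ᵐ t, t ∈ Ioo 0 T → ∀ e', HasDerivAt (en G τ ε p) e' t → e' ≤ Le G' τ ε (p t) := by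
  obtain ⟨Γ, hΓg, hΓ⟩ := ldr_unif H hM hb F hε
  filter_upwards [q_deriv H hm ha hM hb F hε hT] with t ht htT e' he
  have ht0 := htT.1
  have hq := q_Dn (F.dn t ht0.le) hε hε1
  have hu : ∀ n, 0 ≤ t - hs t n := fun n => by linarith [hs_lt ht0 n]
  have hqn := fun n => q_Dn (F.dn _ (hu n)) hε hε1
  have hfp := H.ff_pg hq
  have hlim : Tendsto (fun n => ∫ x, ff G' τ (Cv (kk ε) (p t)) x * ((Cv (kk ε) (p t) x - Cv (kk ε) (p (t - hs t n)) x) / hs t n)) atTop (𝓝 (Le G' τ ε (p t))) := by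
    unfold Le
    refine tendsto_integral_of_dominated_convergence (fun x => |ff G' τ (Cv (kk ε) (p t)) x| * Γ x) (fun n => ?_) (GB.PG_mul hfp.abs hΓg).integrable (fun n => Eventually.of_forall fun x => ?_) (Eventually.of_forall fun x => ?_)
    · exact (hfp.1.mul ((hq.meas.sub (hqn n).meas).div_const _)).aestronglyMeasurable
    · have hh := hs_pos ht0 n
      rw [norm_mul, Real.norm_eq_abs, Real.norm_eq_abs, abs_div, abs_of_pos hh]
      gcongr
      rw [div_le_iff₀ hh]
      have := q_lip H hm ha hM hb F hε hΓ (hu n) ht0.le x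
      rwa [show t - (t - hs t n) = hs t n by ring, abs_of_pos hh] at this
    · exact (ht htT x).const_mul _
  refine le_of_tendsto_of_tendsto' (left_quot ht0 he) hlim fun n => ?_
  have hh := hs_pos ht0 n
  rw [div_le_iff₀ hh, ← integral_mul_const]
  have h1 := tangent H hq (hqn n).pd (hqn n).ent_int
  have h2 : ∫ x, ff G' τ (Cv (kk ε) (p t)) x * ((Cv (kk ε) (p t) x - Cv (kk ε) (p (t - hs t n)) x) / hs t n) * hs t n
      = - ∫ x, ff G' τ (Cv (kk ε) (p t)) x * (Cv (kk ε) (p (t - hs t n)) x - Cv (kk ε) (p t) x) := by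
    rw [← integral_neg]; congr 1; ext x
    field_simp; ring
  rw [h2]; unfold en; linarith
end D4
end ModD4

section ModD5
section D5
open Filter Topology
variable {d : ℕ} {m a M b ε : ℝ}
variable {α L τ : ℝ} {G : Measure (Ed d) → ℝ} {G' : Measure (Ed d) → Ed d → ℝ}

/-- limiting form of the dissipation bound -/
theorem ev_Le (H : HF α L τ G G') {p : Ed d → ℝ} (hp : Dn m a M b p) (hab : b < 2 * a) {ε : ℕ → ℝ} (hε : ∀ n, 0 < ε n) (hε1 : ∀ n, ε n ≤ 1)
    (hε0 : Tendsto ε atTop (𝓝 0)) (hanti : StrictAnti ε)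
    {r : Ed d → ℝ} {M' : ℝ} (hMM : M ≤ M') (hrm : Measurable r) (hr0 : ∀ x, 0 ≤ r x) (hru : ∀ x, r x ≤ M' * kk b x) (hr1 : ∫ x, r x = 1)
    {A0 Δ : ℝ} (hΔ0 : 0 ≤ Δ) (hΔ : Δ ≤ ∫ x, ff G' τ p x * (p x - r x)) (hA : π ^ 2 * a * M' ^ 2 * JC d a b * A0 < 8 * m * Δ ^ 2) :
    ∀ᶠ n in atTop, Le G' τ (ε n) p ≤ - A0 := by
  by_contra hc
  have hf : ∃ᶠ n in atTop, - A0 ≤ Le G' τ (ε n) p := by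
    refine (Filter.not_eventually.1 hc).mono fun n hn => ?_
    exact (not_le.1 hn).le
  obtain ⟨φ, hφ, hφ'⟩ := extraction_of_frequently_atTop hf
  have h := claim2 H hp hab (ε := ε ∘ φ) (fun n => hε _) (fun n => hε1 _) (hε0.comp hφ.tendsto_atTop)
    (hanti.comp_strictMono hφ) hφ' hMM hrm hr0 hru hr1
  have h2 : Δ ^ 2 ≤ (∫ x, ff G' τ p x * (p x - r x)) ^ 2 := by gcongr
  have h3 : 8 * m * Δ ^ 2 ≤ 8 * m * (∫ x, ff G' τ p x * (p x - r x)) ^ 2 := by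
    have := hp.hm
    gcongr
  linarith

theorem Le_unif (H : HF α L τ G G') (hm : 0 < m) (ha : 0 < a) (hM : 0 < M) (hb : 0 < b) :
    ∃ W, 0 ≤ W ∧ ∀ (p : Ed d → ℝ) (ε : ℝ), Dn m a M b p → 0 < ε → ε ≤ 1 → Le G' τ ε p ≤ W := by
  obtain ⟨W, hW, h⟩ := ww_unif (d := d) hm ha hM hb (B := 2 * α ^ 2 + 2 * L ^ 2) (by positivity)
  refine ⟨3 * ∑ i : Fin d, (W + 4 * L ^ 2), by positivity, fun p ε hp hε hε1 => ?_⟩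
  have h1 := claim1 H hp hε hε1
  have h2 : 0 ≤ ∑ i, ∫ x, Cv (kk ε) p x * XX τ ε p (db G' (wd p)) i x ^ 2 :=
    Finset.sum_nonneg fun i _ => integral_nonneg fun x => mul_nonneg (q_pos hp hε x).le (sq_nonneg _)
  have h3 : ∑ i, ((∫ x, ww ε p (db G' (wd p) i) x) + 4 * L ^ 2) ≤ ∑ i : Fin d, (W + 4 * L ^ 2) := by
    refine Finset.sum_le_sum fun i _ => ?_
    have := h p (db G' (wd p) i) ε hp (H.db_pg hp.pd.isP2 i) (H.db_sq hp.pd.isP2 i) hε hε1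
    linarith
  linarith

theorem calc_step {f l : ℕ → ℝ → ℝ} {t1 t2 e1 e2 A W : ℝ} (ht : t1 ≤ t2) (hA : 0 ≤ A)
    (hf : ∀ n, ∃ K : ℝ≥0, LipschitzOnWith K (f n) (Icc t1 t2))
    (h1 : Tendsto (fun n => f n t1) atTop (𝓝 e1)) (h2 : Tendsto (fun n => f n t2) atTop (𝓝 e2))
    (hd : ∀ n, ∀ᵐ t, t ∈ Ioo t1 t2 → ∀ e', HasDerivAt (f n) e' t → e' ≤ l n t) (hW0 : 0 ≤ W)
    (hW : ∀ n, ∀ t ∈ Ioo t1 t2, l n t ≤ W) (hev : ∀ t ∈ Ioo t1 t2, ∀ᶠ n in atTop, l n t ≤ -A) :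
    e2 - e1 ≤ - A * (t2 - t1) := by
  have hac : ∀ n, AbsolutelyContinuousOnInterval (f n) t1 t2 := fun n => by
    obtain ⟨K, hK⟩ := hf n
    refine LipschitzOnWith.absolutelyContinuousOnInterval (K := K) ?_
    rwa [uIcc_of_le ht]
  have hdiff : ∀ n, ∀ᵐ t, t ∈ Ioo t1 t2 → deriv (f n) t ≤ l n t := fun n => by
    filter_upwards [hd n, (hac n).ae_differentiableAt] with t h h' htt
    refine h htt _ (h' ?_).hasDerivAt
    rw [uIcc_of_le ht]; exact Ioo_subset_Icc_self htt
  have hall := ae_all_iff.2 hdiff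
  set h : ℕ → ℝ → ℝ := fun n t => max (deriv (f n) t + A) 0 with hh
  have hhm : ∀ n, Measurable (h n) := fun n => ((measurable_deriv (f n)).add_const A).max measurable_const
  have hbd : ∀ n, ∀ᵐ t ∂(volume.restrict (Ioo t1 t2)), ‖h n t‖ ≤ W + A := fun n => by
    filter_upwards [(ae_restrict_iff' measurableSet_Ioo).2 (hdiff n), ae_restrict_mem measurableSet_Ioo] with t h1 h2
    rw [Real.norm_eq_abs, abs_of_nonneg (le_max_right _ _)]
    exact max_le (by linarith [hW n t h2]) (by positivity)
  have hint : ∀ n, Integrable (h n) (volume.restrict (Ioo t1 t2)) := fun n =>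
    Integrable.of_bound (hhm n).aestronglyMeasurable (W + A) (hbd n)
  have hT : Tendsto (fun n => ∫ t in Ioo t1 t2, h n t) atTop (𝓝 (∫ t in Ioo t1 t2, (0:ℝ))) := by
    refine tendsto_integral_of_dominated_convergence (fun _ => W + A) (fun n => (hhm n).aestronglyMeasurable)
      (integrable_const _) hbd ?_
    filter_upwards [ae_restrict_of_ae hall, ae_restrict_mem measurableSet_Ioo] with t h1 h2
    refine tendsto_const_nhds.congr' ?_
    filter_upwards [hev t h2] with n hn
    exact (max_eq_right (by linarith [h1 n h2])).symm
  rw [integral_zero] at hT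
  have hle : ∀ n, f n t2 - f n t1 ≤ (∫ t in Ioo t1 t2, h n t) - A * (t2 - t1) := fun n => by
    rw [← (hac n).integral_deriv_eq_sub, intervalIntegral.integral_of_le ht, integral_Ioc_eq_integral_Ioo]
    have e : A * (t2 - t1) = ∫ t in Ioo t1 t2, A := by
      simp [ht, mul_comm]
    rw [e, ← integral_sub (hint n) (integrable_const _)]
    by_cases hi : Integrable (deriv (f n)) (volume.restrict (Ioo t1 t2))
    · refine integral_mono hi (isub (hint n) (integrable_const _)) fun t => ?_
      have := le_max_left (deriv (f n) t + A) 0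
      simp only [hh]; linarith
    · exfalso
      apply hi
      have := (hac n).intervalIntegrable_deriv
      rw [intervalIntegrable_iff_integrableOn_Ioo_of_le ht] at this
      exact this
  have := le_of_tendsto_of_tendsto' (h2.sub h1) (hT.sub_const (A * (t2 - t1))) hle
  linarith

variable {p : ℝ → Ed d → ℝ}

def ep (n : ℕ) : ℝ := 1 / ((n:ℝ) + 1)
theorem ep_pos (n : ℕ) : 0 < ep n := by unfold ep; positivity
theorem ep_le (n : ℕ) : ep n ≤ 1 := by
  unfold ep
  rw [div_le_one (by positivity)]
  linarith [(Nat.cast_nonneg n : (0:ℝ) ≤ n)]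
theorem ep_anti : StrictAnti ep := fun i j h => by
  have : (i:ℝ) < j := by exact_mod_cast h
  unfold ep
  gcongr
theorem ep_tend : Tendsto ep atTop (𝓝 0) := tendsto_one_div_add_atTop_nhds_zero_nat

theorem en_tend (H : HF α L τ G G') {p : ℝ → Ed d → ℝ} {t : ℝ} (hp : Dn m a M b (p t)) :
    Tendsto (fun n => en G τ (ep n) p t) atTop (𝓝 (Fr G τ (p t))) := by
  have hq := fun n => q_Dn hp (ep_pos n) (ep_le n)
  have hp1 := p_Dn hp
  obtain ⟨A, hA, h⟩ := F_lip H hp1.hm hp1.ha hp1.hM hp1.hb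
  have h1 := (q_conv ep_pos ep_le ep_tend hp).const_mul A
  rw [mul_zero] at h1
  rw [tendsto_iff_dist_tendsto_zero]
  refine squeeze_zero (fun n => dist_nonneg) (fun n => ?_) h1
  rw [Real.dist_eq]
  exact h _ _ (hq n) hp1

/-- the energy decay over a time step -/
theorem step (H : HF α L τ G G') (hm : 0 < m) (ha : 0 < a) (hM : 0 < M) (hb : 0 < b) (F : Fl G' τ m a M b p) (hab : b < 2 * a)
    {r : Ed d → ℝ} {M' : ℝ} (hMM : M ≤ M') (hrm : Measurable r) (hr0 : ∀ x, 0 ≤ r x) (hru : ∀ x, r x ≤ M' * kk b x) (hr1 : ∫ x, r x = 1)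
    {t1 t2 Δ : ℝ} (ht1 : 0 ≤ t1) (ht : t1 ≤ t2) (hΔ0 : 0 < Δ)
    (hΔ : ∀ t ∈ Ioo t1 t2, Δ ≤ ∫ x, ff G' τ (p t) x * (p t x - r x)) :
    Fr G τ (p t2) - Fr G τ (p t1) ≤ - (8 * m / (π ^ 2 * a * M' ^ 2 * JC d a b) * Δ ^ 2) * (t2 - t1) := by
  have hJ : 0 < JC d a b := JC_pos ha hb hab
  have hM' : 0 < M' := hM.trans_le hMM
  obtain ⟨W, hW0, hW⟩ := Le_unif (G := G) H hm ha hM hb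
  set Q := π ^ 2 * a * M' ^ 2 * JC d a b with hQ
  have hQ0 : 0 < Q := by positivity
  have key : ∀ A, 0 ≤ A → Q * A < 8 * m * Δ ^ 2 → Fr G τ (p t2) - Fr G τ (p t1) ≤ - A * (t2 - t1) := by
    intro A hA hAQ
    refine calc_step (f := fun n => en G τ (ep n) p) (l := fun n t => Le G' τ (ep n) (p t)) ht hA (fun n => ?_)
      (en_tend H (F.dn _ ht1)) (en_tend H (F.dn _ (ht1.trans ht))) (fun n => ?_) hW0 (fun n t htt => ?_) (fun t htt => ?_)
    · obtain ⟨K, hK⟩ := en_lip H hm ha hM hb F (ep_pos n) (ep_le n)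
      exact ⟨K, hK.mono fun x hx => ht1.trans hx.1⟩
    · rcases ht.eq_or_lt with h | h
      · subst h; simp
      filter_upwards [en_deriv H hm ha hM hb F (ep_pos n) (ep_le n) (T := t2) (ht1.trans_lt h)] with t h htt
      exact h ⟨ht1.trans_lt htt.1, htt.2⟩
    · exact hW _ _ (F.dn t (ht1.trans htt.1.le)) (ep_pos n) (ep_le n)
    · exact ev_Le H (F.dn t (ht1.trans htt.1.le)) hab ep_pos ep_le ep_tend ep_anti hMM hrm hr0 hru hr1 hΔ0.le (hΔ t htt) hAQ
  have h := hΔ0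
  set A1 := 8 * m / Q * Δ ^ 2 with hA1
  have hA1' : Q * A1 = 8 * m * Δ ^ 2 := by rw [hA1]; field_simp
  have hA1p : 0 < A1 := by positivity
  have hT : Tendsto (fun n : ℕ => - (A1 * (1 - ep n)) * (t2 - t1)) atTop (𝓝 (-(A1 * (1 - 0)) * (t2 - t1))) :=
    (((ep_tend.const_sub 1).const_mul A1).neg).mul_const _
  have := ge_of_tendsto' hT fun n => key (A1 * (1 - ep n)) (mul_nonneg hA1p.le (by linarith [ep_le n])) (by
    rw [← mul_assoc, hA1']
    nlinarith [ep_pos n, mul_pos (mul_pos (mul_pos (by norm_num : (0:ℝ) < 8) hm) (pow_pos h 2)) (ep_pos n)])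
  simpa using this
end D5
end ModD5

section ModF1
section F1
open Filter Topology
variable {d : ℕ} {m a M b ε : ℝ}
variable {α L τ : ℝ} {G : Measure (Ed d) → ℝ} {G' : Measure (Ed d) → Ed d → ℝ} {p : ℝ → Ed d → ℝ}

/-- a discrete comparison argument -/
theorem ode {g : ℝ → ℝ} {K : ℝ} (hK : 0 < K) (hg0 : ∀ t, 0 ≤ t → 0 ≤ g t) (hanti : ∀ s t, 0 ≤ s → s ≤ t → g t ≤ g s)
    (hstep : ∀ s t, 0 ≤ s → s ≤ t → g t - g s ≤ - (2 * K * g t ^ 2) * (t - s)) {t : ℝ} (ht : 0 ≤ t) :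
    g t ≤ ((g 0)⁻¹ + K * t)⁻¹ := by
  have h00 := hg0 0 le_rfl
  rcases (hg0 t ht).eq_or_lt with h | h
  · rw [← h]; positivity
  have hpos : ∀ s, 0 ≤ s → s ≤ t → 0 < g s := fun s hs hst => h.trans_le (hanti s t hs hst)
  have hgp := hpos 0 le_rfl ht
  have one : ∀ s u, 0 ≤ s → s ≤ u → u ≤ t → K * (u - s) * g 0 ≤ 1 → (g s)⁻¹ + K * (u - s) ≤ (g u)⁻¹ := by
    intro s u hs hsu hut hsm
    have hx := hpos u (hs.trans hsu) hut
    have hy := hpos s hs (hsu.trans hut)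
    have hst := hstep s u hs hsu
    have hy0 := hanti 0 s le_rfl hs
    have hkh : 0 ≤ K * (u - s) := mul_nonneg hK.le (by linarith)
    have e : -(2 * K * g u ^ 2) * (u - s) = - (2 * (K * (u - s)) * g u ^ 2) := by ring
    rw [e] at hst
    generalize K * (u - s) = k at *
    have hw : g u + k * (g u * g s) ≤ g s := by
      rcases le_total (g s) (2 * g u) with h1 | h1
      · have : k * (g u * g s) ≤ k * (g u * (2 * g u)) := by gcongr
        nlinarith
      · have h2 : k * g s ≤ 1 := (mul_le_mul_of_nonneg_left hy0 hkh).trans hsm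
        nlinarith [mul_le_mul_of_nonneg_left h2 hx.le]
    have e2 : (g s)⁻¹ + k = (g u + k * (g u * g s)) / (g u * g s) := by field_simp
    have e3 : (g u)⁻¹ = g s / (g u * g s) := by field_simp
    rw [e2, e3]
    exact div_le_div_of_nonneg_right hw (by positivity)
  obtain ⟨n, hn⟩ := exists_nat_gt (K * t * g 0)
  have hn0 : 0 < (n:ℝ) := lt_of_le_of_lt (by positivity) hn
  have hh : 0 ≤ t / n := by positivity
  have ind : ∀ k : ℕ, k ≤ n → (g 0)⁻¹ + K * (k * (t / n)) ≤ (g (k * (t / n)))⁻¹ := by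
    intro k
    induction k with
    | zero => intro _; simp
    | succ k ih =>
      intro hk
      have h1 := ih (by omega)
      have h2 := one (k * (t / n)) ((k + 1 : ℕ) * (t / n)) (by positivity) (by push_cast; nlinarith) (by
        have : ((k + 1 : ℕ) : ℝ) ≤ n := by exact_mod_cast hk
        calc ((k + 1 : ℕ) : ℝ) * (t / n) ≤ n * (t / n) := by gcongr
          _ = t := by field_simp) (by
        have e : K * (((k + 1 : ℕ) : ℝ) * (t / n) - k * (t / n)) * g 0 = K * t * g 0 / n := by
          push_cast; field_simp; ring
        rw [e, div_le_one hn0]; exact hn.le)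
      have e : K * (((k + 1 : ℕ) : ℝ) * (t / n) - k * (t / n)) = K * (((k + 1 : ℕ) : ℝ) * (t / n)) - K * (k * (t / n)) := by ring
      linarith
  have := ind n le_rfl
  have e : (n:ℝ) * (t / n) = t := by field_simp
  rw [e] at this
  have hl : 0 < (g 0)⁻¹ + K * t := by positivity
  rw [← inv_inv (g t)]
  exact inv_anti₀ hl this

/-- truncation of a density under a Gaussian -/
theorem trunc {r : Ed d → ℝ} (hr : Pd r) (hb : 0 < b) {η : ℝ} (hη : 0 < η) :
    ∃ (r' : Ed d → ℝ) (N : ℝ), Pd r' ∧ (∀ x, r' x ≤ N * kk b x) ∧ ∫ x, om x * |r x - r' x| ≤ η := by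
  have hk := fun x : Ed d => kk_pos hb x
  set u : ℕ → Ed d → ℝ := fun n x => min (r x) (n * kk b x) with hu
  have hum : ∀ n, Measurable (u n) := fun n => hr.meas.min ((kk_cont b).measurable.const_mul _)
  have hu0 : ∀ n x, 0 ≤ u n x := fun n x => le_min (hr.nn x) (mul_nonneg (Nat.cast_nonneg n) (hk x).le)
  have hur : ∀ n x, u n x ≤ r x := fun n x => min_le_left _ _
  have hut : ∀ x, Tendsto (fun n => u n x) atTop (𝓝 (r x)) := fun x => by
    obtain ⟨n0, hn0⟩ := exists_nat_ge (r x / kk b x)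
    refine tendsto_const_nhds.congr' ?_
    filter_upwards [eventually_ge_atTop n0] with n hn
    refine (min_eq_left ?_).symm
    rw [← div_le_iff₀ (hk x)]
    exact hn0.trans (by exact_mod_cast hn)
  have hi : ∀ n, Integrable (fun x => om x * u n x) := fun n =>
    hr.int_om.mono' (om_cont.measurable.mul (hum n)).aestronglyMeasurable (Eventually.of_forall fun x => by
      rw [Real.norm_eq_abs, abs_of_nonneg (mul_nonneg (om_pos x).le (hu0 n x))]
      exact mul_le_mul_of_nonneg_left (hur n x) (om_pos x).le)
  have hi1 : ∀ n, Integrable (u n) := fun n =>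
    hr.int.mono' (hum n).aestronglyMeasurable (Eventually.of_forall fun x => by
      rw [Real.norm_eq_abs, abs_of_nonneg (hu0 n x)]; exact hur n x)
  have T1 : Tendsto (fun n => ∫ x, om x * u n x) atTop (𝓝 (∫ x, om x * r x)) := by
    refine tendsto_integral_of_dominated_convergence (fun x => om x * r x) (fun n => (hi n).1) hr.int_om
      (fun n => Eventually.of_forall fun x => ?_) (Eventually.of_forall fun x => (hut x).const_mul _)
    rw [Real.norm_eq_abs, abs_of_nonneg (mul_nonneg (om_pos x).le (hu0 n x))]
    exact mul_le_mul_of_nonneg_left (hur n x) (om_pos x).le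
  have T2 : Tendsto (fun n => ∫ x, u n x) atTop (𝓝 1) := by
    rw [← hr.mass]
    refine tendsto_integral_of_dominated_convergence r (fun n => (hi1 n).1) hr.int
      (fun n => Eventually.of_forall fun x => ?_) (Eventually.of_forall fun x => hut x)
    rw [Real.norm_eq_abs, abs_of_nonneg (hu0 n x)]
    exact hur n x
  have hkom : Integrable (fun x : Ed d => om x * kk b x) := by simpa using om_kk_int (d := d) 1 hb
  set B := ∫ x : Ed d, om x * kk b x with hB
  have T : Tendsto (fun n => ((∫ x, om x * r x) - ∫ x, om x * u n x) + (1 - ∫ x, u n x) * B) atTop (𝓝 (((∫ x, om x * r x) - ∫ x, om x * r x) + (1 - 1) * B)) :=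
    (T1.const_sub _).add ((T2.const_sub 1).mul_const B)
  have e0 : ((∫ x, om x * r x) - ∫ x, om x * r x) + (1 - 1) * B = 0 := by ring
  rw [e0] at T
  obtain ⟨n, hn⟩ := (T.eventually (gt_mem_nhds hη)).exists
  set c := 1 - ∫ x, u n x with hc
  have hc0 : 0 ≤ c := by
    have := integral_mono (hi1 n) hr.int (hur n)
    rw [hr.mass] at this
    linarith
  have hIr : Integrable (fun x => om x * u n x + c * (om x * kk b x)) := iadd (hi n) (hkom.const_mul c)
  refine ⟨fun x => u n x + c * kk b x, n + c, ⟨?_, ?_, ?_, ?_⟩, ?_, ?_⟩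
  · exact (hum n).add ((kk_cont b).measurable.const_mul c)
  · exact fun x => add_nonneg (hu0 n x) (mul_nonneg hc0 (hk x).le)
  · exact hIr.congr (Eventually.of_forall fun x => by simp only; ring)
  · rw [integral_add (hi1 n) ((kk_int hb).const_mul c), integral_const_mul, kk_integral hb]
    rw [hc]; ring
  · intro x
    have : u n x ≤ n * kk b x := min_le_right _ _
    simp only; linarith
  · have hle : ∫ x, om x * |r x - (u n x + c * kk b x)| ≤ ∫ x, ((om x * r x - om x * u n x) + c * (om x * kk b x)) := by
      refine integral_mono_of_nonneg (Eventually.of_forall fun x => mul_nonneg (om_pos x).le (abs_nonneg _))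
        (iadd (isub hr.int_om (hi n)) (hkom.const_mul c)) (Eventually.of_forall fun x => ?_)
      have h1 : |r x - (u n x + c * kk b x)| ≤ (r x - u n x) + c * kk b x := by
        have := hur n x
        have := mul_nonneg hc0 (hk x).le
        rw [abs_le]; constructor <;> linarith
      have := mul_le_mul_of_nonneg_left h1 (om_pos x).le
      simp only
      linarith
    rw [integral_add (isub hr.int_om (hi n)) (hkom.const_mul c), integral_sub hr.int_om (hi n), integral_const_mul] at hle
    exact hle.trans hn.le

/-- the energy converges to its infimum -/
theorem conv_inf (H : HF α L τ G G') (hm : 0 < m) (ha : 0 < a) (hM : 0 < M) (hb : 0 < b) (F : Fl G' τ m a M b p) (hab : b < 2 * a)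
    {r : Ed d → ℝ} (hr : Pd r) (hi : Integrable (fun x => r x * Real.log (r x))) {θ : ℝ} (hθ : 0 < θ) :
    ∃ t, 0 ≤ t ∧ Fr G τ (p t) ≤ Fr G τ r + 2 * θ := by
  by_contra hc
  push Not at hc
  obtain ⟨A, hA, hAb⟩ := ff_bound (τ := τ) H hm ha hM hb
  obtain ⟨r', N, hr', hN, hclose⟩ := trunc hr hb (η := θ / (A + 1)) (by positivity)
  have hbd : ∀ t, 0 ≤ t → θ ≤ ∫ x, ff G' τ (p t) x * (p t x - r' x) := by
    intro t ht
    have hp := F.dn t ht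
    have hfm : Measurable (ff G' τ (p t)) := (H.ff_pg hp).1
    have hfb := hAb (p t) hp
    have I1 := pd_om_int hp.pd hfm hfb
    have I2 := pd_om_int hr hfm hfb
    have I3 := pd_om_int hr' hfm hfb
    have h1 := tangent H hp hr hi
    have h2 := hc t ht
    have J1 : ∫ x, ff G' τ (p t) x * (r x - p t x) = (∫ x, ff G' τ (p t) x * r x) - ∫ x, ff G' τ (p t) x * p t x := by
      rw [← integral_sub I2 I1]; congr 1; ext x; ring
    have J2 : ∫ x, ff G' τ (p t) x * (p t x - r' x) = (∫ x, ff G' τ (p t) x * p t x) - ∫ x, ff G' τ (p t) x * r' x := by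
      rw [← integral_sub I1 I3]; congr 1; ext x; ring
    have J3 : ∫ x, ff G' τ (p t) x * (r x - r' x) = (∫ x, ff G' τ (p t) x * r x) - ∫ x, ff G' τ (p t) x * r' x := by
      rw [← integral_sub I2 I3]; congr 1; ext x; ring
    have I4 : Integrable (fun x => ff G' τ (p t) x * (r x - r' x)) :=
      (isub I2 I3).congr (Eventually.of_forall fun x => by simp only; ring)
    have hz : ∫ x, (r x - r' x) = 0 := by rw [integral_sub hr.int hr'.int, hr.mass, hr'.mass, sub_self]
    have J4 := int_shift I4 (isub hr.int hr'.int) hz (G' (wd (p t)) 0)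
    have Iom : Integrable (fun x => om x * |r x - r' x|) := by
      refine (isub hr.int_om hr'.int_om).abs.congr (Eventually.of_forall fun x => ?_)
      simp only
      rw [← mul_sub, abs_mul, abs_of_pos (om_pos x)]
    have J5 : |∫ x, (ff G' τ (p t) x - G' (wd (p t)) 0) * (r x - r' x)| ≤ ∫ x, A * (om x * |r x - r' x|) := by
      refine abs_int_le (Iom.const_mul A) fun x => ?_
      rw [abs_mul, ← mul_assoc]
      exact mul_le_mul_of_nonneg_right (hfb x) (abs_nonneg _)
    rw [integral_const_mul] at J5
    have J6 : A * ∫ x, om x * |r x - r' x| ≤ θ := by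
      calc A * ∫ x, om x * |r x - r' x| ≤ (A + 1) * (θ / (A + 1)) :=
            mul_le_mul (by linarith) hclose (integral_nonneg fun x => mul_nonneg (om_pos x).le (abs_nonneg _)) (by positivity)
        _ = θ := by field_simp
    have := (abs_le.1 J5).1
    linarith
  have hJ : 0 < JC d a b := JC_pos ha hb hab
  set M' := max M N with hM'
  have hM'0 : 0 < M' := hM.trans_le (le_max_left _ _)
  set c := 8 * m / (π ^ 2 * a * M' ^ 2 * JC d a b) * θ ^ 2 with hcd
  have hc0 : 0 < c := by positivity
  have hdec : ∀ T, 0 ≤ T → Fr G τ (p T) - Fr G τ (p 0) ≤ - c * (T - 0) := fun T hT =>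
    step H hm ha hM hb F hab (le_max_left M N) hr'.meas hr'.nn
      (fun x => (hN x).trans (mul_le_mul_of_nonneg_right (le_max_right _ _) (kk_pos hb x).le)) hr'.mass le_rfl hT hθ
      (fun t ht => hbd t ht.1.le)
  set T := (|Fr G τ (p 0) - Fr G τ r| + 1) / c with hT
  have hT0 : 0 ≤ T := by positivity
  have h1 := hdec T hT0
  have h2 := hc T hT0
  have h3 : c * T = |Fr G τ (p 0) - Fr G τ r| + 1 := by rw [hT]; field_simp
  have h4 := le_abs_self (Fr G τ (p 0) - Fr G τ r)
  have h5 : -c * (T - 0) = -(c * T) := by ring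
  linarith

theorem m_le_one {q : Ed d → ℝ} (h : Dn m a M b q) : m ≤ 1 := by
  have := integral_mono ((kk_int h.ha).const_mul m) h.gb.integrable h.lb
  rwa [integral_const_mul, kk_integral h.ha, h.mass, mul_one] at this

/-- the rate in terms of densities -/
theorem rate (H : HF α L τ G G') (hm : 0 < m) (ha : 0 < a) (hM : 0 < M) (hb : 0 < b) (F : Fl G' τ m a M b p) (hab : b < 2 * a)
    (hanti : ∀ s t, 0 ≤ s → s ≤ t → Fr G τ (p t) ≤ Fr G τ (p s)) {I : ℝ} (hI : ∀ t, 0 ≤ t → I ≤ Fr G τ (p t))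
    (hI2 : ∀ θ, 0 < θ → ∃ r, Pd r ∧ Integrable (fun x => r x * Real.log (r x)) ∧ Fr G τ r < I + θ) {t : ℝ} (ht : 0 ≤ t) :
    Fr G τ (p t) - I ≤ ((Fr G τ (p 0) - I)⁻¹ + m ^ 2 / (4 * JC d a b * M ^ 2 * a) * t)⁻¹ := by
  have hJ : 0 < JC d a b := JC_pos ha hb hab
  have hm1 : m ≤ 1 := m_le_one (F.dn 0 le_rfl)
  refine ode (g := fun t => Fr G τ (p t) - I) (by positivity) (fun t ht => sub_nonneg.2 (hI t ht))
    (fun s t hs hst => sub_le_sub_right (hanti s t hs hst) _) (fun s t hs hst => ?_) ht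
  have ht0 := hs.trans hst
  set g := Fr G τ (p t) - I with hg
  set K := m ^ 2 / (4 * JC d a b * M ^ 2 * a) with hK
  set K2 := 8 * m / (π ^ 2 * a * M ^ 2 * JC d a b) with hK2
  have hKK : 2 * K ≤ K2 := by
    have hpi : π ^ 2 ≤ 16 := by nlinarith [Real.pi_le_four, Real.pi_pos]
    have e1 : 2 * K = m * m / (2 * (a * M ^ 2 * JC d a b)) := by rw [hK]; field_simp; norm_num
    have e2 : K2 = 8 * m / (π ^ 2 * (a * M ^ 2 * JC d a b)) := by rw [hK2]; congr 1; ring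
    rw [e1, e2, div_le_div_iff₀ (by positivity) (by positivity)]
    have : m * π ^ 2 ≤ 1 * 16 := by gcongr
    have h0 : 0 < m * (a * M ^ 2 * JC d a b) := by positivity
    nlinarith
  have hg0 : 0 ≤ g := sub_nonneg.2 (hI t ht0)
  have hend : Fr G τ (p t) - Fr G τ (p s) ≤ - (K2 * g ^ 2) * (t - s) := by
    rcases hg0.eq_or_lt with h | h
    · rw [← h]
      have := hanti s t hs hst
      simp; linarith
    have key : ∀ θ, 0 < θ → θ < g → Fr G τ (p t) - Fr G τ (p s) ≤ - (K2 * (g - θ) ^ 2) * (t - s) := by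
      intro θ hθ hθg
      obtain ⟨r, hr, hi, hrI⟩ := hI2 (θ / 3) (by positivity)
      obtain ⟨S, hS, hSr⟩ := conv_inf H hm ha hM hb F hab hr hi (θ := θ / 3) (by positivity)
      have hd := F.dn S hS
      refine step H hm ha hM hb F hab le_rfl hd.meas (fun x => (hd.pos x).le) hd.ub hd.mass hs hst (sub_pos.2 hθg) fun v hv => ?_
      have hv0 : 0 ≤ v := hs.trans hv.1.le
      have h1 := tangent H (F.dn v hv0) hd.pd hd.ent_int
      have h2 := hanti v t hv0 hv.2.le
      have e : ∫ x, ff G' τ (p v) x * (p v x - p S x) = - ∫ x, ff G' τ (p v) x * (p S x - p v x) := by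
        rw [← integral_neg]; congr 1; ext x; ring
      rw [e]
      linarith
    have hT : Tendsto (fun n : ℕ => - (K2 * (g - g * (ep (n+1))) ^ 2) * (t - s)) atTop (𝓝 (- (K2 * (g - g * 0) ^ 2) * (t - s))) :=
      ((((((ep_tend.comp (tendsto_add_atTop_nat 1)).const_mul g).const_sub g).pow 2).const_mul K2).neg).mul_const _
    have := ge_of_tendsto' hT fun n => key (g * ep (n+1)) (mul_pos h (ep_pos _)) (by
      have : ep (n+1) < ep 0 := ep_anti (by omega)
      have h1 : ep 0 = 1 := by simp [ep]
      nlinarith)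
    simpa using this
  have h3 : 2 * K * g ^ 2 * (t - s) ≤ K2 * g ^ 2 * (t - s) := by
    have : 0 ≤ t - s := by linarith
    gcongr
  linarith
end F1
end ModF1

section ModF2
section F2
open Filter Topology
variable {d : ℕ} {m a M b : ℝ}

/-- a measurable version of the density obeying the bounds -/
theorem exists_p (hm : 0 < m) (ha : 0 < a) (hM : 0 < M) (hb : 0 < b) {μ : Measure (Ed d)} (hμ : IsProbabilityMeasure μ)
    {ρ : Ed d → ℝ} (h : μ = volume.withDensity (fun x => ENNReal.ofReal (ρ x)))
    (hl : ∀ x, m * kk a x ≤ ρ x) (hu : ∀ x, ρ x ≤ M * kk b x) : ∃ p, Dn m a M b p ∧ μ = wd p := by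
  obtain ⟨g, hgm, hgf, hg⟩ := exists_measurable_le_withDensity_eq (volume : Measure (Ed d)) (fun x => ENNReal.ofReal (ρ x))
  have hkm : Measurable (fun x : Ed d => m * kk a x) := (kk_cont a).measurable.const_mul m
  have hgl : (fun x => ENNReal.ofReal (m * kk a x)) ≤ᵐ[volume] g := by
    refine ae_le_of_forall_setLIntegral_le_of_sigmaFinite hkm.ennreal_ofReal fun s hs _ => ?_
    have e : ∫⁻ x in s, g x = ∫⁻ x in s, ENNReal.ofReal (ρ x) := by
      rw [← withDensity_apply _ hs, hg, withDensity_apply _ hs]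
    rw [e]
    exact lintegral_mono fun x => ENNReal.ofReal_le_ofReal (hl x)
  set p : Ed d → ℝ := fun x => max (m * kk a x) (g x).toReal with hp
  have hpm : Measurable p := hkm.max hgm.ennreal_toReal
  have hpl : ∀ x, m * kk a x ≤ p x := fun x => le_max_left _ _
  have hgt : ∀ x, g x ≠ ⊤ := fun x => ne_top_of_le_ne_top ENNReal.ofReal_ne_top (hgf x)
  have hpu : ∀ x, p x ≤ M * kk b x := fun x => by
    refine max_le ((hl x).trans (hu x)) ?_
    have h0 : 0 ≤ ρ x := (mul_pos hm (kk_pos ha x)).le.trans (hl x)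
    have := ENNReal.toReal_mono ENNReal.ofReal_ne_top (hgf x)
    rw [ENNReal.toReal_ofReal h0] at this
    exact this.trans (hu x)
  have hpg : (fun x => ENNReal.ofReal (p x)) =ᵐ[volume] g := by
    filter_upwards [hgl] with x hx
    have h1 : m * kk a x ≤ (g x).toReal := by
      rwa [ENNReal.ofReal_le_iff_le_toReal (hgt x)] at hx
    simp only [hp, max_eq_right h1]
    exact ENNReal.ofReal_toReal (hgt x)
  have hwd : μ = wd p := by
    rw [h, ← hg]; exact (withDensity_congr_ae hpg).symm
  have hp0 : ∀ x, 0 ≤ p x := fun x => (mul_pos hm (kk_pos ha x)).le.trans (hpl x)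
  refine ⟨p, ⟨hpm, hm, ha, hM, hb, hpl, hpu, ?_⟩, hwd⟩
  have := wd_integral hpm hp0 (fun _ => (1:ℝ))
  rw [← hwd] at this
  simpa using this.symm

theorem main_aux (d : ℕ) (α L τ σ₁ σ₂ m M : ℝ)
    (hα : 0 < α) (hL : 0 < L) (hτ : 0 < τ)
    (hσ₁ : 0 < σ₁) (hσ : σ₁ ≤ σ₂) (hσ' : σ₂ < Real.sqrt 2 * σ₁) (hm : 0 < m) (hM : 0 < M)
    (G : Measure (Ed d) → ℝ) (G' : Measure (Ed d) → Ed d → ℝ)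
    (μ : ℝ → Measure (Ed d)) (ρ : ℝ → Ed d → ℝ)
    (hAii : AssumptionAii G G' α L)
    (hconv : ConvexFun (obj G τ))
    (hflow : IsWGF G G' τ μ ρ)
    (h0 : μ 0 = volume.withDensity (fun x => ENNReal.ofReal (ρ 0 x)))
    (hbounds : ∀ t : ℝ, 0 ≤ t → ∀ x : Ed d,
      m * gaussDen d σ₁ x ≤ ρ t x ∧ ρ t x ≤ M * gaussDen d σ₂ x) (t : ℝ) (ht : 0 ≤ t) :
      gap G τ μ t ≤ ((gap G τ μ 0)⁻¹ + m ^ 2 * t / (4 * JC d (σ₁ ^ 2) (σ₂ ^ 2) * M ^ 2 * σ₁ ^ 2))⁻¹ := by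
  have H : HF α L τ G G' := ⟨hα, hL, hτ, hAii, hconv⟩
  have hσ₂ : 0 < σ₂ := hσ₁.trans_le hσ
  have ha : 0 < σ₁ ^ 2 := by positivity
  have hb : 0 < σ₂ ^ 2 := by positivity
  have hab : σ₂ ^ 2 < 2 * σ₁ ^ 2 := by
    calc σ₂ ^ 2 < (Real.sqrt 2 * σ₁) ^ 2 := by gcongr
      _ = 2 * σ₁ ^ 2 := by rw [mul_pow, Real.sq_sqrt (by norm_num)]
  have hJ := JC_pos (d := d) ha hb hab
  have hden : ∀ t, 0 ≤ t → μ t = volume.withDensity (fun x => ENNReal.ofReal (ρ t x)) := fun t ht => by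
    rcases ht.eq_or_lt with h | h
    · rw [← h]; exact h0
    · exact hflow.density_eq t h
  have hex : ∀ t, ∃ p, 0 ≤ t → Dn m (σ₁ ^ 2) M (σ₂ ^ 2) p ∧ μ t = wd p := fun t => by
    by_cases ht : 0 ≤ t
    · obtain ⟨p, hp⟩ := exists_p hm ha hM hb (hflow.isP2 t ht).1 (hden t ht)
        (fun x => (hbounds t ht x).1) (fun x => (hbounds t ht x).2)
      exact ⟨p, fun _ => hp⟩
    · exact ⟨0, fun h => absurd h ht⟩
  choose p hp using hex
  have hn : ∀ t, 0 ≤ t → ∀ x, 0 ≤ p t x := fun t ht x => ((hp t ht).1.pos x).le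
  have F : Fl G' τ m (σ₁ ^ 2) M (σ₂ ^ 2) p := by
    refine ⟨fun t ht => (hp t ht).1, fun φ hφ hs t₁ t₂ h1 h2 => ?_⟩
    have e := hflow.pde φ hφ hs t₁ t₂ h1 h2
    have h3 := h1.trans h2
    rw [(hp t₁ h1).2, (hp t₂ h3).2, wd_integral (hp t₁ h1).1.meas (hn t₁ h1), wd_integral (hp t₂ h3).1.meas (hn t₂ h3)] at e
    rw [e]
    refine intervalIntegral.integral_congr fun s hs' => ?_
    rw [uIcc_of_le h2] at hs'
    have hs0 : 0 ≤ s := h1.trans hs'.1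
    rw [(hp s hs0).2, wd_integral (hp s hs0).1.meas (hn s hs0)]
    unfold lam LL
    congr 1
    ext y
    rw [EE_std hφ y]
    rfl
  have hobj : ∀ t, 0 ≤ t → obj G τ (μ t) = (Fr G τ (p t) : EReal) := fun t ht => by
    rw [(hp t ht).2]
    exact obj_wd G τ (hp t ht).1.pd (hp t ht).1.ent_int
  have hanti : ∀ s t, 0 ≤ s → s ≤ t → Fr G τ (p t) ≤ Fr G τ (p s) := fun s t hs hst => by
    rcases hst.eq_or_lt with h | h
    · rw [h]
    have e := hflow.dissipation s t hs h
    rw [hobj s hs, hobj t (hs.trans hst), EReal.toReal_coe, EReal.toReal_coe] at e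
    have : 0 ≤ ∫ s in s..t, ∫ x, ‖gradient (G' (μ s)) x + τ • gradient (fun y => Real.log (ρ s y)) x‖ ^ 2 ∂(μ s) :=
      intervalIntegral.integral_nonneg hst fun u _ => integral_nonneg fun x => by positivity
    linarith
  have hinf : ∀ t, 0 ≤ t → infObj G τ ≤ (Fr G τ (p t) : EReal) := fun t ht => by
    rw [← hobj t ht]
    exact iInf_le (fun ν : {ν : Measure (Ed d) // IsP2 ν} => obj G τ ν.1) ⟨μ t, hflow.isP2 t ht⟩
  have hC : 0 < 4 * JC d (σ₁ ^ 2) (σ₂ ^ 2) * M ^ 2 * σ₁ ^ 2 := by positivity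
  by_cases hbot : infObj G τ = ⊥
  · have hz : ∀ t, 0 ≤ t → gap G τ μ t = 0 := fun t ht => by
      unfold gap
      rw [hobj t ht, hbot, EReal.coe_sub_bot, EReal.toReal_top]
    rw [hz t ht, hz 0 le_rfl]
    positivity
  have htop : infObj G τ ≠ ⊤ := ne_top_of_le_ne_top (EReal.coe_ne_top _) (hinf 0 le_rfl)
  obtain ⟨I, hI⟩ : ∃ I : ℝ, infObj G τ = I := ⟨_, (EReal.coe_toReal htop hbot).symm⟩
  have hgap : ∀ t, 0 ≤ t → gap G τ μ t = Fr G τ (p t) - I := fun t ht => by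
    unfold gap
    rw [hobj t ht, hI, ← EReal.coe_sub, EReal.toReal_coe]
  rw [hgap t ht, hgap 0 le_rfl]
  have hr := rate H hm ha hM hb F hab hanti (I := I) (fun t ht => by
    have := hinf t ht
    rw [hI] at this
    exact_mod_cast this) (fun θ hθ => by
    have hlt : infObj G τ < ((I + θ : ℝ) : EReal) := by
      rw [hI]; exact_mod_cast (by linarith : I < I + θ)
    obtain ⟨ν, hν⟩ := iInf_lt_iff.1 hlt
    obtain ⟨r, hr, hi, hνr⟩ := exists_wd (G := G) hτ ν.2 (ne_top_of_lt hν)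
    refine ⟨r, hr, hi, ?_⟩
    rw [hνr, obj_wd G τ hr hi] at hν
    exact_mod_cast hν) ht
  have e : m ^ 2 / (4 * JC d (σ₁ ^ 2) (σ₂ ^ 2) * M ^ 2 * σ₁ ^ 2) * t = m ^ 2 * t / (4 * JC d (σ₁ ^ 2) (σ₂ ^ 2) * M ^ 2 * σ₁ ^ 2) := by ring
  rwa [e] at hr
end F2
end ModF2

/-- **Lemma 3.4**: in the convex case on `ℝ^d`, two-sided Gaussian bounds on the densities of
the flow with `σ₁ ≤ σ₂ < √2 σ₁` imply an `O(1/t)` convergence rate with explicit constant. -/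
theorem wgf_convex_principle_Rd (d : ℕ) (α L τ σ₁ σ₂ m M : ℝ)
    (hα : 0 < α) (hL : 0 < L) (hτ : 0 < τ)
    (hσ₁ : 0 < σ₁) (hσ : σ₁ ≤ σ₂) (hσ' : σ₂ < Real.sqrt 2 * σ₁) (hm : 0 < m) (hM : 0 < M)
    (G : Measure (Ed d) → ℝ) (G' : Measure (Ed d) → Ed d → ℝ)
    (μ : ℝ → Measure (Ed d)) (ρ : ℝ → Ed d → ℝ)
    (hAii : AssumptionAii G G' α L)
    (hconv : ConvexFun (obj G τ))
    (hflow : IsWGF G G' τ μ ρ)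
    (h0 : μ 0 = volume.withDensity (fun x => ENNReal.ofReal (ρ 0 x)))
    (hbounds : ∀ t : ℝ, 0 ≤ t → ∀ x : Ed d,
      m * gaussDen d σ₁ x ≤ ρ t x ∧ ρ t x ≤ M * gaussDen d σ₂ x) :
    ∀ t : ℝ, 0 ≤ t →
      gap G τ μ t ≤
        ((gap G τ μ 0)⁻¹ +
          m ^ 2 * t /
            (4 * ((2 * (σ₂ ^ 2 / σ₁ ^ 2) - (σ₂ ^ 2 / σ₁ ^ 2) ^ 2) ^ (-(d : ℝ) / 2)) *
              M ^ 2 * σ₁ ^ 2))⁻¹ := by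
  intro t ht
  exact main_aux d α L τ σ₁ σ₂ m M hα hL hτ hσ₁ hσ hσ' hm hM G G' μ ρ hAii hconv hflow h0 hbounds t ht

end
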